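/- Let a ≥ 1 and ℓ ≥ 1 be integers, let k be an odd prime, and assume 2 ≤ a ≤ (k^ℓ + 1)/2 and k(a−1) ≤ k^ℓ − 1. Then every continuous map f : ℂP^{k^ℓ−a} → ℂ^{k^ℓ−2} admits a local k-multiplicity: there exists a point x₀ ∈ ℂP^{k^ℓ−a} such that every neighborhood of x₀ contains k pairwise distinct points x_1, …, x_k with f(x_1) = ⋯ = f(x_k). -/

import Mathlib

/-- The projectivization of a topological vector space carries the quotient topology
coming from the nonzero vectors. -/
instance projectivizationTopology (K V : Type*) [DivisionRing K] [AddCommGroup V]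
    [Module K V] [TopologicalSpace V] : TopologicalSpace (Projectivization K V) :=
  inferInstanceAs (TopologicalSpace (Quotient (projectivizationSetoid K V)))

/-- A continuous map `f : X → Y` admits a local `k`-multiplicity if there is a point
`x₀` such that every neighborhood of `x₀` contains `k` pairwise distinct points with
equal images under `f`. -/
def AdmitsLocalMultiplicity {X Y : Type*} [TopologicalSpace X] [TopologicalSpace Y]
    (f : X → Y) (k : ℕ) : Prop :=
  ∃ x₀ : X, ∀ U ∈ nhds x₀, ∃ x : Fin k → X,
    Function.Injective x ∧ (∀ i, x i ∈ U) ∧ ∀ i j, f (x i) = f (x j)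

namespace FineStar

section Operators

variable {Q R : Type*} [Fintype Q] [CommRing R] (D : Matrix Q Q R)

/-- Weighting a differential by a 1-cochain. -/
def op1 (V : Q → Q → R) : Matrix Q Q R := Matrix.of fun x y => D x y * V x y

/-- Weighting the square of a differential by a 2-cochain. -/
def op2 (c : Q → Q → Q → R) : Matrix Q Q R :=
  Matrix.of fun x z => ∑ y, D x y * D y z * c x y z

/-- Weighting the cube of a differential by a 3-cochain. -/
def op3 (c : Q → Q → Q → Q → R) : Matrix Q Q R :=
  Matrix.of fun x w => ∑ y, ∑ z, D x y * D y z * D z w * c x y z w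

variable {D}

theorem sum_mul_eq_zero_of_sq (h : D * D = 0) (x z : Q) : ∑ y, D x y * D y z = 0 := by
  have := congrFun (congrFun h x) z
  simpa [Matrix.mul_apply] using this

theorem op1_coboundary (h : D * D = 0) (V : Q → Q → R) :
    D * op1 D V + op1 D V * D = op2 D fun x y z => V y z - V x z + V x y := by
  ext x z
  have h0 : ∑ y, D x y * D y z * V x z = 0 := by
    rw [← Finset.sum_mul, sum_mul_eq_zero_of_sq h, zero_mul]
  simp only [Matrix.add_apply, Matrix.mul_apply, op1, op2, Matrix.of_apply]
  rw [← Finset.sum_add_distrib, ← sub_zero (∑ y, _), ← h0, ← Finset.sum_sub_distrib]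
  exact Finset.sum_congr rfl fun y _ => by ring

theorem op2_zero : op2 D (fun _ _ _ => 0) = 0 := by
  ext; simp [op2]

theorem op2_add (c c' : Q → Q → Q → R) :
    op2 D (fun x y z => c x y z + c' x y z) = op2 D c + op2 D c' := by
  ext; simp [op2, mul_add, Finset.sum_add_distrib]

theorem op2_smul (r : R) (c : Q → Q → Q → R) :
    op2 D (fun x y z => r * c x y z) = r • op2 D c := by
  ext
  simp only [op2, Matrix.of_apply, Matrix.smul_apply, smul_eq_mul, Finset.mul_sum]
  exact Finset.sum_congr rfl fun y _ => by ring

theorem op1_anticomm (h : D * D = 0) {V : Q → Q → R}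
    (hV : ∀ x y z, V y z - V x z + V x y = 0) : D * op1 D V = - (op1 D V * D) := by
  rw [eq_neg_iff_add_eq_zero, op1_coboundary h]
  simp only [hV]
  exact op2_zero

theorem op2_comm (h : D * D = 0) {c : Q → Q → Q → R}
    (hc : ∀ x y z w, c y z w - c x z w + c x y w - c x y z = 0) :
    D * op2 D c = op2 D c * D := by
  ext x w
  have h1 : ∑ y, ∑ z, D x y * D y z * D z w * c x z w = 0 := by
    rw [Finset.sum_comm]
    refine Finset.sum_eq_zero fun z _ => ?_
    rw [← Finset.sum_mul, ← Finset.sum_mul, sum_mul_eq_zero_of_sq h, zero_mul, zero_mul]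
  have h2 : ∑ y, ∑ z, D x y * D y z * D z w * c x y w = 0 := by
    refine Finset.sum_eq_zero fun y _ => ?_
    rw [Finset.sum_congr rfl fun z _ => show _ =
        (D x y * c x y w) * (D y z * D z w) by ring,
      ← Finset.mul_sum, sum_mul_eq_zero_of_sq h, mul_zero]
  have e1 : (D * op2 D c) x w = ∑ y, ∑ z, D x y * D y z * D z w * c y z w := by
    simp only [Matrix.mul_apply, op2, Matrix.of_apply, Finset.mul_sum]
    exact Finset.sum_congr rfl fun y _ => Finset.sum_congr rfl fun z _ => by ring
  have e2 : (op2 D c * D) x w = ∑ y, ∑ z, D x y * D y z * D z w * c x y z := by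
    simp only [Matrix.mul_apply, op2, Matrix.of_apply, Finset.sum_mul]
    rw [Finset.sum_comm]
    exact Finset.sum_congr rfl fun y _ => Finset.sum_congr rfl fun z _ => by ring
  rw [e1, e2]
  calc _ = (∑ y, ∑ z, D x y * D y z * D z w * c x y z)
        + (∑ y, ∑ z, D x y * D y z * D z w * c x z w)
        - (∑ y, ∑ z, D x y * D y z * D z w * c x y w) := by
        simp only [← Finset.sum_add_distrib, ← Finset.sum_sub_distrib]
        refine Finset.sum_congr rfl fun y _ => Finset.sum_congr rfl fun z _ => ?_
        linear_combination (D x y * D y z * D z w) * hc x y z w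
    _ = _ := by rw [h1, h2]; ring

/-- The 3-cochain giving the homotopy between the two products of 2-cocycles. -/
def cupOne (c c' : Q → Q → Q → R) (x y z w : Q) : R :=
  c x y w * c' y z w - c x z w * c' x y z

theorem op2_mul_comm_homotopy (h : D * D = 0) {c c' : Q → Q → Q → R}
    (hc : ∀ x y z w, c y z w - c x z w + c x y w - c x y z = 0)
    (hc' : ∀ x y z w, c' y z w - c' x z w + c' x y w - c' x y z = 0) :
    op2 D c * op2 D c' - op2 D c' * op2 D c =
      D * op3 D (cupOne c c') + op3 D (cupOne c c') * D := by
  ext x v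
  set κ := cupOne c c' with hκ
  have prod : ∀ a b : Q → Q → Q → R, (op2 D a * op2 D b) x v =
      ∑ y, ∑ z, ∑ w, D x y * D y z * D z w * D w v * (a x y z * b z w v) := by
    intro a b
    simp only [Matrix.mul_apply, op2, Matrix.of_apply, Finset.sum_mul_sum]
    rw [Finset.sum_comm]
    exact Finset.sum_congr rfl fun y _ => Finset.sum_congr rfl fun z _ =>
      Finset.sum_congr rfl fun w _ => by ring
  have e1 : (D * op3 D κ) x v =
      ∑ y, ∑ z, ∑ w, D x y * D y z * D z w * D w v * κ y z w v := by
    simp only [Matrix.mul_apply, op3, Matrix.of_apply, Finset.mul_sum]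
    exact Finset.sum_congr rfl fun y _ => Finset.sum_congr rfl fun z _ =>
      Finset.sum_congr rfl fun w _ => by ring
  have e2 : (op3 D κ * D) x v =
      ∑ y, ∑ z, ∑ w, D x y * D y z * D z w * D w v * κ x y z w := by
    simp only [Matrix.mul_apply, op3, Matrix.of_apply, Finset.sum_mul]
    rw [Finset.sum_comm]
    refine Finset.sum_congr rfl fun y _ => ?_
    rw [Finset.sum_comm]
    exact Finset.sum_congr rfl fun z _ => Finset.sum_congr rfl fun w _ => by ring
  have z1 : ∑ y, ∑ z, ∑ w, D x y * D y z * D z w * D w v * κ x z w v = 0 := by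
    rw [Finset.sum_comm]
    refine Finset.sum_eq_zero fun z _ => ?_
    rw [Finset.sum_comm]
    refine Finset.sum_eq_zero fun w _ => ?_
    simp only [← Finset.sum_mul]
    rw [sum_mul_eq_zero_of_sq h]; ring
  have z2 : ∑ y, ∑ z, ∑ w, D x y * D y z * D z w * D w v * κ x y w v = 0 := by
    refine Finset.sum_eq_zero fun y _ => ?_
    rw [Finset.sum_comm]
    refine Finset.sum_eq_zero fun w _ => ?_
    rw [Finset.sum_congr rfl fun z _ => show _ =
        (D x y * D w v * κ x y w v) * (D y z * D z w) by ring,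
      ← Finset.mul_sum, sum_mul_eq_zero_of_sq h, mul_zero]
  have z3 : ∑ y, ∑ z, ∑ w, D x y * D y z * D z w * D w v * κ x y z v = 0 := by
    refine Finset.sum_eq_zero fun y _ => Finset.sum_eq_zero fun z _ => ?_
    rw [Finset.sum_congr rfl fun w _ => show _ =
        (D x y * D y z * κ x y z v) * (D z w * D w v) by ring,
      ← Finset.mul_sum, sum_mul_eq_zero_of_sq h, mul_zero]
  rw [Matrix.sub_apply, Matrix.add_apply, prod, prod, e1, e2]
  have key : ∀ y z w, c x y z * c' z w v - c' x y z * c z w v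
      = κ y z w v - κ x z w v + κ x y w v - κ x y z v + κ x y z w := by
    intro y z w
    simp only [hκ, cupOne]
    linear_combination -c' z w v * hc x y z v + c x y v * hc' y z w v + c x w v * hc' x y z w
      + c' y z w * hc x y w v - c' x y z * hc x z w v
  calc _ = (∑ y, ∑ z, ∑ w, D x y * D y z * D z w * D w v * κ y z w v)
        - (∑ y, ∑ z, ∑ w, D x y * D y z * D z w * D w v * κ x z w v)
        + (∑ y, ∑ z, ∑ w, D x y * D y z * D z w * D w v * κ x y w v)
        - (∑ y, ∑ z, ∑ w, D x y * D y z * D z w * D w v * κ x y z v)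
        + (∑ y, ∑ z, ∑ w, D x y * D y z * D z w * D w v * κ x y z w) := by
        simp only [← Finset.sum_add_distrib, ← Finset.sum_sub_distrib]
        refine Finset.sum_congr rfl fun y _ => Finset.sum_congr rfl fun z _ =>
          Finset.sum_congr rfl fun w _ => ?_
        linear_combination (D x y * D y z * D z w * D w v) * key y z w
    _ = _ := by rw [z1, z2, z3]; ring

end Operators

section PolynomialLemma

open Polynomial in
theorem prod_X_add_C_mul (k : ℕ) [Fact k.Prime] :
    (∏ j ∈ (Finset.univ : Finset (ZMod k)).erase 0,
      (X + C (C j * X) : (ZMod k)[X][X])) = X ^ (k - 1) - C (X ^ (k - 1)) := by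
  have hk : 2 ≤ k := (Fact.out : k.Prime).two_le
  have hcard : ((Finset.univ : Finset (ZMod k)).erase 0).card = k - 1 := by
    rw [Finset.card_erase_of_mem (Finset.mem_univ _), Finset.card_univ, ZMod.card]
  have hinj : Function.Injective (fun j : ZMod k => -(C j * X : (ZMod k)[X])) := by
    intro i j h
    have := congrArg (fun p => Polynomial.coeff p 1) h
    simpa using this
  have hm1 : (∏ j ∈ (Finset.univ : Finset (ZMod k)).erase 0,
      (X + C (C j * X) : (ZMod k)[X][X])).Monic :=
    monic_prod_of_monic _ _ fun j _ => monic_X_add_C _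
  have hm2 : (X ^ (k - 1) - C (X ^ (k - 1)) : (ZMod k)[X][X]).Monic :=
    monic_X_pow_sub_C _ (by omega)
  have hd1 : (∏ j ∈ (Finset.univ : Finset (ZMod k)).erase 0,
      (X + C (C j * X) : (ZMod k)[X][X])).natDegree = k - 1 := by
    rw [natDegree_prod_of_monic _ _ fun j _ => monic_X_add_C _]
    simp only [natDegree_X_add_C, Finset.sum_const, hcard, smul_eq_mul, mul_one]
  have hd2 : (X ^ (k - 1) - C (X ^ (k - 1)) : (ZMod k)[X][X]).natDegree = k - 1 :=
    natDegree_X_pow_sub_C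
  apply eq_of_degree_sub_lt_of_eval_finset_eq
    (((Finset.univ : Finset (ZMod k)).erase 0).map ⟨_, hinj⟩)
  · rw [Finset.card_map, hcard]
    refine (degree_sub_lt_left ?_ hm1.ne_zero ?_).trans_eq ?_
    · rw [degree_eq_natDegree hm1.ne_zero, degree_eq_natDegree hm2.ne_zero, hd1, hd2]
    · rw [hm1.leadingCoeff, hm2.leadingCoeff]
    · rw [degree_eq_natDegree hm1.ne_zero, hd1]
  · intro y hy
    obtain ⟨j, hj, rfl⟩ := Finset.mem_map.1 hy
    have hj0 : j ≠ 0 := (Finset.mem_erase.1 hj).1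
    rw [eval_prod, Finset.prod_eq_zero hj (by simp)]
    have he : Even (k - 1) ∨ k = 2 := by
      rcases (Fact.out : k.Prime).eq_two_or_odd' with h | h
      · exact Or.inr h
      · exact Or.inl (h.tsub_odd odd_one)
    have hf : j ^ (k - 1) = 1 := ZMod.pow_card_sub_one_eq_one hj0
    have hneg : (-1 : (ZMod k)[X]) ^ (k - 1) = 1 := by
      rcases he with h | rfl
      · exact h.neg_one_pow
      · rw [← C_1, ← C_neg, ← C_pow]; rfl
    have hC : (C j : (ZMod k)[X]) ^ (k - 1) = 1 := by rw [← C_pow, hf, C_1]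
    simp only [Function.Embedding.coeFn_mk, eval_sub, eval_pow, eval_X, eval_C]
    rw [neg_pow (C j * X), mul_pow, hneg, hC]
    ring

theorem prod_add_mul_eq {A : Type*} [CommRing A] (k : ℕ) [Fact k.Prime]
    (hk : (k : A) = 0) (x t : A) :
    (∏ j ∈ (Finset.univ : Finset (ZMod k)).erase 0, (x + j.val * t)) =
      x ^ (k - 1) - t ^ (k - 1) := by
  nontriviality A
  have : CharP A k := (CharP.charP_iff_prime_eq_zero Fact.out).2 hk
  let φ : ZMod k →+* A := ZMod.castHom (dvd_refl k) A
  have h := congrArg (Polynomial.eval₂RingHom (Polynomial.eval₂RingHom φ t) x)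
    (prod_X_add_C_mul k)
  have hφ : ∀ j : ZMod k, φ j = j.val := fun j => by
    rw [ZMod.castHom_apply, ZMod.natCast_val]
  simpa [Polynomial.eval₂_finsetProd, map_prod, hφ, Polynomial.eval₂_pow, -map_pow] using h

/-- The relation that survives in the cohomology ring. -/
theorem pow_mul_pow_eq_zero {A : Type*} [CommRing A] (k ℓ a : ℕ) [Fact k.Prime] (hk2 : 3 ≤ k)
    (hk : (k : A) = 0) (ha : 2 ≤ a) (haq : a ≤ k ^ ℓ) (x t : A)
    (hx : x ^ ((k - 1) * (a - 1) + 1) = 0)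
    (hprod : (∏ j ∈ (Finset.univ : Finset (ZMod k)).erase 0,
      (x + j.val * t)) ^ (k ^ ℓ - a + 1) = 0)
    (ht : t ^ ((k - 1) * k ^ ℓ - 1) = 0) :
    x ^ ((k - 1) * (a - 1)) * t ^ ((k - 1) * (k ^ ℓ - a + 1) - 1) = 0 := by
  rw [prod_add_mul_eq k hk] at hprod
  set q := k ^ ℓ with hq
  obtain ⟨m, rfl⟩ : ∃ m, a = m + 2 := ⟨a - 2, by omega⟩
  obtain ⟨r, rfl⟩ : ∃ r, k = r + 3 := ⟨k - 3, by omega⟩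
  obtain ⟨p, hp⟩ : ∃ p, q = m + 2 + p := ⟨q - (m + 2), by omega⟩
  rw [hp] at hprod ht ⊢
  simp only [show r + 3 - 1 = r + 2 by omega, show m + 2 - 1 = m + 1 by omega,
    show m + 2 + p - (m + 2) + 1 = p + 1 by omega] at *
  have hchoose : ∀ i, i < m + 2 + p → IsUnit (((m + 1 + p).choose i : ℕ) : A) := by
    intro i
    induction i with
    | zero => intro; simp
    | succ i ih =>
      intro hi
      have h1 := ih (by omega)
      have h2 : (((m + 2 + p).choose (i + 1) : ℕ) : A) = 0 := by
        have hd : (r + 3) ∣ (m + 2 + p).choose (i + 1) := by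
          rw [← hp, hq]
          exact (Fact.out : (r + 3).Prime).dvd_choose_pow (by omega) (by omega)
        obtain ⟨w, hw⟩ := hd
        rw [hw, Nat.cast_mul, hk, zero_mul]
      rw [show m + 2 + p = (m + 1 + p) + 1 by omega, Nat.choose_succ_succ, Nat.cast_add] at h2
      rw [← neg_eq_of_add_eq_zero_right h2]
      exact h1.neg
  set y := x ^ (r + 2) with hy
  set T := t ^ (r + 2) with hT
  have hbin : (y + (T - y)) ^ (m + 1 + p) * t ^ (r + 1) = 0 := by
    rw [add_sub_cancel, hT, ← pow_mul, ← pow_add,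
      show (r + 2) * (m + 1 + p) + (r + 1) = (r + 2) * (m + 2 + p) - 1 by
        rw [eq_comm, Nat.sub_eq_iff_eq_add (by nlinarith)]; ring]
    exact ht
  have hyT : (T - y) ^ (p + 1) = 0 := by
    rw [← neg_sub, neg_pow, hprod, mul_zero]
  have hyy : y * y ^ (m + 1) = 0 := by
    rw [hy, ← pow_mul, ← pow_add, show r + 2 + (r + 2) * (m + 1) = ((r + 2) * (m + 1) + 1) + (r + 1) by ring,
      pow_add, hx, zero_mul]
  rw [add_pow, Finset.sum_eq_single (m + 1)] at hbin
  · rw [show m + 1 + p - (m + 1) = p by omega] at hbin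
    have hu := hchoose (m + 1) (by omega)
    have h3 : y ^ (m + 1) * (T - y) ^ p = y ^ (m + 1) * T ^ p := by
      obtain ⟨w, hw⟩ := sub_dvd_pow_sub_pow (T - y) T p
      linear_combination y ^ (m + 1) * hw - w * hyy
    rw [h3] at hbin
    have h4 : (((m + 1 + p).choose (m + 1) : ℕ) : A) * (y ^ (m + 1) * T ^ p * t ^ (r + 1)) = 0 := by
      linear_combination hbin
    have h5 := hu.mul_right_eq_zero.1 h4
    rw [hy, hT, ← pow_mul, ← pow_mul, mul_assoc, ← pow_add] at h5
    rw [← h5]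
    congr 2
  · intro i hi hne
    rcases lt_or_gt_of_ne hne with h | h
    · rw [show m + 1 + p - i = (p + 1) + (m - i) by omega, pow_add (T - y), hyT]; ring
    · rw [show i = (m + 1) + 1 + (i - (m + 2)) by omega, pow_add y, pow_succ' y, hyy]; ring
  · intro h
    exact absurd (Finset.mem_range.2 (by omega)) h

end PolynomialLemma

open scoped IsMulCommutative in
theorem pow_mul_pow_eq_zero_of_commute {A : Type*} [Ring A] (k ℓ a : ℕ) [Fact k.Prime]
    (hk2 : 3 ≤ k) (hk : (k : A) = 0) (ha : 2 ≤ a) (haq : a ≤ k ^ ℓ) (x t : A) (hxt : x * t = t * x)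
    (hx : x ^ ((k - 1) * (a - 1) + 1) = 0)
    (hprod : (((Finset.univ : Finset (ZMod k)).erase 0).toList.map
      fun j => (x + j.val * t) ^ (k ^ ℓ - a + 1)).prod = 0)
    (ht : t ^ ((k - 1) * k ^ ℓ - 1) = 0) :
    x ^ ((k - 1) * (a - 1)) * t ^ ((k - 1) * (k ^ ℓ - a + 1) - 1) = 0 := by
  have : IsMulCommutative (Subring.closure {x, t}) := Subring.isMulCommutative_closure (by
    rintro x (rfl | rfl) y (rfl | rfl)
    exacts [rfl, hxt, hxt.symm, rfl])
  let x' : Subring.closure {x, t} := ⟨x, Subring.subset_closure (by simp)⟩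
  let t' : Subring.closure {x, t} := ⟨t, Subring.subset_closure (by simp)⟩
  refine congrArg Subtype.val (pow_mul_pow_eq_zero k ℓ a hk2 (A := Subring.closure {x, t})
    (Subtype.ext ?_) ha haq x' t' (Subtype.ext hx) ?_ (Subtype.ext ht))
  · exact hk
  · rw [← Finset.prod_pow, ← Finset.prod_map_toList]
    ext
    rw [SubmonoidClass.coe_list_prod, List.map_map]
    exact hprod

section HomotopyRing

variable {Q R G : Type*} [Fintype Q] [DecidableEq Q] [CommRing R]

/-- Invariance of a matrix under a family of permutations of its index set. -/
def Inv (act : G → Equiv.Perm Q) (M : Matrix Q Q R) : Prop :=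
  ∀ g x y, M (act g x) (act g y) = M x y

variable {act : G → Equiv.Perm Q}

omit [Fintype Q] [DecidableEq Q] in
theorem Inv.add {M N : Matrix Q Q R} (hM : Inv act M) (hN : Inv act N) : Inv act (M + N) :=
  fun g x y => by simp [hM g x y, hN g x y]

omit [Fintype Q] [DecidableEq Q] in
theorem Inv.neg {M : Matrix Q Q R} (hM : Inv act M) : Inv act (-M) :=
  fun g x y => by simp [hM g x y]

omit [DecidableEq Q] in
theorem Inv.mul {M N : Matrix Q Q R} (hM : Inv act M) (hN : Inv act N) : Inv act (M * N) := by
  intro g x y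
  rw [Matrix.mul_apply, Matrix.mul_apply, ← Equiv.sum_comp (act g)]
  exact Finset.sum_congr rfl fun z _ => by rw [hM, hN]

omit [Fintype Q] in
theorem Inv.one : Inv act (1 : Matrix Q Q R) :=
  fun g x y => by simp [Matrix.one_apply]

omit [Fintype Q] [DecidableEq Q] in
theorem Inv.zero : Inv act (0 : Matrix Q Q R) := fun _ _ _ => rfl

variable (act) (D : Matrix Q Q R)

/-- The invariant matrices commuting with the differential. -/
def chainSubring : Subring (Matrix Q Q R) where
  carrier := {M | Inv act M ∧ D * M = M * D}
  mul_mem' := by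
    rintro M N ⟨hM, hM'⟩ ⟨hN, hN'⟩
    exact ⟨hM.mul hN, by rw [← mul_assoc, hM', mul_assoc, hN', mul_assoc]⟩
  one_mem' := ⟨Inv.one, by simp⟩
  add_mem' := by
    rintro M N ⟨hM, hM'⟩ ⟨hN, hN'⟩
    exact ⟨hM.add hN, by rw [mul_add, add_mul, hM', hN']⟩
  zero_mem' := ⟨Inv.zero, by simp⟩
  neg_mem' := by
    rintro M ⟨hM, hcomm⟩
    exact ⟨hM.neg, by rw [mul_neg, neg_mul, hcomm]⟩

/-- The two-sided ideal of null-homotopic chain maps. -/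
def nullHomotopic : TwoSidedIdeal (chainSubring act D) :=
  TwoSidedIdeal.mk' {M | ∃ K, Inv act K ∧ (M : Matrix Q Q R) = D * K + K * D}
    ⟨0, Inv.zero, by simp⟩
    (by
      rintro x y ⟨K, hK, hx⟩ ⟨K', hK', hy⟩
      exact ⟨K + K', hK.add hK', by rw [Subring.coe_add, hx, hy, mul_add, add_mul]; abel⟩)
    (by
      rintro x ⟨K, hK, hx⟩
      exact ⟨-K, hK.neg, by rw [Subring.coe_neg, hx, mul_neg, neg_mul]; abel⟩)
    (by
      rintro x y ⟨K, hK, hy⟩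
      exact ⟨x * K, x.2.1.mul hK, by
        rw [Subring.coe_mul, hy, mul_add, ← mul_assoc, ← mul_assoc, ← x.2.2]; simp [mul_assoc]⟩)
    (by
      rintro x y ⟨K, hK, hx⟩
      exact ⟨K * y, hK.mul y.2.1, by
        rw [Subring.coe_mul, hx, add_mul, mul_assoc K D, y.2.2]; simp [mul_assoc]⟩)

/-- The quotient of the ring of invariant chain maps by the null-homotopic ones. -/
abbrev HomotopyRing := (nullHomotopic act D).ringCon.Quotient

/-- The projection to the homotopy ring. -/
def toHomotopyRing : chainSubring act D →+* HomotopyRing act D :=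
  (nullHomotopic act D).ringCon.mk'

theorem toHomotopyRing_eq_zero_iff (M : chainSubring act D) :
    toHomotopyRing act D M = 0 ↔ ∃ K, Inv act K ∧ (M : Matrix Q Q R) = D * K + K * D := by
  have h1 : toHomotopyRing act D M = 0 ↔ (nullHomotopic act D).ringCon M 0 := by
    rw [← map_zero (toHomotopyRing act D)]
    exact (nullHomotopic act D).ringCon.eq
  rw [h1, ← TwoSidedIdeal.mem_iff, nullHomotopic, TwoSidedIdeal.mem_mk']
  rfl

variable {act D}

theorem homotopy_mem_chainSubring (hD : D * D = 0) (hDi : Inv act D) {K : Matrix Q Q R}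
    (hK : Inv act K) : D * K + K * D ∈ chainSubring act D := by
  refine ⟨(hDi.mul hK).add (hK.mul hDi), ?_⟩
  rw [mul_add, add_mul, ← mul_assoc, hD, mul_assoc K D D, hD, mul_assoc]
  simp

theorem mem_chainSubring_of_homotopy (hD : D * D = 0) (hDi : Inv act D) {M N : Matrix Q Q R}
    (hN : N ∈ chainSubring act D) (h : ∃ K, Inv act K ∧ M = N + (D * K + K * D)) :
    M ∈ chainSubring act D := by
  obtain ⟨K, hK, rfl⟩ := h
  exact add_mem hN (homotopy_mem_chainSubring hD hDi hK)

theorem exists_homotopy_pow_mul_pow {k ℓ a : ℕ} [Fact k.Prime] (hk2 : 3 ≤ k)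
    (hk : (k : R) = 0) (ha : 2 ≤ a) (haq : a ≤ k ^ ℓ)
    (hD : D * D = 0) (hDi : Inv act D) {X T F : Matrix Q Q R} {Y : ZMod k → Matrix Q Q R}
    (hX : X ∈ chainSubring act D) (hT : T ∈ chainSubring act D)
    (hXT : ∃ K, Inv act K ∧ X * T - T * X = D * K + K * D)
    (hX0 : X ^ ((k - 1) * (a - 1) + 1) = 0)
    (hY : ∀ j ≠ 0, ∃ K, Inv act K ∧ Y j = (X + j.val • T) + (D * K + K * D))
    (hY0 : (((Finset.univ : Finset (ZMod k)).erase 0).toList.map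
      fun j => Y j ^ (k ^ ℓ - a + 1)).prod = 0)
    (hF : ∃ K, Inv act K ∧ F = T + (D * K + K * D))
    (hF0 : F ^ ((k - 1) * k ^ ℓ - 1) = 0) :
    ∃ K, Inv act K ∧ X ^ ((k - 1) * (a - 1)) * T ^ ((k - 1) * (k ^ ℓ - a + 1) - 1)
      = D * K + K * D := by
  set π := toHomotopyRing act D with hπ
  let X' : chainSubring act D := ⟨X, hX⟩
  let T' : chainSubring act D := ⟨T, hT⟩
  have hcomm : π X' * π T' = π T' * π X' := by
    rw [← sub_eq_zero, ← map_mul, ← map_mul, ← map_sub, hπ, toHomotopyRing_eq_zero_iff]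
    exact hXT
  have hk' : ((k : chainSubring act D) : chainSubring act D) = 0 := by
    ext x y
    have : ((k : Matrix Q Q R) : Matrix Q Q R) x y = 0 := by
      rw [← Matrix.diagonal_natCast', Matrix.diagonal_apply]
      split_ifs
      · exact hk
      · rfl
    exact this
  have hkπ : (k : HomotopyRing act D) = 0 := by
    rw [← map_natCast π, hk', map_zero]
  have hxπ : π X' ^ ((k - 1) * (a - 1) + 1) = 0 := by
    rw [← map_pow, show X' ^ ((k - 1) * (a - 1) + 1) = 0 from Subtype.ext hX0, map_zero]
  have htπ : π T' ^ ((k - 1) * k ^ ℓ - 1) = 0 := by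
    have hFm := mem_chainSubring_of_homotopy hD hDi hT hF
    have hFπ : π ⟨F, hFm⟩ = π T' := by
      rw [← sub_eq_zero, ← map_sub, hπ, toHomotopyRing_eq_zero_iff]
      obtain ⟨K, hK, h⟩ := hF
      exact ⟨K, hK, by simp [T', h]⟩
    rw [← hFπ, ← map_pow, show (⟨F, hFm⟩ : chainSubring act D) ^ ((k - 1) * k ^ ℓ - 1) = 0 from
      Subtype.ext hF0, map_zero]
  have hprodπ : (((Finset.univ : Finset (ZMod k)).erase 0).toList.map
      fun j => (π X' + j.val * π T') ^ (k ^ ℓ - a + 1)).prod = 0 := by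
    let Y' : ZMod k → chainSubring act D := fun j => if hj : j ≠ 0 then
      ⟨Y j, mem_chainSubring_of_homotopy hD hDi (add_mem hX (nsmul_mem hT _)) (hY j hj)⟩ else 0
    have hYπ : ∀ j ≠ 0, π (Y' j) = π X' + j.val * π T' := by
      intro j hj
      rw [← nsmul_eq_mul, ← map_nsmul, ← sub_eq_zero, ← map_add, ← map_sub, hπ,
        toHomotopyRing_eq_zero_iff]
      obtain ⟨K, hK, h⟩ := hY j hj
      refine ⟨K, hK, ?_⟩
      rw [← sub_eq_iff_eq_add'] at h
      rw [← h]
      simp only [Y', dif_pos hj]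
      rfl
    have hl : (((Finset.univ : Finset (ZMod k)).erase 0).toList.map
        fun j => Y' j ^ (k ^ ℓ - a + 1)).prod = 0 := by
      apply Subtype.ext
      rw [SubmonoidClass.coe_list_prod, List.map_map, Subring.coe_zero, ← hY0]
      congr 1
      refine List.map_congr_left fun j hj => ?_
      have hj0 : j ≠ 0 := (Finset.mem_erase.1 (Finset.mem_toList.1 hj)).1
      simp [Y', hj0]
    have hl' := congrArg π hl
    rw [map_zero, map_list_prod, List.map_map] at hl'
    rw [← hl']
    congr 1
    refine List.map_congr_left fun j hj => ?_
    have hj0 : j ≠ 0 := (Finset.mem_erase.1 (Finset.mem_toList.1 hj)).1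
    simp only [Function.comp_apply, map_pow, hYπ j hj0]
  have key := pow_mul_pow_eq_zero_of_commute k ℓ a hk2 hkπ ha haq (π X') (π T') hcomm hxπ
    hprodπ htπ
  have key' : π (X' ^ ((k - 1) * (a - 1)) * T' ^ ((k - 1) * (k ^ ℓ - a + 1) - 1)) = 0 := by
    rw [map_mul, map_pow, map_pow]
    exact key
  rw [hπ, toHomotopyRing_eq_zero_iff] at key'
  exact key'

end HomotopyRing

section FundamentalDomain

variable {Q R G : Type*} [Fintype Q] [CommRing R] [AddCommGroup G] [Fintype G] [DecidableEq G]

theorem sum_fundamental_domain (act : G → Equiv.Perm Q) (lab : Q → G)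
    (hlab : ∀ g x, lab (act g x) = g + lab x) (m : Q → Q → R)
    (hm : ∀ g x y, m (act g x) (act g y) = m x y) :
    ∑ x, ∑ y, (if lab x = 0 then m x y else 0) = ∑ x, ∑ y, (if lab y = 0 then m x y else 0) := by
  have h1 : ∀ x y, (if lab x = 0 then m x y else 0)
      = ∑ g, if lab x = 0 ∧ lab y = g then m x y else 0 := by
    intro x y
    rw [Finset.sum_eq_single (lab y)] <;> simp +contextual [eq_comm]
  have h2 : ∀ x y, (if lab y = 0 then m x y else 0)
      = ∑ g, if lab x = -g ∧ lab y = 0 then m x y else 0 := by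
    intro x y
    rw [Finset.sum_eq_single (-lab x)] 
    · simp 
    · intro g _ hg
      rw [if_neg]
      rintro ⟨h, -⟩
      exact hg (by rw [h, neg_neg])
    · simp
  simp_rw [h1, h2]
  simp_rw [Finset.sum_comm (t := (Finset.univ : Finset G))]
  refine Finset.sum_congr rfl fun g _ => ?_
  rw [← Equiv.sum_comp (act g)]
  refine Finset.sum_congr rfl fun x _ => ?_
  rw [← Equiv.sum_comp (act g)]
  refine Finset.sum_congr rfl fun y _ => ?_
  rw [hm, hlab, hlab]
  congr 1
  rw [eq_neg_iff_add_eq_zero, add_comm g, add_eq_left]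

/-- An invariant cycle pairs to zero with an invariant coboundary on a fundamental domain. -/
theorem sum_fundamental_domain_mulVec_eq_zero (act : G → Equiv.Perm Q) (lab : Q → G)
    (hlab : ∀ g x, lab (act g x) = g + lab x) (D : Matrix Q Q R)
    (hD : ∀ g x y, D (act g x) (act g y) = D x y) (Ω ψ : Q → R)
    (hΩ : ∀ g x, Ω (act g x) = Ω x) (hψ : ∀ g x, ψ (act g x) = ψ x)
    (hcyc : Matrix.vecMul Ω D = 0) :
    ∑ x, (if lab x = 0 then Ω x * (D.mulVec ψ) x else 0) = 0 := by
  have := sum_fundamental_domain act lab hlab (fun x y => Ω x * D x y * ψ y)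
    (fun g x y => by rw [hΩ, hD, hψ])
  calc _ = ∑ x, ∑ y, (if lab x = 0 then Ω x * D x y * ψ y else 0) := by
        refine Finset.sum_congr rfl fun x _ => ?_
        split_ifs
        · simp [Matrix.mulVec, dotProduct, Finset.mul_sum, mul_assoc]
        · simp
    _ = ∑ y, (if lab y = 0 then (Matrix.vecMul Ω D) y * ψ y else 0) := by
        rw [this, Finset.sum_comm]
        refine Finset.sum_congr rfl fun y _ => ?_
        split_ifs
        · simp [Matrix.vecMul, dotProduct, Finset.sum_mul]
        · simp
    _ = 0 := by simp [hcyc]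

end FundamentalDomain

section Carry

variable {k : ℕ} [NeZero k]

/-- The carry digit of an addition modulo `k`. -/
def crZ (u v : ZMod k) : ℤ := if k ≤ u.val + v.val then 1 else 0

theorem crZ_spec (u v : ZMod k) : (k : ℤ) * crZ u v = u.val + v.val - (u + v).val := by
  unfold crZ
  split_ifs with h
  · have := ZMod.val_add_val_of_le h
    omega
  · have := ZMod.val_add_of_lt (not_le.1 h)
    omega

theorem crZ_zero_left (v : ZMod k) : crZ 0 v = 0 := by
  simp [crZ, not_le.2 (ZMod.val_lt v)]

theorem crZ_zero_right (u : ZMod k) : crZ u 0 = 0 := by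
  simp [crZ, not_le.2 (ZMod.val_lt u)]

variable {Q : Type*} (ε : Q → ZMod k)

/-- The carry 2-cocycle of a labelling. -/
def carry (x y z : Q) : ZMod k := (crZ (ε x - ε y) (ε y - ε z) : ℤ)

variable {ε}

theorem mul_crZ_sub (x y z : Q) : (k : ℤ) * crZ (ε x - ε y) (ε y - ε z) =
    (ε x - ε y).val + (ε y - ε z).val - (ε x - ε z).val := by
  rw [crZ_spec, sub_add_sub_cancel]

theorem carry_cocycle (x y z w : Q) :
    carry ε y z w - carry ε x z w + carry ε x y w - carry ε x y z = 0 := by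
  have h : crZ (ε y - ε z) (ε z - ε w) - crZ (ε x - ε z) (ε z - ε w)
      + crZ (ε x - ε y) (ε y - ε w) - crZ (ε x - ε y) (ε y - ε z) = 0 := by
    have hk : (k : ℤ) ≠ 0 := by exact_mod_cast NeZero.ne k
    apply mul_left_cancel₀ hk
    linear_combination mul_crZ_sub (ε := ε) y z w - mul_crZ_sub (ε := ε) x z w
      + mul_crZ_sub (ε := ε) x y w - mul_crZ_sub (ε := ε) x y z
  simp only [carry]
  exact_mod_cast congrArg (Int.cast : ℤ → ZMod k) h

theorem carry_eq_zero_left {x y : Q} (h : ε x = ε y) (z : Q) : carry ε x y z = 0 := by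
  simp [carry, h, crZ_zero_left]

theorem carry_eq_zero_right (x : Q) {y z : Q} (h : ε y = ε z) : carry ε x y z = 0 := by
  simp [carry, h, crZ_zero_right]

section Invariance

variable {R G : Type*} [Fintype Q] [CommRing R] {act : G → Equiv.Perm Q} {D : Matrix Q Q R}

omit [Fintype Q] in
theorem Inv.op1 (hD : Inv act D) {V : Q → Q → R} (hV : ∀ g x y, V (act g x) (act g y) = V x y) :
    Inv act (op1 D V) := fun g x y => by simp [FineStar.op1, hD g x y, hV]

theorem Inv.op2 (hD : Inv act D) {c : Q → Q → Q → R}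
    (hc : ∀ g x y z, c (act g x) (act g y) (act g z) = c x y z) :
    Inv act (op2 D c) := by
  intro g x z
  simp only [FineStar.op2, Matrix.of_apply]
  rw [← Equiv.sum_comp (act g)]
  exact Finset.sum_congr rfl fun y _ => by rw [hD, hD, hc]

theorem Inv.op3 (hD : Inv act D) {c : Q → Q → Q → Q → R}
    (hc : ∀ g x y z w, c (act g x) (act g y) (act g z) (act g w) = c x y z w) :
    Inv act (op3 D c) := by
  intro g x w
  simp only [FineStar.op3, Matrix.of_apply]
  rw [← Equiv.sum_comp (act g)]
  refine Finset.sum_congr rfl fun y _ => ?_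
  rw [← Equiv.sum_comp (act g)]
  exact Finset.sum_congr rfl fun z _ => by rw [hD, hD, hD, hc]

end Invariance

variable {G : Type*} [Fintype Q] {act : G → Equiv.Perm Q} {D : Matrix Q Q (ZMod k)}

omit [Fintype Q] [NeZero k] in
theorem carry_inv {s : G → ZMod k} (hs : ∀ g x, ε (act g x) = s g + ε x) (g : G) (x y z : Q) :
    carry ε (act g x) (act g y) (act g z) = carry ε x y z := by
  simp [carry, hs]

theorem carryOp_mem [DecidableEq Q] (hD : D * D = 0) (hDi : Inv act D) {s : G → ZMod k}
    (hs : ∀ g x, ε (act g x) = s g + ε x) : op2 D (carry ε) ∈ chainSubring act D :=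
  ⟨hDi.op2 (carry_inv hs), op2_comm hD carry_cocycle⟩

theorem carryOp_comm (hD : D * D = 0) (hDi : Inv act D) {s s' : G → ZMod k}
    {ε' : Q → ZMod k} (hs : ∀ g x, ε (act g x) = s g + ε x)
    (hs' : ∀ g x, ε' (act g x) = s' g + ε' x) :
    ∃ K, Inv act K ∧ op2 D (carry ε) * op2 D (carry ε') - op2 D (carry ε') * op2 D (carry ε)
      = D * K + K * D :=
  ⟨_, hDi.op3 fun g x y z w => by simp only [cupOne, carry_inv hs, carry_inv hs'],
    op2_mul_comm_homotopy hD carry_cocycle carry_cocycle⟩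

theorem carryOp_relation (hD : D * D = 0) (hDi : Inv act D) {s s₁ s₂ : G → ZMod k}
    {ε₁ ε₂ w : Q → ZMod k} (n₁ n₂ : ℕ) (hs : ∀ g x, ε (act g x) = s g + ε x)
    (hs₁ : ∀ g x, ε₁ (act g x) = s₁ g + ε₁ x) (hs₂ : ∀ g x, ε₂ (act g x) = s₂ g + ε₂ x)
    (hw : ∀ g x, w (act g x) = w x) (h : ∀ x, ε x = n₁ * ε₁ x + n₂ * ε₂ x + w x) :
    ∃ K, Inv act K ∧ op2 D (carry ε) =
      (n₁ • op2 D (carry ε₁) + n₂ • op2 D (carry ε₂)) + (D * K + K * D) := by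
  have hdiv : ∀ x y, (k : ℤ) ∣ (ε x - ε y).val - n₁ * (ε₁ x - ε₁ y).val
      - n₂ * (ε₂ x - ε₂ y).val - ((w x).val - (w y).val) := by
    intro x y
    rw [← ZMod.intCast_zmod_eq_zero_iff_dvd]
    push_cast
    simp only [ZMod.natCast_val, ZMod.cast_id', id_eq, h]
    ring
  choose V hV using hdiv
  have hVi : ∀ g x y, V (act g x) (act g y) = V x y := by
    intro g x y
    have hk : (k : ℤ) ≠ 0 := by exact_mod_cast NeZero.ne k
    apply mul_left_cancel₀ hk
    rw [← hV, ← hV]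
    simp [hs, hs₁, hs₂, hw]
  have hc : ∀ x y z, carry ε x y z = (n₁ * carry ε₁ x y z + n₂ * carry ε₂ x y z)
      + ((V y z : ZMod k) - V x z + V x y) := by
    intro x y z
    have h : crZ (ε x - ε y) (ε y - ε z) = (n₁ * crZ (ε₁ x - ε₁ y) (ε₁ y - ε₁ z)
        + n₂ * crZ (ε₂ x - ε₂ y) (ε₂ y - ε₂ z)) + (V y z - V x z + V x y) := by
      have hk : (k : ℤ) ≠ 0 := by exact_mod_cast NeZero.ne k
      apply mul_left_cancel₀ hk
      linear_combination mul_crZ_sub (ε := ε) x y z - n₁ * mul_crZ_sub (ε := ε₁) x y z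
        - n₂ * mul_crZ_sub (ε := ε₂) x y z + hV y z - hV x z + hV x y
    simp only [carry]
    exact_mod_cast congrArg (Int.cast : ℤ → ZMod k) h
  refine ⟨op1 D fun x y => V x y, hDi.op1 fun g x y => by rw [hVi], ?_⟩
  rw [op1_coboundary hD, ← Nat.cast_smul_eq_nsmul (ZMod k) n₁, ← Nat.cast_smul_eq_nsmul (ZMod k) n₂,
    ← op2_smul, ← op2_smul, ← op2_add, ← op2_add]
  congr 1
  funext x y z
  exact hc x y z

section Rank

theorem exists_ne_of_carryOp_ne_zero {x z : Q} (h : op2 D (carry ε) x z ≠ 0) :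
    ∃ y, D x y ≠ 0 ∧ D y z ≠ 0 ∧ ε x ≠ ε y ∧ ε y ≠ ε z := by
  simp only [op2, Matrix.of_apply] at h
  obtain ⟨y, -, hy⟩ := Finset.exists_ne_zero_of_sum_ne_zero h
  refine ⟨y, fun h => hy (by simp [h]), fun h => hy (by simp [h]), fun h => hy ?_, fun h => hy ?_⟩
  · rw [carry_eq_zero_left h, mul_zero]
  · rw [carry_eq_zero_right _ h, mul_zero]

theorem rank_mono_of_carryOp_pow_ne_zero [DecidableEq Q] {r : Q → ℕ}
    (hr : ∀ x y, D x y ≠ 0 → r y ≤ r x) (n : ℕ) {x z : Q}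
    (h : (op2 D (carry ε) ^ n) x z ≠ 0) : r z ≤ r x := by
  induction n generalizing x with
  | zero =>
    rw [pow_zero, Matrix.one_apply] at h
    rw [(ite_ne_right_iff.1 h).1]
  | succ n ih =>
    rw [pow_succ', Matrix.mul_apply] at h
    obtain ⟨y, -, hy⟩ := Finset.exists_ne_zero_of_sum_ne_zero h
    obtain ⟨v, h1, h2, -, -⟩ := exists_ne_of_carryOp_ne_zero (left_ne_zero_of_mul hy)
    exact (ih (right_ne_zero_of_mul hy)).trans ((hr _ _ h2).trans (hr _ _ h1))

theorem rank_eq_zero_of_carryOp_pow_ne_zero [DecidableEq Q] {r : Q → ℕ}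
    (hr : ∀ x y, D x y ≠ 0 → r y ≤ r x)
    (hε : ∀ x y, D x y ≠ 0 → ε x ≠ ε y → r y = 0 ∨ r y < r x) (n : ℕ) {x z : Q} (hx : r x ≤ 2 * n)
    (h : (op2 D (carry ε) ^ n) x z ≠ 0) : r z = 0 := by
  induction n generalizing x with
  | zero => exact Nat.le_zero.1 ((rank_mono_of_carryOp_pow_ne_zero hr 0 h).trans hx)
  | succ n ih =>
    rw [pow_succ', Matrix.mul_apply] at h
    obtain ⟨y, -, hy⟩ := Finset.exists_ne_zero_of_sum_ne_zero h
    obtain ⟨v, h1, h2, h3, h4⟩ := exists_ne_of_carryOp_ne_zero (left_ne_zero_of_mul hy)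
    have h5 := hr _ _ h1
    have h6 := hr _ _ h2
    have h7 := rank_mono_of_carryOp_pow_ne_zero hr n (right_ne_zero_of_mul hy)
    rcases hε _ _ h1 h3 with h8 | h8
    · omega
    · rcases hε _ _ h2 h4 with h9 | h9
      · omega
      · exact ih (by omega) (right_ne_zero_of_mul hy)

theorem list_prod_carryOp_pow_eq_zero [DecidableEq Q] {J : Type*} {r : J → Q → ℕ}
    {ε : J → Q → ZMod k} (hr : ∀ j x y, D x y ≠ 0 → r j y ≤ r j x)
    (hε : ∀ j x y, D x y ≠ 0 → ε j x ≠ ε j y → r j y = 0 ∨ r j y < r j x) (n : ℕ)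
    (hn : ∀ j x, r j x ≤ 2 * n) (l : List J) (hl : ∀ x, ∃ j ∈ l, r j x ≠ 0) :
    (l.map fun j => op2 D (carry (ε j)) ^ n).prod = 0 := by
  have key : ∀ l : List J, ∀ x z, (l.map fun j => op2 D (carry (ε j)) ^ n).prod x z ≠ 0 →
      (∀ j, r j z ≤ r j x) ∧ ∀ j ∈ l, r j z = 0 := by
    intro l
    induction l with
    | nil =>
      intro x z h
      rw [List.map_nil, List.prod_nil, Matrix.one_apply] at h
      rw [(ite_ne_right_iff.1 h).1]
      simp
    | cons i l ih =>
      intro x z h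
      rw [List.map_cons, List.prod_cons, Matrix.mul_apply] at h
      obtain ⟨y, -, hy⟩ := Finset.exists_ne_zero_of_sum_ne_zero h
      obtain ⟨h1, h2⟩ := ih _ _ (right_ne_zero_of_mul hy)
      have h3 := left_ne_zero_of_mul hy
      refine ⟨fun j => (h1 j).trans (rank_mono_of_carryOp_pow_ne_zero (hr j) n h3), ?_⟩
      intro j hj
      rcases List.mem_cons.1 hj with rfl | hj
      · have h4 := rank_eq_zero_of_carryOp_pow_ne_zero (hr j) (hε j) n (hn j x) h3
        exact Nat.le_zero.1 (h4 ▸ h1 j)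
      · exact h2 j hj
  ext x z
  by_contra h
  obtain ⟨j, hj, hj'⟩ := hl z
  exact hj' ((key l x z h).2 j hj)

theorem carryOp_pow_eq_zero [DecidableEq Q] {r : Q → ℕ}
    (hr : ∀ x y, D x y ≠ 0 → r y ≤ r x)
    (hε : ∀ x y, D x y ≠ 0 → ε x ≠ ε y → r y < r x) (n : ℕ) (hn : ∀ x, r x ≤ 2 * n)
    (hpos : ∀ x, r x ≠ 0) : op2 D (carry ε) ^ n = 0 := by
  ext x z
  by_contra h
  exact hpos z (rank_eq_zero_of_carryOp_pow_ne_zero hr (fun x y h1 h2 => Or.inr (hε x y h1 h2))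
    n (hn x) h)

end Rank

end Carry

/-- The cells of a star with legs indexed by `ZMod k`, each leg subdivided into `m + 1` edges.
The center is `none`; the Boolean distinguishes an edge from its outer endpoint. -/
abbrev Cell (k m : ℕ) := Option (ZMod k × Fin (m + 1) × Bool)

namespace Cell

variable {k m : ℕ}

/-- Whether the cell is an edge. -/
def isEdge : Cell k m → Bool
  | none => false
  | some (_, _, e) => e

/-- The outer endpoint of an edge. -/
def head : Cell k m → Cell k m
  | none => none
  | some (a, r, _) => some (a, r, false)

/-- The inner endpoint of an edge. -/
def tail : Cell k m → Cell k m
  | none => none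
  | some (a, r, _) => Fin.cases none (fun s => some (a, s.castSucc, false)) r

/-- The leg containing a cell. -/
def leg : Cell k m → ZMod k
  | none => 0
  | some (a, _, _) => a

/-- Whether the cell is an outermost vertex. -/
def isLeaf : Cell k m → Prop
  | none => False
  | some (_, r, e) => r = Fin.last m ∧ e = false

/-- The edge of the leg `a` at the center. -/
def firstEdge (a : ZMod k) : Cell k m := some (a, 0, true)

/-- The outermost vertex of the leg `a`. -/
def leafOf (a : ZMod k) : Cell k m := some (a, Fin.last m, false)

/-- The outermost edge of the leg `a`. -/
def lastEdge (a : ZMod k) : Cell k m := some (a, Fin.last m, true)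

/-- Rotation of the legs. -/
def shift (s : ZMod k) : Cell k m → Cell k m := Option.map fun x => (s + x.1, x.2)

theorem head_isEdge (c : Cell k m) : c.head.isEdge = false := by
  rcases c with _ | ⟨a, r, e⟩ <;> rfl

theorem tail_isEdge (c : Cell k m) : c.tail.isEdge = false := by
  rcases c with _ | ⟨a, r, e⟩
  · rfl
  · induction r using Fin.cases <;> rfl

theorem head_shift (s : ZMod k) (c : Cell k m) : (shift s c).head = shift s c.head := by
  rcases c with _ | ⟨a, r, e⟩ <;> rfl

theorem tail_shift (s : ZMod k) (c : Cell k m) : (shift s c).tail = shift s c.tail := by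
  rcases c with _ | ⟨a, r, e⟩
  · rfl
  · induction r using Fin.cases <;> rfl

@[simp] theorem isEdge_shift (s : ZMod k) (c : Cell k m) : (shift s c).isEdge = c.isEdge := by
  rcases c with _ | ⟨a, r, e⟩ <;> rfl

@[simp] theorem isLeaf_shift (s : ZMod k) (c : Cell k m) : (shift s c).isLeaf ↔ c.isLeaf := by
  rcases c with _ | ⟨a, r, e⟩ <;> rfl

@[simp] theorem shift_eq_none (s : ZMod k) (c : Cell k m) : shift s c = none ↔ c = none := by
  rcases c with _ | ⟨a, r, e⟩ <;> simp [shift]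

theorem leg_shift (s : ZMod k) {c : Cell k m} (hc : c ≠ none) : (shift s c).leg = s + c.leg := by
  rcases c with _ | ⟨a, r, e⟩
  · exact absurd rfl hc
  · rfl

theorem shift_shift (s t : ZMod k) (c : Cell k m) : shift s (shift t c) = shift (s + t) c := by
  rcases c with _ | ⟨a, r, e⟩
  · rfl
  · simp [shift, add_assoc]

@[simp] theorem shift_zero (c : Cell k m) : shift 0 c = c := by
  rcases c with _ | ⟨a, r, e⟩
  · rfl
  · simp [shift]

theorem head_ne_none {c : Cell k m} (h : c ≠ none) : c.head ≠ none := by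
  rcases c with _ | ⟨a, r, e⟩
  · exact absurd rfl h
  · exact Option.some_ne_none _

theorem head_leg (c : Cell k m) : c.head.leg = c.leg := by
  rcases c with _ | ⟨a, r, e⟩ <;> rfl

theorem tail_leg {c : Cell k m} (h : c.tail ≠ none) : c.tail.leg = c.leg := by
  rcases c with _ | ⟨a, r, e⟩
  · rfl
  · induction r using Fin.cases
    · exact absurd rfl h
    · rfl

theorem isEdge_eq_false_of_isLeaf {c : Cell k m} (h : c.isLeaf) : c.isEdge = false := by
  rcases c with _ | ⟨a, r, e⟩
  · exact h.elim
  · exact h.2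

theorem ne_none_of_isEdge {c : Cell k m} (h : c.isEdge = true) : c ≠ none := by
  rintro rfl
  exact Bool.false_ne_true h

theorem ne_none_of_isLeaf {c : Cell k m} (h : c.isLeaf) : c ≠ none := by
  rintro rfl
  exact h

theorem eq_leafOf_of_isLeaf {c : Cell k m} (h : c.isLeaf) : c = leafOf c.leg := by
  rcases c with _ | ⟨a, r, e⟩
  · exact h.elim
  · obtain ⟨rfl, rfl⟩ := h
    rfl

theorem eq_firstEdge_of_tail_eq_none {c : Cell k m} (h : c.isEdge = true) (ht : c.tail = none) :
    c = firstEdge c.leg := by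
  rcases c with _ | ⟨a, r, e⟩
  · exact (Bool.false_ne_true h).elim
  · obtain rfl : e = true := h
    induction r using Fin.cases
    · rfl
    · exact absurd ht (Option.some_ne_none _)

end Cell

section Complex

variable {k m M : ℕ}

/-- The cells of a product of `M` stars. -/
abbrev Cells (k m M : ℕ) := Fin M → Cell k m

/-- The incidence sign of the `i`-th direction. -/
def sgn (c : Cells k m M) (i : Fin M) : ZMod k :=
  ∏ j ∈ Finset.univ.filter (· < i), if (c j).isEdge then -1 else 1

theorem sgn_update_of_le (c : Cells k m M) {i j : Fin M} (h : i ≤ j) (v : Cell k m) :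
    sgn (Function.update c j v) i = sgn c i := by
  refine Finset.prod_congr rfl fun l hl => ?_
  have : l ≠ j := ((Finset.mem_filter.1 hl).2.trans_le h).ne
  rw [Function.update_of_ne this]

theorem sgn_update_of_lt {c : Cells k m M} {i j : Fin M} (h : j < i) {v : Cell k m}
    (hc : (c j).isEdge = true) (hv : v.isEdge = false) :
    sgn (Function.update c j v) i = - sgn c i := by
  have hj : j ∈ Finset.univ.filter (· < i) := by simpa using h
  rw [sgn, sgn, ← Finset.mul_prod_erase _ _ hj, ← Finset.mul_prod_erase _ _ hj]
  simp only [Function.update_self, hc, hv, if_true, neg_mul, one_mul, neg_neg]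
  simp only [Bool.false_eq_true, if_false, one_mul]
  refine Finset.prod_congr rfl fun l hl => ?_
  rw [Function.update_of_ne (Finset.mem_erase.1 hl).1]

theorem sgn_congr {c c' : Cells k m M} {i : Fin M} (h : ∀ j < i, (c j).isEdge = (c' j).isEdge) :
    sgn c i = sgn c' i :=
  Finset.prod_congr rfl fun l hl => by rw [h l (Finset.mem_filter.1 hl).2]

variable [NeZero k]

/-- The boundary in the `i`-th direction. -/
def dd (i : Fin M) : Matrix (Cells k m M) (Cells k m M) (ZMod k) :=
  Matrix.of fun c c' => if (c i).isEdge then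
    sgn c i * ((if c' = Function.update c i (c i).head then 1 else 0)
      - (if c' = Function.update c i (c i).tail then 1 else 0)) else 0

theorem dd_mulVec (i : Fin M) (G : Cells k m M → ZMod k) (c : Cells k m M) :
    (dd i).mulVec G c = if (c i).isEdge then
      sgn c i * (G (Function.update c i (c i).head) - G (Function.update c i (c i).tail)) else 0 := by
  simp only [Matrix.mulVec, dotProduct, dd, Matrix.of_apply]
  split_ifs
  · simp [mul_assoc, sub_mul, Finset.sum_sub_distrib, ← Finset.mul_sum]
  · simp

theorem dd_mul_self (i : Fin M) : dd (k := k) (m := m) i * dd i = 0 := by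
  refine Matrix.ext_iff_mulVec.2 fun G => ?_
  ext c
  rw [← Matrix.mulVec_mulVec, dd_mulVec, dd_mulVec, dd_mulVec]
  simp [Cell.head_isEdge, Cell.tail_isEdge]

theorem dd_anticomm_of_lt {i j : Fin M} (h : i < j) :
    dd (k := k) (m := m) i * dd j + dd j * dd i = 0 := by
  refine Matrix.ext_iff_mulVec.2 fun G => ?_
  ext c
  rw [Matrix.add_mulVec, ← Matrix.mulVec_mulVec, ← Matrix.mulVec_mulVec]
  simp only [Pi.add_apply, dd_mulVec, Function.update_of_ne h.ne, Function.update_of_ne h.ne']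
  by_cases hi : (c i).isEdge = true
  · by_cases hj : (c j).isEdge = true
    · simp only [hi, hj, if_true]
      rw [sgn_update_of_lt h hi (Cell.head_isEdge _), sgn_update_of_lt h hi (Cell.tail_isEdge _),
        sgn_update_of_le c h.le, sgn_update_of_le c h.le]
      simp only [Function.update_comm h.ne, Matrix.zero_mulVec, Pi.zero_apply]
      ring
    · simp [hj]
  · simp [hi]

theorem dd_anticomm (i j : Fin M) :
    dd (k := k) (m := m) i * dd j + dd j * dd i = 0 := by
  rcases lt_trichotomy i j with h | rfl | h
  · exact dd_anticomm_of_lt h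
  · simp [dd_mul_self]
  · rw [add_comm]
    exact dd_anticomm_of_lt h

/-- The boundary in a set of directions. -/
def bdOn (I : Finset (Fin M)) : Matrix (Cells k m M) (Cells k m M) (ZMod k) := ∑ i ∈ I, dd i

theorem bdOn_anticomm (I J : Finset (Fin M)) :
    bdOn (k := k) (m := m) I * bdOn J + bdOn J * bdOn I = 0 := by
  simp only [bdOn, Finset.sum_mul_sum]
  rw [Finset.sum_comm (s := J), ← Finset.sum_add_distrib]
  refine Finset.sum_eq_zero fun i _ => ?_
  rw [← Finset.sum_add_distrib]
  exact Finset.sum_eq_zero fun j _ => dd_anticomm i j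

theorem bdOn_mul_self (I : Finset (Fin M)) : bdOn (k := k) (m := m) I * bdOn I = 0 := by
  induction I using Finset.induction_on with
  | empty => simp [bdOn]
  | insert i I hi ih =>
    have h1 : bdOn (k := k) (m := m) (insert i I) = dd i + bdOn I := by
      simp [bdOn, Finset.sum_insert hi]
    have h2 := bdOn_anticomm (k := k) (m := m) {i} I
    have h3 : bdOn (k := k) (m := m) {i} = dd i := by simp [bdOn]
    rw [h3] at h2
    rw [h1, add_mul, mul_add, mul_add, dd_mul_self, ih, zero_add, add_zero, h2]

/-- The elementary face relation. -/
def Face (c c' : Cells k m M) (i : Fin M) : Prop :=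
  (c i).isEdge = true ∧
    (c' = Function.update c i (c i).head ∨ c' = Function.update c i (c i).tail)

omit [NeZero k] in
theorem face_of_dd_ne_zero {i : Fin M} {c c' : Cells k m M} (h : dd i c c' ≠ 0) : Face c c' i := by
  simp only [dd, Matrix.of_apply, ne_eq, ite_eq_right_iff, Classical.not_imp] at h
  refine ⟨h.1, ?_⟩
  by_contra! h'
  exact h.2 (by simp [h'.1, h'.2])

omit [NeZero k] in
theorem exists_face_of_bdOn_ne_zero {I : Finset (Fin M)} {c c' : Cells k m M}
    (h : bdOn I c c' ≠ 0) : ∃ i ∈ I, Face c c' i := by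
  rw [bdOn, Matrix.sum_apply] at h
  obtain ⟨i, hi, h⟩ := Finset.exists_ne_zero_of_sum_ne_zero h
  exact ⟨i, hi, face_of_dd_ne_zero h⟩

omit [NeZero k] in
theorem Face.eq_of_ne {c c' : Cells k m M} {i j : Fin M} (h : Face c c' i) (hj : j ≠ i) :
    c' j = c j := by
  rcases h.2 with h | h <;> rw [h, Function.update_of_ne hj]

omit [NeZero k] in
theorem Face.leg_eq {c c' : Cells k m M} {i j : Fin M} (h : Face c c' i) (hj : c' j ≠ none) :
    c j ≠ none ∧ (c' j).leg = (c j).leg := by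
  by_cases hij : j = i
  · subst hij
    refine ⟨Cell.ne_none_of_isEdge h.1, ?_⟩
    rcases h.2 with h | h
    · rw [h, Function.update_self, Cell.head_leg]
    · rw [h, Function.update_self, Cell.tail_leg]
      rwa [h, Function.update_self] at hj
  · rw [h.eq_of_ne hij] at hj ⊢
    exact ⟨hj, rfl⟩

omit [NeZero k] in
theorem Face.isLeaf {c c' : Cells k m M} {i j : Fin M} (h : Face c c' i) (hj : (c j).isLeaf) :
    (c' j).isLeaf := by
  rwa [h.eq_of_ne]
  rintro rfl
  exact Bool.false_ne_true ((Cell.isEdge_eq_false_of_isLeaf hj).symm.trans h.1)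

/-- Rotation of all the stars. -/
def shiftCells (s : Fin M → ZMod k) (c : Cells k m M) : Cells k m M := fun i => (c i).shift (s i)

omit [NeZero k] in
theorem shiftCells_neg (s : Fin M → ZMod k) (c : Cells k m M) :
    shiftCells (-s) (shiftCells s c) = c := by
  funext i
  simp [shiftCells, Cell.shift_shift]

omit [NeZero k] in
theorem shiftCells_update (s : Fin M → ZMod k) (c : Cells k m M) (i : Fin M) (v : Cell k m) :
    Function.update (shiftCells s c) i (v.shift (s i)) = shiftCells s (Function.update c i v) := by
  funext j
  by_cases h : j = i
  · subst h; simp [shiftCells]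
  · simp [shiftCells, Function.update_of_ne h]

omit [NeZero k] in
theorem shiftCells_injective (s : Fin M → ZMod k) :
    Function.Injective (shiftCells (m := m) s) :=
  (Function.LeftInverse.injective (shiftCells_neg s))

omit [NeZero k] in
theorem dd_shift (s : Fin M → ZMod k) (i : Fin M) (c c' : Cells k m M) :
    dd i (shiftCells s c) (shiftCells s c') = dd i c c' := by
  have h1 : sgn (shiftCells s c) i = sgn c i := sgn_congr fun j _ => by simp [shiftCells]
  simp only [dd, Matrix.of_apply, h1]
  have h2 : (shiftCells s c i) = (c i).shift (s i) := rfl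
  simp only [h2, Cell.isEdge_shift, Cell.head_shift, Cell.tail_shift, shiftCells_update,
    (shiftCells_injective s).eq_iff]

omit [NeZero k] in
theorem bdOn_shift (s : Fin M → ZMod k) (I : Finset (Fin M)) (c c' : Cells k m M) :
    bdOn I (shiftCells s c) (shiftCells s c') = bdOn I c c' := by
  simp only [bdOn, Matrix.sum_apply, dd_shift]

theorem bdOn_mulVec_one (I : Finset (Fin M)) : (bdOn (k := k) (m := m) I).mulVec 1 = 0 := by
  ext c
  rw [bdOn, Matrix.sum_mulVec, Finset.sum_apply]
  exact Finset.sum_eq_zero fun i _ => by simp [dd_mulVec]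

end Complex

section Lead

variable {M : ℕ} {A : Type*}

/-- The value of `g` at the least element of `S`. -/
def lead [Zero A] (S : Finset (Fin M)) (g : Fin M → A) : A :=
  if h : S.Nonempty then g (S.min' h) else 0

theorem lead_congr [Zero A] {S : Finset (Fin M)} {g g' : Fin M → A} (h : ∀ i ∈ S, g i = g' i) :
    lead S g = lead S g' := by
  unfold lead
  split_ifs with hS
  · exact h _ (S.min'_mem hS)
  · rfl

theorem lead_eq [Zero A] {S : Finset (Fin M)} {g : Fin M → A} {i : Fin M} (hi : i ∈ S)
    (h : ∀ j ∈ S, i ≤ j) : lead S g = g i := by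
  have hS : S.Nonempty := ⟨i, hi⟩
  rw [lead, dif_pos hS, le_antisymm (S.min'_le i hi) (h _ (S.min'_mem hS))]

theorem lead_map {B : Type*} [Zero A] [Zero B] {S : Finset (Fin M)} (hS : S.Nonempty) (φ : A → B)
    (g : Fin M → A) : lead S (fun i => φ (g i)) = φ (lead S g) := by
  simp [lead, hS]

variable {k m : ℕ}

/-- The nonzero coordinates in a set of directions. -/
def nz (I : Finset (Fin M)) (c : Cells k m M) : Finset (Fin M) := I.filter fun i => c i ≠ none

open Classical in
/-- The coordinates in a set of directions which are leaves. -/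
noncomputable def lf (I : Finset (Fin M)) (c : Cells k m M) : Finset (Fin M) :=
  I.filter fun i => (c i).isLeaf

theorem nz_shiftCells (I : Finset (Fin M)) (s : Fin M → ZMod k) (c : Cells k m M) :
    nz I (shiftCells s c) = nz I c := by
  simp [nz, shiftCells]

theorem lf_shiftCells (I : Finset (Fin M)) (s : Fin M → ZMod k) (c : Cells k m M) :
    lf I (shiftCells s c) = lf I c := by
  classical
  unfold lf
  refine Finset.filter_congr fun i _ => ?_
  simp [shiftCells]

theorem lf_subset_nz (I : Finset (Fin M)) (c : Cells k m M) : lf I c ⊆ nz I c := by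
  classical
  exact Finset.monotone_filter_right _ fun i _ h => Cell.ne_none_of_isLeaf h

theorem Face.nz_subset {c c' : Cells k m M} {i : Fin M} (h : Face c c' i) (I : Finset (Fin M)) :
    nz I c' ⊆ nz I c :=
  Finset.monotone_filter_right _ fun _ _ hj => (h.leg_eq hj).1

theorem Face.lead_eq_of_nz {c c' : Cells k m M} {i : Fin M} (h : Face c c' i)
    {I : Finset (Fin M)} (hI : nz I c' = nz I c) :
    lead (nz I c') (fun j => (c' j).leg) = lead (nz I c) fun j => (c j).leg := by
  rw [← hI]
  exact lead_congr fun j hj => (h.leg_eq (Finset.mem_filter.1 hj).2).2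

end Lead

section Restrict

variable {α R : Type*} [Fintype α] [CommRing R] {P : α → Prop} [DecidablePred P]
  {D : Matrix α α R}

theorem sum_subtype_of_support (g : α → R) (h : ∀ y, ¬ P y → g y = 0) :
    ∑ y : {y // P y}, g y = ∑ y, g y := by
  rw [← Finset.sum_subtype (Finset.univ.filter P) (by simp) g]
  exact Finset.sum_filter_of_ne fun y _ hy => by_contra fun hP => hy (h y hP)

theorem submatrix_mulVec_of_closed (hP : ∀ x y, P x → D x y ≠ 0 → P y) (φ : α → R) :
    (D.submatrix (Subtype.val : {y // P y} → α) (Subtype.val : {y // P y} → α)).mulVec (fun y => φ y.1)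
      = fun y => D.mulVec φ y.1 := by
  funext x
  exact sum_subtype_of_support (fun y => D x y * φ y) fun y hy => by
    rw [by_contra fun h => hy (hP x y x.2 h), zero_mul]

theorem submatrix_mul_of_closed (hP : ∀ x y, P x → D x y ≠ 0 → P y) (N : Matrix α α R) :
    D.submatrix (Subtype.val : {y // P y} → α) Subtype.val * N.submatrix Subtype.val Subtype.val
      = (D * N).submatrix Subtype.val (Subtype.val : {y // P y} → α) := by
  ext x z
  exact sum_subtype_of_support (fun y => D x y * N y z) fun y hy => by
    rw [by_contra fun h => hy (hP x y x.2 h), zero_mul]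

theorem op2_submatrix_of_closed (hP : ∀ x y, P x → D x y ≠ 0 → P y) (c : α → α → α → R) :
    op2 (D.submatrix (Subtype.val : {y // P y} → α) Subtype.val) (fun x y z => c x.1 y.1 z.1)
      = (op2 D c).submatrix Subtype.val (Subtype.val : {y // P y} → α) := by
  ext x z
  simp only [op2, Matrix.of_apply, Matrix.submatrix_apply]
  exact sum_subtype_of_support (fun y => D x y * D y z * c x y z) fun y hy => by
    rw [by_contra fun h => hy (hP x y x.2 h), zero_mul, zero_mul]

omit [DecidablePred P] in
theorem op2_closed (hP : ∀ x y, P x → D x y ≠ 0 → P y) (c : α → α → α → R) :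
    ∀ x y, P x → op2 D c x y ≠ 0 → P y := by
  intro x z hx h
  simp only [op2, Matrix.of_apply] at h
  obtain ⟨y, -, hy⟩ := Finset.exists_ne_zero_of_sum_ne_zero h
  have h1 := left_ne_zero_of_mul hy
  exact hP y z (hP x y hx (left_ne_zero_of_mul h1)) (right_ne_zero_of_mul h1)

theorem submatrix_pow_mulVec_of_closed [DecidableEq α] (hP : ∀ x y, P x → D x y ≠ 0 → P y) (n : ℕ)
    (φ : α → R) : (D.submatrix (Subtype.val : {y // P y} → α)
      (Subtype.val : {y // P y} → α) ^ n).mulVec (fun y => φ y.1) = fun y => (D ^ n).mulVec φ y.1 := by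
  induction n generalizing φ with
  | zero => simp
  | succ n ih =>
    rw [pow_succ, ← Matrix.mulVec_mulVec, submatrix_mulVec_of_closed hP, ih, pow_succ]
    simp only [Matrix.mulVec_mulVec]

end Restrict

section Setup

variable {k m n₁ n₂ : ℕ}

/-- The first block of directions. -/
def blk₁ (n₁ n₂ : ℕ) : Finset (Fin (2 * (n₁ + n₂))) := Finset.univ.filter fun i => i.val < 2 * n₁

/-- The second block of directions. -/
def blk₂ (n₁ n₂ : ℕ) : Finset (Fin (2 * (n₁ + n₂))) := Finset.univ.filter fun i => 2 * n₁ ≤ i.val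

theorem mem_blk₁ {i : Fin (2 * (n₁ + n₂))} : i ∈ blk₁ n₁ n₂ ↔ i.val < 2 * n₁ := by simp [blk₁]

theorem mem_blk₂ {i : Fin (2 * (n₁ + n₂))} : i ∈ blk₂ n₁ n₂ ↔ 2 * n₁ ≤ i.val := by simp [blk₂]

/-- The product cells having a leaf in each block. -/
def Good (n₁ n₂ : ℕ) (c : Cells k m (2 * (n₁ + n₂))) : Prop :=
  (lf (blk₁ n₁ n₂) c).Nonempty ∧ (lf (blk₂ n₁ n₂) c).Nonempty

/-- The complex of cells having a leaf in each block. -/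
abbrev GoodCells (k m n₁ n₂ : ℕ) := {c : Cells k m (2 * (n₁ + n₂)) // Good n₁ n₂ c}

noncomputable instance : DecidablePred (Good (k := k) (m := m) n₁ n₂) := Classical.decPred _

theorem Face.lf_subset {M : ℕ} {c c' : Cells k m M} {i : Fin M} (h : Face c c' i)
    (I : Finset (Fin M)) : lf I c ⊆ lf I c' := by
  classical
  exact Finset.monotone_filter_right _ fun _ _ hj => h.isLeaf hj

theorem Face.good {c c' : Cells k m (2 * (n₁ + n₂))} {i : Fin (2 * (n₁ + n₂))} (h : Face c c' i)
    (hc : Good n₁ n₂ c) : Good n₁ n₂ c' :=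
  ⟨hc.1.mono (h.lf_subset _), hc.2.mono (h.lf_subset _)⟩

theorem Good.nz₁ {c : Cells k m (2 * (n₁ + n₂))} (hc : Good n₁ n₂ c) :
    (nz (blk₁ n₁ n₂) c).Nonempty := hc.1.mono (lf_subset_nz _ _)

theorem Good.nz₂ {c : Cells k m (2 * (n₁ + n₂))} (hc : Good n₁ n₂ c) :
    (nz (blk₂ n₁ n₂) c).Nonempty := hc.2.mono (lf_subset_nz _ _)

theorem good_shiftCells (s : Fin (2 * (n₁ + n₂)) → ZMod k) {c : Cells k m (2 * (n₁ + n₂))} :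
    Good n₁ n₂ (shiftCells s c) ↔ Good n₁ n₂ c := by
  simp [Good, lf_shiftCells]

/-- The boundary operator of the complex of good cells. -/
def bdGood (k m n₁ n₂ : ℕ) : Matrix (GoodCells k m n₁ n₂) (GoodCells k m n₁ n₂) (ZMod k) :=
  (bdOn Finset.univ).submatrix Subtype.val Subtype.val

theorem exists_face_of_bdGood_ne_zero {x y : GoodCells k m n₁ n₂}
    (h : bdGood k m n₁ n₂ x y ≠ 0) : ∃ i, Face x.1 y.1 i := by
  rw [bdGood, Matrix.submatrix_apply] at h
  obtain ⟨i, -, hi⟩ := exists_face_of_bdOn_ne_zero h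
  exact ⟨i, hi⟩

theorem good_of_bdOn_ne_zero {I : Finset (Fin (2 * (n₁ + n₂)))} (x y : Cells k m (2 * (n₁ + n₂)))
    (hx : Good n₁ n₂ x) (h : bdOn I x y ≠ 0) : Good n₁ n₂ y := by
  obtain ⟨i, -, hi⟩ := exists_face_of_bdOn_ne_zero h
  exact hi.good hx

/-- The rotation angles of the stars under an element of the symmetry group. -/
def angle (n₁ : ℕ) (p : Fin (2 * (n₁ + n₂)) → ZMod k) (g : ZMod k × ZMod k)
    (i : Fin (2 * (n₁ + n₂))) : ZMod k := if i.val < 2 * n₁ then g.1 else g.1 * p i + g.2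

variable (p : Fin (2 * (n₁ + n₂)) → ZMod k)

/-- The action of the symmetry group on the good cells. -/
def act (g : ZMod k × ZMod k) : Equiv.Perm (GoodCells k m n₁ n₂) where
  toFun c := ⟨shiftCells (angle n₁ p g) c.1, (good_shiftCells _).2 c.2⟩
  invFun c := ⟨shiftCells (-angle n₁ p g) c.1, (good_shiftCells _).2 c.2⟩
  left_inv c := Subtype.ext (shiftCells_neg _ _)
  right_inv c := Subtype.ext (by simpa using shiftCells_neg (-angle n₁ p g) c.1)

/-- The leg of the first nonzero coordinate of the first block. -/
def labX (n₁ n₂ : ℕ) (c : Cells k m (2 * (n₁ + n₂))) : ZMod k :=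
  lead (nz (blk₁ n₁ n₂) c) fun i => (c i).leg

/-- The normalized leg of the first nonzero coordinate of the second block. -/
def labT (c : Cells k m (2 * (n₁ + n₂))) : ZMod k :=
  lead (nz (blk₂ n₁ n₂) c) fun i => (c i).leg - labX n₁ n₂ c * p i

/-- The directions of type `j`. -/
def blkType (j : ZMod k) : Finset (Fin (2 * (n₁ + n₂))) :=
  (blk₂ n₁ n₂).filter fun i => j * p i = 1

/-- The label attached to the directions of type `j`. -/
def labY (j : ZMod k) (c : Cells k m (2 * (n₁ + n₂))) : ZMod k :=
  if (nz (blkType p j) c).Nonempty then j * lead (nz (blkType p j) c) fun i => (c i).leg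
  else labX n₁ n₂ c + j * labT p c

/-- The label of a fundamental domain. -/
noncomputable def labFund (c : Cells k m (2 * (n₁ + n₂))) : ZMod k × ZMod k :=
  (lead (lf (blk₁ n₁ n₂) c) fun i => (c i).leg,
    lead (lf (blk₂ n₁ n₂) c) fun i =>
      (c i).leg - (lead (lf (blk₁ n₁ n₂) c) fun i => (c i).leg) * p i)

theorem lead_shift {c : Cells k m (2 * (n₁ + n₂))} {S : Finset (Fin (2 * (n₁ + n₂)))}
    (hS : S.Nonempty) (hS' : ∀ i ∈ S, c i ≠ none ∧ i.val < 2 * n₁) (g : ZMod k × ZMod k) :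
    lead S (fun i => (shiftCells (angle n₁ p g) c i).leg) = g.1 + lead S fun i => (c i).leg := by
  rw [← lead_map hS fun x => g.1 + x]
  refine lead_congr fun i hi => ?_
  rw [shiftCells, Cell.leg_shift _ (hS' i hi).1, angle, if_pos (hS' i hi).2]

theorem lead_shift' {c : Cells k m (2 * (n₁ + n₂))} {S : Finset (Fin (2 * (n₁ + n₂)))}
    (hS : S.Nonempty) (hS' : ∀ i ∈ S, c i ≠ none ∧ 2 * n₁ ≤ i.val) (g : ZMod k × ZMod k)
    (u : ZMod k) :
    lead S (fun i => (shiftCells (angle n₁ p g) c i).leg - (g.1 + u) * p i)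
      = g.2 + lead S fun i => (c i).leg - u * p i := by
  rw [← lead_map hS fun x => g.2 + x]
  refine lead_congr fun i hi => ?_
  rw [shiftCells, Cell.leg_shift _ (hS' i hi).1, angle, if_neg (not_lt.2 (hS' i hi).2)]
  ring

theorem labX_shift {c : Cells k m (2 * (n₁ + n₂))} (hc : Good n₁ n₂ c) (g : ZMod k × ZMod k) :
    labX n₁ n₂ (shiftCells (angle n₁ p g) c) = g.1 + labX n₁ n₂ c := by
  rw [labX, nz_shiftCells, lead_shift p hc.nz₁]
  · rfl
  · exact fun i hi => ⟨(Finset.mem_filter.1 hi).2, mem_blk₁.1 (Finset.mem_filter.1 hi).1⟩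

theorem labT_shift {c : Cells k m (2 * (n₁ + n₂))} (hc : Good n₁ n₂ c) (g : ZMod k × ZMod k) :
    labT p (shiftCells (angle n₁ p g) c) = g.2 + labT p c := by
  rw [labT, nz_shiftCells, labX_shift p hc, lead_shift' p hc.nz₂]
  · rfl
  · exact fun i hi => ⟨(Finset.mem_filter.1 hi).2, mem_blk₂.1 (Finset.mem_filter.1 hi).1⟩

theorem labY_shift (j : ZMod k) {c : Cells k m (2 * (n₁ + n₂))} (hc : Good n₁ n₂ c)
    (g : ZMod k × ZMod k) :
    labY p j (shiftCells (angle n₁ p g) c) = g.1 + j * g.2 + labY p j c := by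
  unfold labY
  rw [nz_shiftCells, labX_shift p hc, labT_shift p hc]
  split_ifs with h
  · rw [← lead_map h fun x => j * x, ← lead_map h fun x => j * x, ← lead_map h fun x => g.1 + j * g.2 + x]
    refine lead_congr fun i hi => ?_
    obtain ⟨hi, hi'⟩ := Finset.mem_filter.1 hi
    obtain ⟨hi, hj⟩ := Finset.mem_filter.1 hi
    rw [shiftCells, Cell.leg_shift _ hi', angle, if_neg (not_lt.2 (mem_blk₂.1 hi))]
    linear_combination g.1 * hj
  · ring

theorem labFund_act (g : ZMod k × ZMod k) (c : GoodCells k m n₁ n₂) :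
    labFund p (act p g c).1 = g + labFund p c.1 := by
  have h1 : (lead (lf (blk₁ n₁ n₂) c.1) fun i => (shiftCells (angle n₁ p g) c.1 i).leg)
      = g.1 + lead (lf (blk₁ n₁ n₂) c.1) fun i => (c.1 i).leg := by
    refine lead_shift p c.2.1 (fun i hi => ?_) g
    have := Finset.mem_filter.1 (lf_subset_nz _ _ hi)
    exact ⟨this.2, mem_blk₁.1 this.1⟩
  simp only [labFund, act, Equiv.coe_fn_mk, lf_shiftCells, h1]
  refine Prod.ext rfl (lead_shift' p c.2.2 (fun i hi => ?_) g _)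
  have := Finset.mem_filter.1 (lf_subset_nz _ _ hi)
  exact ⟨this.2, mem_blk₂.1 this.1⟩

theorem card_nz_mono {x y : Cells k m (2 * (n₁ + n₂))} {i : Fin (2 * (n₁ + n₂))} (h : Face x y i)
    (I : Finset (Fin (2 * (n₁ + n₂)))) : (nz I y).card ≤ (nz I x).card :=
  Finset.card_le_card (h.nz_subset I)

theorem labX_rank {x y : Cells k m (2 * (n₁ + n₂))} {i : Fin (2 * (n₁ + n₂))} (h : Face x y i)
    (hl : labX n₁ n₂ x ≠ labX n₁ n₂ y) : (nz (blk₁ n₁ n₂) y).card < (nz (blk₁ n₁ n₂) x).card := by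
  refine Finset.card_lt_card ((h.nz_subset _).ssubset_of_ne fun h' => hl ?_)
  exact (h.lead_eq_of_nz h').symm

theorem labY_rank {j : ZMod k} {x y : Cells k m (2 * (n₁ + n₂))} {i : Fin (2 * (n₁ + n₂))}
    (h : Face x y i) (hl : labY p j x ≠ labY p j y) :
    (nz (blkType p j) y).card = 0 ∨ (nz (blkType p j) y).card < (nz (blkType p j) x).card := by
  by_contra! h'
  have h1 : (nz (blkType p j) y).Nonempty := Finset.card_ne_zero.1 h'.1
  have h2 := Finset.eq_of_subset_of_card_le (h.nz_subset (blkType p j)) h'.2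
  have h3 : (nz (blkType p j) x).Nonempty := h2 ▸ h1
  refine hl ?_
  rw [labY, labY, if_pos h1, if_pos h3, h.lead_eq_of_nz h2]

variable [NeZero k]

theorem bdGood_mul_self : bdGood k m n₁ n₂ * bdGood k m n₁ n₂ = 0 := by
  rw [bdGood, submatrix_mul_of_closed good_of_bdOn_ne_zero, bdOn_mul_self]
  rfl

omit [NeZero k] in
theorem bdGood_inv : Inv (act (m := m) p) (bdGood k m n₁ n₂) :=
  fun g x y => bdOn_shift (angle n₁ p g) Finset.univ x.1 y.1

theorem bdGood_mulVec_one : (bdGood k m n₁ n₂).mulVec 1 = 0 := by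
  have := submatrix_mulVec_of_closed (D := bdOn (k := k) (m := m) Finset.univ)
    good_of_bdOn_ne_zero (1 : Cells k m (2 * (n₁ + n₂)) → ZMod k)
  rw [bdOn_mulVec_one] at this
  exact this

end Setup

section Kernel

variable {k : ℕ} [NeZero k]

/-- The kernel of a cycle on the join of two copies of `ZMod k`. -/
def kap (a b : ZMod k) : ZMod k := (if b = a then 1 else 0) - (if b = a + 1 then 1 else 0)

theorem sum_kap_left (b : ZMod k) : ∑ a, kap a b = 0 := by
  simp only [kap, Finset.sum_sub_distrib]
  rw [sub_eq_zero]
  have : ∀ a : ZMod k, b = a + 1 ↔ b - 1 = a := fun a => sub_eq_iff_eq_add.symm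
  simp [this]

theorem sum_kap_right (a : ZMod k) : ∑ b, kap a b = 0 := by
  simp [kap, Finset.sum_sub_distrib]

end Kernel

theorem Cell.not_isLeaf_tail {k m : ℕ} (c : Cell k m) : ¬ c.tail.isLeaf := by
  rcases c with _ | ⟨a, r, e⟩
  · exact id
  · induction r using Fin.cases with
    | zero => exact id
    | succ s => exact fun h => (Fin.castSucc_lt_last s).ne h.1

theorem Cell.eq_lastEdge_of_isLeaf_head {k m : ℕ} {e : Cell k m} (h : e.isEdge = true)
    (h' : e.head.isLeaf) : e = lastEdge e.leg := by
  rcases e with _ | ⟨a, r, e⟩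
  · exact h'.elim
  · obtain rfl : e = true := h
    obtain rfl : r = Fin.last m := h'.1
    rfl

section VecMul

variable {k m M : ℕ} [NeZero k]

theorem dd_vecMul (i : Fin M) (ω : Cells k m M → ZMod k) (c : Cells k m M) :
    Matrix.vecMul ω (dd i) c = ∑ e : Cell k m, if e.isEdge then
      sgn c i * ω (Function.update c i e) * ((if c i = e.head then 1 else 0)
        - (if c i = e.tail then 1 else 0)) else 0 := by
  simp only [Matrix.vecMul, dotProduct]
  symm
  refine Finset.sum_of_injOn (fun e => Function.update c i e)
    (Function.update_injective c i).injOn (fun _ _ => Finset.mem_coe.2 (Finset.mem_univ _)) ?_ ?_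
  · intro c' _ hc'
    rw [mul_eq_zero_of_right]
    by_contra h
    refine hc' ⟨c' i, by simp, ?_⟩
    rcases (face_of_dd_ne_zero h).2 with h | h <;> simp [h]
  · intro e _
    have h1 : ∀ v, c = Function.update c i v ↔ c i = v := fun v => by
      rw [Function.eq_update_iff]; simp
    simp only [dd, Matrix.of_apply, Function.update_self, Function.update_idem, h1,
      sgn_update_of_le c le_rfl]
    split_ifs <;> ring

open Classical in
theorem sum_edges (h : ZMod k → ZMod k) (v : Cell k m) :
    (∑ e : Cell k m, if e.isEdge then
      h e.leg * ((if v = e.head then 1 else 0) - (if v = e.tail then 1 else 0)) else 0)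
    = if v = none then - ∑ a, h a else if v.isLeaf then h v.leg else 0 := by
  have h1 : ∀ g : Cell k m → ZMod k, (∑ e : Cell k m, if e.isEdge then g e else 0)
      = ∑ a, ∑ r, g (some (a, r, true)) := by
    intro g
    simp [Fintype.sum_option, Fintype.sum_prod_type, Cell.isEdge]
  rw [h1]
  rcases v with _ | ⟨b, r, e⟩
  · simp [Cell.head, Cell.tail, Cell.leg, Fin.sum_univ_succ]
  · cases e
    · simp only [Cell.head, Cell.tail, Cell.leg, Cell.isLeaf, Option.some.injEq, Prod.mk.injEq,
        and_true, mul_sub, Finset.sum_sub_distrib, reduceCtorEq, if_false]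
      have h2 : ∑ a, ∑ s : Fin (m + 1), (h a * if b = a ∧ r = s then 1 else 0) = h b := by
        rw [Finset.sum_eq_single b, Finset.sum_eq_single r] <;> simp +contextual [eq_comm]
      rw [h2]
      induction r using Fin.lastCases with
      | last =>
        simp [Fin.sum_univ_succ, (Fin.castSucc_lt_last _).ne']
      | cast s =>
        rw [Finset.sum_eq_single b, Fin.sum_univ_succ, Finset.sum_eq_single s] <;>
          simp +contextual [eq_comm]
        intro b' hb
        symm
        refine Finset.sum_eq_zero fun x _ => ?_
        induction x using Fin.cases <;> simp [hb]
    · simp [Cell.head, Cell.tail, Cell.leg, Cell.isLeaf, Fin.sum_univ_succ]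

theorem dd_vecMul_of_isEdge {i : Fin M} (ω : Cells k m M → ZMod k) {c : Cells k m M}
    (h : (c i).isEdge = true) : Matrix.vecMul ω (dd i) c = 0 := by
  rw [dd_vecMul]
  refine Finset.sum_eq_zero fun e _ => ?_
  have h1 : c i ≠ e.head := fun h' => by simp [h', Cell.head_isEdge] at h
  have h2 : c i ≠ e.tail := fun h' => by simp [h', Cell.tail_isEdge] at h
  simp [h1, h2]

theorem dd_vecMul_of_isLeaf {i : Fin M} (ω : Cells k m M → ZMod k) {c : Cells k m M}
    (h : (c i).isLeaf) : Matrix.vecMul ω (dd i) c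
      = sgn c i * ω (Function.update c i (Cell.lastEdge (c i).leg)) := by
  rw [dd_vecMul, Finset.sum_eq_single (Cell.lastEdge (c i).leg)]
  · have h1 : c i = (Cell.lastEdge (c i).leg).head := Cell.eq_leafOf_of_isLeaf h
    have h2 : c i ≠ (Cell.lastEdge (c i).leg).tail := fun h' =>
      Cell.not_isLeaf_tail (Cell.lastEdge (c i).leg) (h' ▸ h)
    have h3 : (Cell.lastEdge (m := m) (c i).leg).isEdge = true := rfl
    rw [if_pos h3, if_pos h1, if_neg h2, sub_zero, mul_one]
  · intro e _ he
    have h2 : c i ≠ e.tail := fun h' => Cell.not_isLeaf_tail e (h' ▸ h)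
    rw [if_neg h2]
    split_ifs with h1 h3
    · refine absurd ?_ he
      rw [h3, Cell.head_leg]
      exact Cell.eq_lastEdge_of_isLeaf_head h1 (h3 ▸ h)
    · simp
    · rfl
  · simp

theorem bdOn_mul_comm (I J : Finset (Fin M)) :
    bdOn (k := k) (m := m) I * bdOn J = -(bdOn J * bdOn I) :=
  eq_neg_of_add_eq_zero_left (bdOn_anticomm I J)

end VecMul

section Cycle

variable {k m N : ℕ}

/-- The first direction of the `q`-th pair. -/
def ev (q : Fin N) : Fin (2 * N) := ⟨2 * q, by omega⟩

/-- The second direction of the `q`-th pair. -/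
def od (q : Fin N) : Fin (2 * N) := ⟨2 * q + 1, by omega⟩

theorem eq_ev_or_od (i : Fin (2 * N)) : ∃ q : Fin N, i = ev q ∨ i = od q := by
  refine ⟨⟨i / 2, by omega⟩, ?_⟩
  simp only [ev, od, Fin.ext_iff]
  omega

/-- The weight of a top-dimensional cell in the fundamental cycle. -/
def omegaHat (c : Cells k m (2 * N)) : ZMod k :=
  if ∀ i, (c i).isEdge = true then ∏ q, kap (c (ev q)).leg (c (od q)).leg else 0

theorem omegaHat_congr {c c' : Cells k m (2 * N)} (h : ∀ i, (c i).isEdge = (c' i).isEdge)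
    (h' : ∀ i, (c i).leg = (c' i).leg) : omegaHat c = omegaHat c' := by
  simp only [omegaHat, h, h']

variable [NeZero k]

theorem sum_omegaHat_update (c : Cells k m (2 * N)) (i : Fin (2 * N)) :
    ∑ a, omegaHat (Function.update c i (Cell.firstEdge a)) = 0 := by
  by_cases hc : ∀ j ≠ i, (c j).isEdge = true
  · have h1 : ∀ a, omegaHat (Function.update c i (Cell.firstEdge a)) = ∏ q, kap
        (Function.update c i (Cell.firstEdge a) (ev q)).leg
        (Function.update c i (Cell.firstEdge a) (od q)).leg := by
      intro a
      rw [omegaHat, if_pos]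
      intro j
      by_cases hj : j = i
      · subst hj; simp [Cell.firstEdge, Cell.isEdge]
      · rw [Function.update_of_ne hj, hc j hj]
    simp only [h1]
    obtain ⟨q, hq⟩ := eq_ev_or_od i
    have h2 : ∀ a, ∏ q' ∈ Finset.univ.erase q,
        kap (Function.update c i (Cell.firstEdge a) (ev q')).leg
          (Function.update c i (Cell.firstEdge a) (od q')).leg
        = ∏ q' ∈ Finset.univ.erase q, kap (c (ev q')).leg (c (od q')).leg := by
      intro a
      refine Finset.prod_congr rfl fun q' hq' => ?_
      have hne := (Finset.mem_erase.1 hq').1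
      have h3 : ev q' ≠ i ∧ od q' ≠ i := by
        rcases hq with rfl | rfl <;> simp only [ev, od, ne_eq, Fin.ext_iff] at hne ⊢ <;> omega
      rw [Function.update_of_ne h3.1, Function.update_of_ne h3.2]
    simp only [← Finset.mul_prod_erase _ _ (Finset.mem_univ q), h2, ← Finset.sum_mul]
    have hne : ev q ≠ od q := by simp [ev, od]
    rcases hq with rfl | rfl
    · simp [Function.update_of_ne hne.symm, Cell.firstEdge, Cell.leg, sum_kap_left]
    · simp [Function.update_of_ne hne, Cell.firstEdge, Cell.leg, sum_kap_right]
  · push Not at hc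
    obtain ⟨j, hj, hc⟩ := hc
    refine Finset.sum_eq_zero fun a _ => ?_
    rw [omegaHat, if_neg]
    intro h
    exact hc (by simpa [Function.update_of_ne hj] using h j)

theorem omegaHat_vecMul_dd {c : Cells k m (2 * N)} {i : Fin (2 * N)} (h : ¬ (c i).isLeaf) :
    Matrix.vecMul omegaHat (dd i) c = 0 := by
  classical
  have h1 : ∀ e : Cell k m, e.isEdge = true → omegaHat (Function.update c i e)
      = omegaHat (Function.update c i (Cell.firstEdge e.leg)) := by
    intro e he
    refine omegaHat_congr (fun j => ?_) fun j => ?_ <;> by_cases hj : j = i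
    · subst hj; simpa [Cell.firstEdge, Cell.isEdge] using he
    · simp [Function.update_of_ne hj]
    · subst hj; simp [Cell.firstEdge, Cell.leg]
    · simp [Function.update_of_ne hj]
  rw [dd_vecMul]
  have h2 := sum_edges (m := m)
    (fun a => sgn c i * omegaHat (Function.update c i (Cell.firstEdge a))) (c i)
  rw [if_neg h, ← Finset.mul_sum, sum_omegaHat_update, mul_zero, neg_zero, ite_self] at h2
  refine Eq.trans (Finset.sum_congr rfl fun e _ => ?_) h2
  by_cases he : e.isEdge = true
  · rw [if_pos he, if_pos he, h1 e he]
  · rw [if_neg he, if_neg he]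

theorem omegaHat_vecMul_bdOn {c : Cells k m (2 * N)} {I : Finset (Fin (2 * N))}
    (h : ¬ (lf I c).Nonempty) : Matrix.vecMul omegaHat (bdOn I) c = 0 := by
  classical
  rw [bdOn, Matrix.vecMul_sum, Finset.sum_apply]
  refine Finset.sum_eq_zero fun i hi => omegaHat_vecMul_dd fun h' => h ⟨i, ?_⟩
  exact Finset.mem_filter.2 ⟨hi, h'⟩

omit [NeZero k] in
theorem lf_eq_of_bdOn_ne_zero {M : ℕ} {c c' : Cells k m M} {I J : Finset (Fin M)}
    (hIJ : Disjoint I J) (h : bdOn J c c' ≠ 0) : lf I c' = lf I c := by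
  classical
  obtain ⟨i, hi, hF⟩ := exists_face_of_bdOn_ne_zero h
  refine Finset.filter_congr fun j hj => ?_
  rw [hF.eq_of_ne]
  rintro rfl
  exact Finset.disjoint_left.1 hIJ hj hi

theorem omegaHat_vecMul_bdOn_bdOn {c : Cells k m (2 * N)} {I J : Finset (Fin (2 * N))}
    (hIJ : Disjoint I J) (h : ¬ (lf I c).Nonempty) :
    Matrix.vecMul omegaHat (bdOn I * bdOn J) c = 0 := by
  rw [← Matrix.vecMul_vecMul, Matrix.vecMul, dotProduct]
  refine Finset.sum_eq_zero fun c' _ => ?_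
  by_cases h0 : bdOn J c' c = 0
  · rw [h0, mul_zero]
  · rw [omegaHat_vecMul_bdOn, zero_mul]
    rwa [← lf_eq_of_bdOn_ne_zero hIJ h0]

end Cycle

section Setup

variable {k m n₁ n₂ : ℕ} [NeZero k]

/-- The fundamental cycle of the complex of good cells. -/
def omega (n₁ n₂ : ℕ) : Cells k m (2 * (n₁ + n₂)) → ZMod k :=
  Matrix.vecMul omegaHat (bdOn (blk₁ n₁ n₂) * bdOn (blk₂ n₁ n₂))

theorem disjoint_blk : Disjoint (blk₁ n₁ n₂) (blk₂ n₁ n₂) :=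
  Finset.disjoint_left.2 fun _ h h' => absurd (mem_blk₁.1 h) (not_lt.2 (mem_blk₂.1 h'))

theorem univ_eq_blk : (Finset.univ : Finset (Fin (2 * (n₁ + n₂)))) = blk₁ n₁ n₂ ∪ blk₂ n₁ n₂ := by
  ext i
  simp [mem_blk₁, mem_blk₂, lt_or_ge]

theorem good_of_omega_ne_zero {c : Cells k m (2 * (n₁ + n₂))} (h : omega n₁ n₂ c ≠ 0) :
    Good n₁ n₂ c := by
  constructor
  · by_contra h'
    exact h (omegaHat_vecMul_bdOn_bdOn disjoint_blk h')
  · by_contra h'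
    refine h ?_
    rw [omega, bdOn_mul_comm, Matrix.vecMul_neg, Pi.neg_apply,
      omegaHat_vecMul_bdOn_bdOn disjoint_blk.symm h', neg_zero]

theorem omega_vecMul_bdGood :
    Matrix.vecMul (fun c : GoodCells k m n₁ n₂ => omega n₁ n₂ c.1) (bdGood k m n₁ n₂) = 0 := by
  have h : Matrix.vecMul (omega n₁ n₂) (bdOn (k := k) (m := m) Finset.univ) = 0 := by
    have h1 : bdOn (k := k) (m := m) Finset.univ = bdOn (blk₁ n₁ n₂) + bdOn (blk₂ n₁ n₂) := by
      rw [univ_eq_blk, bdOn, Finset.sum_union disjoint_blk]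
      rfl
    rw [omega, Matrix.vecMul_vecMul, h1, Matrix.mul_add, mul_assoc _ (bdOn (blk₂ n₁ n₂)) (bdOn (blk₂ n₁ n₂)),
      bdOn_mul_self,
      mul_zero, add_zero, mul_assoc, bdOn_mul_comm (blk₂ n₁ n₂),
      mul_neg, ← mul_assoc, bdOn_mul_self, zero_mul, neg_zero, Matrix.vecMul_zero]
  ext y
  have := congrFun h y.1
  simp only [Matrix.vecMul, dotProduct] at this ⊢
  rw [Pi.zero_apply] at this ⊢
  rw [← this]
  exact sum_subtype_of_support (P := Good n₁ n₂)
    (fun x => omega n₁ n₂ x * bdOn Finset.univ x y.1) fun x hx => by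
      rw [by_contra fun h => hx (good_of_omega_ne_zero h), zero_mul]

theorem omega_shiftCells {s : Fin (2 * (n₁ + n₂)) → ZMod k} (hs : ∀ q, s (ev q) = s (od q))
    (c : Cells k m (2 * (n₁ + n₂))) : omega n₁ n₂ (shiftCells s c) = omega n₁ n₂ c := by
  let σ : Equiv.Perm (Cells k m (2 * (n₁ + n₂))) :=
    Equiv.ofBijective _ (Finite.injective_iff_bijective.1 (shiftCells_injective s))
  have h1 : ∀ I, Inv (fun _ : Unit => σ) (bdOn (k := k) (m := m) (M := 2 * (n₁ + n₂)) I) :=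
    fun I _ x y => bdOn_shift s I x y
  have h2 := (h1 (blk₁ n₁ n₂)).mul (h1 (blk₂ n₁ n₂))
  have h3 : ∀ x : Cells k m (2 * (n₁ + n₂)), omegaHat (σ x) = omegaHat x := by
    intro x
    change omegaHat (shiftCells s x) = omegaHat x
    simp only [omegaHat, shiftCells, Cell.isEdge_shift]
    split_ifs with h
    · refine Finset.prod_congr rfl fun q _ => ?_
      rw [Cell.leg_shift _ (Cell.ne_none_of_isEdge (h _)),
        Cell.leg_shift _ (Cell.ne_none_of_isEdge (h _)), hs]
      simp only [kap, add_assoc, add_right_inj]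
    · rfl
  change omega n₁ n₂ (σ c) = omega n₁ n₂ c
  simp only [omega, Matrix.vecMul, dotProduct]
  rw [← Equiv.sum_comp σ]
  exact Finset.sum_congr rfl fun x _ => by rw [h3, h2 ()]

theorem shape_of_omega_ne_zero {c : Cells k m (2 * (n₁ + n₂))} (h : omega n₁ n₂ c ≠ 0) :
    ∃ i ∈ blk₁ n₁ n₂, ∃ j ∈ blk₂ n₁ n₂, (c i).isLeaf ∧ (c j).isLeaf ∧
      ∀ l, l ≠ i → l ≠ j → (c l).isEdge = true := by
  classical
  have hG := good_of_omega_ne_zero h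
  rw [omega, Matrix.vecMul, dotProduct] at h
  obtain ⟨x, -, hx⟩ := Finset.exists_ne_zero_of_sum_ne_zero h
  have hE : ∀ i, (x i).isEdge = true := by
    by_contra h'
    exact left_ne_zero_of_mul hx (by rw [omegaHat, if_neg h'])
  have hx' := right_ne_zero_of_mul hx
  rw [Matrix.mul_apply] at hx'
  obtain ⟨y, -, hy⟩ := Finset.exists_ne_zero_of_sum_ne_zero hx'
  obtain ⟨i, hi, hFi⟩ := exists_face_of_bdOn_ne_zero (left_ne_zero_of_mul hy)
  obtain ⟨j, hj, hFj⟩ := exists_face_of_bdOn_ne_zero (right_ne_zero_of_mul hy)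
  have hel : ∀ l, l ≠ i → l ≠ j → (c l).isEdge = true := by
    intro l hl hl'
    rw [hFj.eq_of_ne hl', hFi.eq_of_ne hl, hE]
  refine ⟨i, hi, j, hj, ?_, ?_, hel⟩
  · obtain ⟨l, hl⟩ := hG.1
    obtain ⟨hl, hl'⟩ := Finset.mem_filter.1 hl
    by_cases hli : l = i
    · rwa [← hli]
    · have := hel l hli fun h => Finset.disjoint_left.1 disjoint_blk hl (h ▸ hj)
      rw [Cell.isEdge_eq_false_of_isLeaf hl'] at this
      exact absurd this Bool.false_ne_true
  · obtain ⟨l, hl⟩ := hG.2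
    obtain ⟨hl, hl'⟩ := Finset.mem_filter.1 hl
    by_cases hlj : l = j
    · rwa [← hlj]
    · have := hel l (fun h => Finset.disjoint_left.1 disjoint_blk hi (h ▸ hl)) hlj
      rw [Cell.isEdge_eq_false_of_isLeaf hl'] at this
      exact absurd this Bool.false_ne_true

end Setup

section Step

variable {k m M : ℕ} [NeZero k]

theorem bdOn_univ_mulVec_eq {s : Cells k m M} {i : Fin M} (hs : ∀ j < i, (s j).isEdge = false)
    (hi : s i ≠ none) {G : Cells k m M → ZMod k}
    (hG : ∀ s' j, Face s s' j → s' i ≠ none → G s' = 0) :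
    (bdOn Finset.univ).mulVec G s =
      (if s i = Cell.firstEdge (s i).leg then -1 else 0) * G (Function.update s i none) := by
  rw [bdOn, Matrix.sum_mulVec, Finset.sum_apply, Finset.sum_eq_single i]
  · have hsgn : sgn s i = 1 := Finset.prod_eq_one fun j hj => by
      rw [hs j (Finset.mem_filter.1 hj).2]; rfl
    rw [dd_mulVec, hsgn, one_mul]
    by_cases he : (s i).isEdge = true
    · rw [if_pos he, hG _ i ⟨he, Or.inl rfl⟩ (by simpa using Cell.head_ne_none hi), zero_sub]
      by_cases ht : (s i).tail = none
      · rw [if_pos (Cell.eq_firstEdge_of_tail_eq_none he ht), ht, neg_one_mul]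
      · rw [hG _ i ⟨he, Or.inr rfl⟩ (by simpa using ht), if_neg, zero_mul, neg_zero]
        intro h
        rw [h] at ht
        exact ht rfl
    · rw [if_neg he, if_neg, zero_mul]
      intro h
      rw [h] at he
      exact he rfl
  · intro j _ hj
    rw [dd_mulVec]
    split_ifs with he
    · rw [hG _ j ⟨he, Or.inl rfl⟩ (by rwa [Function.update_of_ne hj.symm]),
        hG _ j ⟨he, Or.inr rfl⟩ (by rwa [Function.update_of_ne hj.symm]), sub_zero, mul_zero]
    · rfl
  · simp

theorem op1_mulVec {Q R : Type*} [Fintype Q] [CommRing R] (D : Matrix Q Q R) (V : Q → Q → R)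
    (φ : Q → R) (x : Q) : (op1 D V).mulVec φ x = D.mulVec (fun y => V x y * φ y) x := by
  simp [op1, Matrix.mulVec, dotProduct, mul_assoc]

theorem op2_mulVec {Q R : Type*} [Fintype Q] [CommRing R] (D : Matrix Q Q R) (c : Q → Q → Q → R)
    (φ : Q → R) (x : Q) : (op2 D c).mulVec φ x
      = D.mulVec (fun y => D.mulVec (fun z => c x y z * φ z) y) x := by
  simp only [op2, Matrix.mulVec, dotProduct, Matrix.of_apply, Finset.sum_mul, Finset.mul_sum]
  rw [Finset.sum_comm]
  exact Finset.sum_congr rfl fun y _ => Finset.sum_congr rfl fun z _ => by ring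

/-- Replace the coordinates before the `i`-th one by centers, except for the `L`-th one. -/
def clr (L : ℕ) (c : Cells k m M) (i : ℕ) : Cells k m M :=
  fun j => if j.val < i ∧ j.val ≠ L then none else c j

/-- The leg of the `i`-th coordinate. -/
def legAt (c : Cells k m M) (i : ℕ) : ZMod k := if h : i < M then (c ⟨i, h⟩).leg else 0

/-- Whether the `i`-th coordinate is an edge at the center. -/
def firstAt (c : Cells k m M) (i : ℕ) : ZMod k :=
  if h : i < M then (if c ⟨i, h⟩ = Cell.firstEdge (c ⟨i, h⟩).leg then 1 else 0) else 0

/-- At the `i`-th stage the label only changes when the `i`-th coordinate becomes a center. -/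
structure Stage (L : ℕ) (ε : Cells k m M → ZMod k) (c : Cells k m M) (i : ℕ) : Prop where
  lt : i < M
  ne : i ≠ L
  isEdge : ∀ j : Fin M, j.val < i → (clr L c i j).isEdge = false
  ne_none : c ⟨i, lt⟩ ≠ none
  lab : ∀ s' j, Face (clr L c i) s' j → s' ⟨i, lt⟩ ≠ none → ε s' = ε (clr L c i)

variable {L : ℕ} {ε : Cells k m M → ZMod k} {c : Cells k m M} {i : ℕ}

omit [NeZero k] in
theorem clr_update (hi : i < M) (hL : i ≠ L) :
    Function.update (clr L c i) ⟨i, hi⟩ none = clr L c (i + 1) := by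
  funext j
  by_cases hj : j = ⟨i, hi⟩
  · subst hj
    simp [clr, hL]
  · rw [Function.update_of_ne hj]
    have : j.val ≠ i := fun h => hj (Fin.ext h)
    have h2 : j.val < i ↔ j.val < i + 1 := by omega
    simp only [clr, h2]

omit [NeZero k] in
theorem clr_self (hi : i < M) : clr L c i ⟨i, hi⟩ = c ⟨i, hi⟩ := by simp [clr]

theorem Stage.mulVec_eq (h : Stage L ε c i) {G : Cells k m M → ZMod k}
    (hG : ∀ s', ε s' = ε (clr L c i) → G s' = 0) :
    (bdOn Finset.univ).mulVec G (clr L c i) = -(firstAt c i * G (clr L c (i + 1))) := by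
  rw [bdOn_univ_mulVec_eq (i := ⟨i, h.lt⟩) (fun j hj => h.isEdge j hj)
    (by rw [clr_self]; exact h.ne_none) fun s' j hF hs' => hG s' (h.lab s' j hF hs'), clr_self,
    clr_update h.lt h.ne, firstAt, dif_pos h.lt]
  split_ifs <;> ring

theorem Stage.op1_mulVec_eq (h : Stage L ε c i) (φ : Cells k m M → ZMod k) :
    (op1 (bdOn Finset.univ) fun x y => ε x - ε y).mulVec φ (clr L c i)
      = -(firstAt c i * ((ε (clr L c i) - ε (clr L c (i + 1))) * φ (clr L c (i + 1)))) := by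
  rw [op1_mulVec, h.mulVec_eq]
  intro s' hs'
  rw [hs', sub_self, zero_mul]

theorem Stage.op2_mulVec_eq (h : Stage L ε c i) (h' : Stage L ε c (i + 1))
    (φ : Cells k m M → ZMod k) :
    (op2 (bdOn Finset.univ) (carry ε)).mulVec φ (clr L c i)
      = firstAt c i * firstAt c (i + 1) *
        (crZ (ε (clr L c i) - ε (clr L c (i + 1))) (ε (clr L c (i + 1)) - ε (clr L c (i + 2))) : ℤ)
        * φ (clr L c (i + 2)) := by
  rw [op2_mulVec, h.mulVec_eq, h'.mulVec_eq]
  · rw [carry]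
    ring
  · intro s' hs'
    rw [carry_eq_zero_right _ hs'.symm, zero_mul]
  · intro s' hs'
    simp only [carry_eq_zero_left hs'.symm, zero_mul]
    exact congrFun (Matrix.mulVec_zero _) _

/-- The contribution of one application of the carry operator. -/
def crAt (A : ℕ → ZMod k) (i : ℕ) : ZMod k := (crZ (A i - A (i + 1)) (A (i + 1) - A (i + 2)) : ℤ)

theorem op2_pow_mulVec_eq {A : ℕ → ZMod k} (n : ℕ)
    (h : ∀ j, i ≤ j → j < i + 2 * n → Stage L ε c j)
    (hA : ∀ j, i ≤ j → j ≤ i + 2 * n → ε (clr L c j) = A j) (φ : Cells k m M → ZMod k) :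
    (op2 (bdOn Finset.univ) (carry ε) ^ n).mulVec φ (clr L c i)
      = (∏ l ∈ Finset.range n, firstAt c (i + 2 * l) * firstAt c (i + 2 * l + 1)
        * crAt A (i + 2 * l)) * φ (clr L c (i + 2 * n)) := by
  induction n generalizing φ with
  | zero => simp
  | succ n ih =>
    rw [pow_succ, ← Matrix.mulVec_mulVec, ih (fun j h1 h2 => h j h1 (by omega))
      (fun j h1 h2 => hA j h1 (by omega)),
      (h (i + 2 * n) (by omega) (by omega)).op2_mulVec_eq (h (i + 2 * n + 1) (by omega) (by omega)),
      hA _ (by omega) (by omega), hA (i + 2 * n + 1) (by omega) (by omega),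
      hA (i + 2 * n + 2) (by omega) (by omega), Finset.prod_range_succ, crAt, mul_add 2 n 1,
      mul_one, add_assoc i]
    ring_nf

end Step

section Stages

variable {k m b d : ℕ} {p : Fin (2 * (b + 1 + (d + 1))) → ZMod k}
  {c : Cells k m (2 * (b + 1 + (d + 1)))}

theorem lead_nz_eq {M : ℕ} {I : Finset (Fin M)} {s : Cells k m M} {i : Fin M} (hi : i ∈ I)
    (hsi : s i ≠ none) (hs : ∀ j ∈ I, j < i → s j = none) (g : Fin M → ZMod k) :
    lead (nz I s) g = g i := by
  refine lead_eq (Finset.mem_filter.2 ⟨hi, hsi⟩) fun j hj => ?_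
  obtain ⟨h1, h2⟩ := Finset.mem_filter.1 hj
  exact not_lt.1 fun h => h2 (hs j h1 h)

theorem Face.eq_none {M : ℕ} {s s' : Cells k m M} {i j : Fin M} (h : Face s s' i)
    (hj : s j = none) : s' j = none := by
  by_contra h'
  exact (h.leg_eq h').1 hj

theorem labX_clr (hc : ∀ i, c i ≠ none) {i : ℕ} (hi : i ≤ 2 * b + 1) :
    labX (b + 1) (d + 1) (clr (2 * b + 1) c i) = legAt c i := by
  have hlt : i < 2 * (b + 1 + (d + 1)) := by omega
  rw [labX, lead_nz_eq (i := ⟨i, hlt⟩) (mem_blk₁.2 (by simp; omega)) (by rw [clr_self]; exact hc _),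
    clr_self, legAt, dif_pos hlt]
  intro j _ hj
  exact if_pos ⟨hj, by have : j.val < i := hj; omega⟩

theorem stage_labX (hc : ∀ i, c i ≠ none) {i : ℕ} (hi : i < 2 * b + 1) :
    Stage (2 * b + 1) (labX (b + 1) (d + 1)) c i := by
  have hlt : i < 2 * (b + 1 + (d + 1)) := by omega
  have h0 : ∀ j : Fin _, j.val < i → clr (2 * b + 1) c i j = none :=
    fun j hj => if_pos ⟨hj, by omega⟩
  refine ⟨hlt, hi.ne, fun j hj => by rw [h0 j hj]; rfl, hc _, fun s' j hF hs' => ?_⟩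
  rw [labX_clr hc hi.le, labX, lead_nz_eq (i := ⟨i, hlt⟩) (mem_blk₁.2 (by simp; omega)) hs',
    (hF.leg_eq hs').2, clr_self, legAt, dif_pos hlt]
  exact fun l _ hl => hF.eq_none (h0 l hl)

section Second

variable (hc : ∀ i, c i ≠ none) (hL : (c ⟨2 * b + 1, by omega⟩).isLeaf)
  (hL0 : (c ⟨2 * b + 1, by omega⟩).leg = 0) {i : ℕ} (hi : 2 * (b + 1) ≤ i)
include hL hL0 hi

theorem labX_clr_eq_zero {s : Cells k m (2 * (b + 1 + (d + 1)))}
    (hs : ∀ j : Fin (2 * (b + 1 + (d + 1))), j.val < 2 * (b + 1) → s j = clr (2 * b + 1) c i j) :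
    labX (b + 1) (d + 1) s = 0 := by
  have h1 : s ⟨2 * b + 1, by omega⟩ = c ⟨2 * b + 1, by omega⟩ := by
    rw [hs _ (by simp; omega), clr, if_neg (by simp)]
  rw [labX, lead_nz_eq (i := ⟨2 * b + 1, by omega⟩) (mem_blk₁.2 (by simp; omega)), h1, hL0]
  · rw [h1]
    exact Cell.ne_none_of_isLeaf hL
  · intro j hj hj'
    have hj : j.val < 2 * (b + 1) := mem_blk₁.1 hj
    have hj' : j.val < 2 * b + 1 := hj'
    rw [hs j hj]
    exact if_pos ⟨by omega, by omega⟩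

include hc

theorem labT_clr (hlt : i < 2 * (b + 1 + (d + 1))) :
    labT p (clr (2 * b + 1) c i) = legAt c i := by
  rw [labT, labX_clr_eq_zero hL hL0 hi fun _ _ => rfl, lead_nz_eq (i := ⟨i, hlt⟩)
    (mem_blk₂.2 hi) (by rw [clr_self]; exact hc _), clr_self, legAt, dif_pos hlt, zero_mul, sub_zero]
  intro j hj hj'
  have := mem_blk₂.1 hj
  exact if_pos ⟨hj', by omega⟩

theorem stage_labT (hlt : i < 2 * (b + 1 + (d + 1))) : Stage (2 * b + 1) (labT p) c i := by
  have hE : ∀ j : Fin _, j.val < i → (clr (2 * b + 1) c i j).isEdge = false := by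
    intro j hj
    by_cases hj' : j.val = 2 * b + 1
    · have hjL : j = ⟨2 * b + 1, by omega⟩ := Fin.ext hj'
      rw [hjL, clr, if_neg (by simp)]
      exact Cell.isEdge_eq_false_of_isLeaf hL
    · rw [clr, if_pos ⟨hj, hj'⟩]
      rfl
  refine ⟨hlt, by omega, hE, hc _, fun s' j hF hs' => ?_⟩
  rw [labT_clr hc hL hL0 hi hlt, labT, labX_clr_eq_zero hL hL0 hi, lead_nz_eq (i := ⟨i, hlt⟩)
    (mem_blk₂.2 hi) hs', (hF.leg_eq hs').2, clr_self, legAt, dif_pos hlt, zero_mul, sub_zero]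
  · intro l hl hl'
    have := mem_blk₂.1 hl
    exact hF.eq_none (if_pos ⟨hl', by omega⟩)
  · intro l hl
    refine hF.eq_of_ne ?_
    rintro rfl
    exact absurd hF.1 (by rw [hE l (by omega)]; exact Bool.false_ne_true)

end Second

end Stages

section Chain

variable {k : ℕ}

/-- Extension of a finite sequence by zero. -/
def ext0 {M : ℕ} (α : Fin M → ZMod k) (i : ℕ) : ZMod k := if h : i < M then α ⟨i, h⟩ else 0

theorem ext0_cons_zero {M : ℕ} (a : ZMod k) (α : Fin M → ZMod k) :
    ext0 (Fin.cons a α : Fin (M + 1) → ZMod k) 0 = a := by simp [ext0]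

theorem ext0_cons_succ {M : ℕ} (a : ZMod k) (α : Fin M → ZMod k) (i : ℕ) :
    ext0 (Fin.cons a α : Fin (M + 1) → ZMod k) (i + 1) = ext0 α i := by
  simp only [ext0, add_lt_add_iff_right]
  split_ifs
  · exact Fin.cons_succ (α := fun _ => ZMod k) a α ⟨i, by assumption⟩
  · rfl

theorem sum_chain [NeZero k] (n : ℕ) (K : ℕ → ZMod k → ZMod k → ZMod k) (C : ℕ → ZMod k)
    (hK : ∀ i b, ∑ a, K i a b = C i) {M : ℕ} (hM : M = n + 1) :
    ∑ α : Fin M → ZMod k, (if ext0 α n = 0 then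
      ∏ i ∈ Finset.range n, K i (ext0 α i) (ext0 α (i + 1)) else 0)
      = ∏ i ∈ Finset.range n, C i := by
  subst hM
  induction n generalizing K C with
  | zero =>
    rw [Fintype.sum_eq_single 0]
    · simp [ext0]
    · intro α hα
      refine if_neg fun h => hα ?_
      funext i
      have hi : i = ⟨0, by omega⟩ := Fin.ext (by omega)
      rw [hi]
      simpa [ext0] using h
  | succ n ih =>
    rw [Finset.prod_range_succ', ← ih (fun i => K (i + 1)) (fun i => C (i + 1)) fun i => hK _,
      ← (Fin.consEquiv fun _ => ZMod k).sum_comp, Fintype.sum_prod_type, Finset.sum_comm,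
      Finset.sum_mul]
    refine Finset.sum_congr rfl fun α _ => ?_
    simp only [Fin.consEquiv, Equiv.coe_fn_mk, Finset.prod_range_succ', ext0_cons_succ,
      ext0_cons_zero]
    split_ifs
    · rw [← Finset.mul_sum, hK]
    · simp

theorem prod_range_pairs {R : Type*} [CommMonoid R] (f : ℕ → R) (s n : ℕ) :
    ∏ i ∈ Finset.range (2 * n), f (s + i)
      = ∏ l ∈ Finset.range n, (f (s + 2 * l) * f (s + 2 * l + 1)) := by
  induction n with
  | zero => simp
  | succ n ih =>
    rw [mul_add, mul_one, Finset.prod_range_succ, Finset.prod_range_succ, ih,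
      Finset.prod_range_succ, mul_assoc, add_assoc]

theorem crZ_neg_one_right [Fact k.Prime] (u : ZMod k) :
    crZ u (-1) = if u = 0 then 0 else 1 := by
  obtain ⟨n, hn⟩ := Nat.exists_eq_add_one_of_ne_zero (NeZero.ne k)
  have h1 : (-1 : ZMod k).val = k - 1 := by
    subst hn
    rw [ZMod.val_neg_one]; rfl
  have := (Fact.out : k.Prime).two_le
  rw [crZ, h1]
  by_cases hu : u = 0
  · rw [if_pos hu, hu, ZMod.val_zero, if_neg (by omega)]
  · have := (ZMod.val_ne_zero u).2 hu
    rw [if_neg hu, if_pos (by omega)]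

theorem crZ_comm [NeZero k] (u v : ZMod k) : crZ u v = crZ v u := by rw [crZ, crZ, add_comm]

theorem kap_mul_crZ_right [Fact k.Prime] (x a b : ZMod k) :
    kap a b * (crZ (x - a) (a - b) : ℤ)
      = (if x = a then 0 else 1) * (-(if b = a + 1 then 1 else 0)) := by
  rw [kap]
  by_cases h1 : b = a
  · simp [h1, crZ_zero_right]
  · by_cases h2 : b = a + 1
    · simp only [h2, sub_eq_zero, sub_add_cancel_left, crZ_neg_one_right]
      split_ifs <;> simp_all
    · simp [h1, h2]

theorem kap_mul_crZ_left [Fact k.Prime] (a b y : ZMod k) :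
    kap a b * (crZ (a - b) (b - y) : ℤ)
      = (-(if b = a + 1 then 1 else 0)) * (if b = y then 0 else 1) := by
  rw [kap]
  by_cases h1 : b = a
  · simp [h1, crZ_zero_left]
  · by_cases h2 : b = a + 1
    · simp only [h2, sub_eq_zero, sub_add_cancel_left, crZ_comm (-1), crZ_neg_one_right]
      split_ifs <;> simp_all
    · simp [h1, h2]

variable (b d : ℕ)

/-- The transfer kernels of the evaluation of the cycle. -/
def transfer (i : ℕ) (x y : ZMod k) : ZMod k :=
  if i = 0 ∨ i = 2 * b + 2 + 2 * d then kap x y * (x - y)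
  else if i = 2 * b + 1 then (if x = 0 then 1 else 0)
  else if i % 2 = 0 then -(if y = x + 1 then 1 else 0)
  else (if x = y then 0 else 1)

/-- The column sums of the transfer kernels. -/
def transferSum (i : ℕ) : ZMod k :=
  if i = 0 ∨ i = 2 * b + 2 + 2 * d then 1
  else if i = 2 * b + 1 then 1
  else -1

theorem sum_transfer [Fact k.Prime] (i : ℕ) (y : ZMod k) :
    ∑ x, transfer b d i x y = transferSum b d i := by
  have h0 : ∀ x : ZMod k, y = x + 1 ↔ y - 1 = x := fun x => sub_eq_iff_eq_add.symm
  unfold transfer transferSum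
  by_cases h1 : i = 0 ∨ i = 2 * b + 2 + 2 * d
  · simp only [if_pos h1]
    rw [Fintype.sum_eq_single (y - 1)]
    · rw [kap, if_neg (by simp [eq_sub_iff_add_eq]), if_pos (by ring)]
      ring
    · intro x hx
      by_cases hxy : y = x
      · subst hxy; simp
      · have : y ≠ x + 1 := fun h => hx ((h0 x).1 h).symm
        simp [kap, hxy, this]
  · simp only [if_neg h1]
    by_cases h2 : i = 2 * b + 1
    · simp [h2]
    · simp only [if_neg h2]
      by_cases h3 : i % 2 = 0
      · simp [h3, h0]
      · simp only [if_neg h3]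
        have h4 : ∀ x : ZMod k, (if x = y then 0 else 1 : ZMod k) = 1 - if x = y then 1 else 0 := by
          intro x; split_ifs <;> simp
        simp [h4, Finset.sum_sub_distrib]

theorem prod_transferSum_ne_zero [Fact k.Prime] (n : ℕ) :
    ∏ i ∈ Finset.range n, transferSum (k := k) b d i ≠ 0 := by
  refine Finset.prod_ne_zero_iff.2 fun i _ => ?_
  unfold transferSum
  split_ifs <;> simp

theorem prod_transfer [Fact k.Prime] (A : ℕ → ZMod k) :
    ∏ i ∈ Finset.range (2 * b + 2 + 2 * d + 1), transfer b d i (A i) (A (i + 1))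
      = (∏ q ∈ Finset.range (b + 1 + (d + 1)), kap (A (2 * q)) (A (2 * q + 1)))
        * (if A (2 * b + 1) = 0 then 1 else 0)
        * ((A 0 - A 1) * ∏ l ∈ Finset.range b, crAt A (1 + 2 * l))
        * ((∏ l ∈ Finset.range d, crAt A (2 * b + 2 + 2 * l))
          * (A (2 * b + 2 + 2 * d) - A (2 * b + 2 + 2 * d + 1))) := by
  have h1 : ∏ i ∈ Finset.range (2 * b + 2 + 2 * d + 1), transfer b d i (A i) (A (i + 1))
      = (kap (A 0) (A 1) * (A 0 - A 1))
      * (∏ l ∈ Finset.range b, (if A (1 + 2 * l) = A (1 + 2 * l + 1) then 0 else 1)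
          * (-(if A (1 + 2 * l + 2) = A (1 + 2 * l + 1) + 1 then 1 else 0)))
      * (if A (2 * b + 1) = 0 then 1 else 0)
      * (∏ l ∈ Finset.range d, (-(if A (2 * b + 2 + 2 * l + 1) = A (2 * b + 2 + 2 * l) + 1
          then 1 else 0)) * (if A (2 * b + 2 + 2 * l + 1) = A (2 * b + 2 + 2 * l + 2) then 0 else 1))
      * (kap (A (2 * b + 2 + 2 * d)) (A (2 * b + 2 + 2 * d + 1))
        * (A (2 * b + 2 + 2 * d) - A (2 * b + 2 + 2 * d + 1))) := by
    rw [Finset.prod_range_succ, Finset.prod_range_add, Finset.prod_range_succ,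
      Finset.prod_range_succ', prod_range_pairs (fun i => transfer b d i (A i) (A (i + 1)))]
    have h2 : ∏ i ∈ Finset.range (2 * b), transfer b d (i + 1) (A (i + 1)) (A (i + 1 + 1))
        = ∏ i ∈ Finset.range (2 * b), transfer b d (1 + i) (A (1 + i)) (A (1 + i + 1)) := by
      simp only [add_comm 1]
    rw [h2, prod_range_pairs (fun i => transfer b d i (A i) (A (i + 1)))]
    have t0 : ∀ x y : ZMod k, transfer b d 0 x y = kap x y * (x - y) := by simp [transfer]
    have t1 : ∀ x y : ZMod k,
        transfer b d (2 * b + 2 + 2 * d) x y = kap x y * (x - y) := by simp [transfer]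
    have t2 : ∀ x y : ZMod k, transfer b d (2 * b + 1) x y = if x = 0 then 1 else 0 := by
      intro x y
      rw [transfer, if_neg (by omega), if_pos rfl]
    have t3 : ∀ i, i ≠ 0 → i ≠ 2 * b + 2 + 2 * d → i % 2 = 0 → ∀ x y : ZMod k,
        transfer b d i x y = -(if y = x + 1 then 1 else 0) := by
      intro i h1 h2 h3 x y
      rw [transfer, if_neg (by omega), if_neg (by omega), if_pos h3]
    have t4 : ∀ i, i ≠ 2 * b + 1 → i % 2 = 1 → ∀ x y : ZMod k,
        transfer b d i x y = if x = y then 0 else 1 := by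
      intro i h1 h2 x y
      rw [transfer, if_neg (by omega), if_neg (by omega), if_neg (by omega)]
    have e1 : ∏ l ∈ Finset.range b, (transfer b d (1 + 2 * l) (A (1 + 2 * l)) (A (1 + 2 * l + 1))
          * transfer b d (1 + 2 * l + 1) (A (1 + 2 * l + 1)) (A (1 + 2 * l + 1 + 1)))
        = ∏ l ∈ Finset.range b, (if A (1 + 2 * l) = A (1 + 2 * l + 1) then 0 else 1)
          * (-(if A (1 + 2 * l + 2) = A (1 + 2 * l + 1) + 1 then 1 else 0)) := by
      refine Finset.prod_congr rfl fun l hl => ?_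
      have := Finset.mem_range.1 hl
      rw [t4 _ (by omega) (by omega), t3 _ (by omega) (by omega) (by omega)]
    have e2 : ∏ l ∈ Finset.range d, (transfer b d (2 * b + 2 + 2 * l) (A (2 * b + 2 + 2 * l))
            (A (2 * b + 2 + 2 * l + 1))
          * transfer b d (2 * b + 2 + 2 * l + 1) (A (2 * b + 2 + 2 * l + 1))
            (A (2 * b + 2 + 2 * l + 1 + 1)))
        = ∏ l ∈ Finset.range d, (-(if A (2 * b + 2 + 2 * l + 1) = A (2 * b + 2 + 2 * l) + 1
          then 1 else 0))
          * (if A (2 * b + 2 + 2 * l + 1) = A (2 * b + 2 + 2 * l + 2) then 0 else 1) := by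
      refine Finset.prod_congr rfl fun l hl => ?_
      have := Finset.mem_range.1 hl
      rw [t3 _ (by omega) (by omega) (by omega), t4 _ (by omega) (by omega)]
    simp only [t0, t1, t2, e1, e2]
    ring
  have h3 : ∏ q ∈ Finset.range (b + 1 + (d + 1)), kap (A (2 * q)) (A (2 * q + 1))
      = kap (A 0) (A 1) * (∏ l ∈ Finset.range b, kap (A (1 + 2 * l + 1)) (A (1 + 2 * l + 2)))
        * (∏ l ∈ Finset.range d, kap (A (2 * b + 2 + 2 * l)) (A (2 * b + 2 + 2 * l + 1)))
        * kap (A (2 * b + 2 + 2 * d)) (A (2 * b + 2 + 2 * d + 1)) := by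
    rw [Finset.prod_range_add, Finset.prod_range_succ', Finset.prod_range_succ]
    have e1 : ∀ l, 2 * (l + 1) = 1 + 2 * l + 1 := fun l => by ring
    have e2 : ∀ l, 2 * (b + 1 + l) = 2 * b + 2 + 2 * l := fun l => by ring
    simp only [e1, e2]
    ring
  have e1 : (∏ l ∈ Finset.range b, kap (A (1 + 2 * l + 1)) (A (1 + 2 * l + 2)))
      * ∏ l ∈ Finset.range b, crAt A (1 + 2 * l)
      = ∏ l ∈ Finset.range b, (if A (1 + 2 * l) = A (1 + 2 * l + 1) then 0 else 1)
          * (-(if A (1 + 2 * l + 2) = A (1 + 2 * l + 1) + 1 then 1 else 0)) := by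
    rw [← Finset.prod_mul_distrib]
    exact Finset.prod_congr rfl fun l _ => kap_mul_crZ_right _ _ _
  have e2 : (∏ l ∈ Finset.range d, kap (A (2 * b + 2 + 2 * l)) (A (2 * b + 2 + 2 * l + 1)))
      * ∏ l ∈ Finset.range d, crAt A (2 * b + 2 + 2 * l)
      = ∏ l ∈ Finset.range d, (-(if A (2 * b + 2 + 2 * l + 1) = A (2 * b + 2 + 2 * l) + 1
          then 1 else 0))
          * (if A (2 * b + 2 + 2 * l + 1) = A (2 * b + 2 + 2 * l + 2) then 0 else 1) := by
    rw [← Finset.prod_mul_distrib]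
    exact Finset.prod_congr rfl fun l _ => kap_mul_crZ_left _ _ _
  rw [h1, h3, ← e1, ← e2]
  ring

end Chain

section Evaluate

variable {k m b d : ℕ} [NeZero k] {p : Fin (2 * (b + 1 + (d + 1))) → ZMod k}
  {c : Cells k m (2 * (b + 1 + (d + 1)))}

theorem bdOn_vecMul_of_isLeaf {M : ℕ} {I : Finset (Fin M)} {i : Fin M} (hi : i ∈ I)
    (ω : Cells k m M → ZMod k) {c : Cells k m M} (h : (c i).isLeaf)
    (hI : ∀ l ∈ I, l ≠ i → (c l).isEdge = true) :
    Matrix.vecMul ω (bdOn I) c = sgn c i * ω (Function.update c i (Cell.lastEdge (c i).leg)) := by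
  have h1 : Matrix.vecMul ω (bdOn I) c = ∑ l ∈ I, Matrix.vecMul ω (dd l) c := by
    simp only [bdOn, Matrix.vecMul, dotProduct, Matrix.sum_apply, Finset.mul_sum]
    exact Finset.sum_comm
  rw [h1, Finset.sum_eq_single_of_mem i hi fun l hl hli => dd_vecMul_of_isEdge ω (hI l hl hli),
    dd_vecMul_of_isLeaf ω h]

theorem omega_eq {n₁ n₂ : ℕ} {c : Cells k m (2 * (n₁ + n₂))} {i j : Fin (2 * (n₁ + n₂))}
    (hi : i ∈ blk₁ n₁ n₂) (hj : j ∈ blk₂ n₁ n₂) (hci : (c i).isLeaf) (hcj : (c j).isLeaf)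
    (hc : ∀ l, l ≠ i → l ≠ j → (c l).isEdge = true) :
    omega n₁ n₂ c = sgn c j * sgn c i * ∏ q, kap (c (ev q)).leg (c (od q)).leg := by
  have hij : i < j := by
    have h1 := mem_blk₁.1 hi
    have h2 := mem_blk₂.1 hj
    exact Fin.lt_def.2 (by omega)
  have hne : ∀ l ∈ blk₂ n₁ n₂, l ≠ i := fun l hl h =>
    Finset.disjoint_left.1 disjoint_blk hi (h ▸ hl)
  have hne' : ∀ l ∈ blk₁ n₁ n₂, l ≠ j := fun l hl h =>
    Finset.disjoint_left.1 disjoint_blk hl (h ▸ hj)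
  have hci' : Function.update c j (Cell.lastEdge (c j).leg) i = c i :=
    Function.update_of_ne hij.ne _ _
  rw [omega, ← Matrix.vecMul_vecMul, bdOn_vecMul_of_isLeaf hj _ hcj fun l hl hlj =>
    hc l (hne l hl) hlj, bdOn_vecMul_of_isLeaf hi, sgn_update_of_le _ hij.le, hci', omegaHat, if_pos]
  · rw [mul_assoc]
    congr 2
    have h1 : ∀ l, (Function.update (Function.update c j (Cell.lastEdge (c j).leg)) i
        (Cell.lastEdge (c i).leg) l).leg = (c l).leg := by
      intro l
      by_cases hli : l = i
      · subst hli; simp [Cell.lastEdge, Cell.leg]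
      · rw [Function.update_of_ne hli]
        by_cases hlj : l = j
        · subst hlj; simp [Cell.lastEdge, Cell.leg]
        · rw [Function.update_of_ne hlj]
    simp only [h1]
  · intro l
    by_cases hli : l = i
    · subst hli; simp [Cell.lastEdge, Cell.isEdge]
    · rw [Function.update_of_ne hli]
      by_cases hlj : l = j
      · subst hlj; simp [Cell.lastEdge, Cell.isEdge]
      · rw [Function.update_of_ne hlj, hc l hli hlj]
  · rwa [hci']
  · intro l hl hli
    rw [Function.update_of_ne (hne' l hl), hc l hli (hne' l hl)]

omit [NeZero k] in
theorem sgn_ne_zero [Fact k.Prime] {M : ℕ} (c : Cells k m M) (i : Fin M) : sgn c i ≠ 0 := by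
  refine Finset.prod_ne_zero_iff.2 fun j _ => ?_
  split_ifs <;> simp

omit [NeZero k] in
theorem eq_firstEdge_of_firstAt_ne_zero {M : ℕ} {c : Cells k m M} {i : ℕ} (h : firstAt c i ≠ 0)
    (j : Fin M) (hj : j.val = i) : c j = Cell.firstEdge (c j).leg := by
  subst hj
  rw [firstAt, dif_pos j.2] at h
  exact by_contra fun hne => h (if_neg hne)

/-- The second half of the evaluated cochain. -/
def chiFun (p : Fin (2 * (b + 1 + (d + 1))) → ZMod k) :
    Cells k m (2 * (b + 1 + (d + 1))) → ZMod k :=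
  (op2 (bdOn Finset.univ) (carry (labT p)) ^ d).mulVec
    ((op1 (bdOn Finset.univ) fun x y => labT p x - labT p y).mulVec 1)

/-- The evaluated cochain. -/
def psiFun (p : Fin (2 * (b + 1 + (d + 1))) → ZMod k) :
    Cells k m (2 * (b + 1 + (d + 1))) → ZMod k :=
  (op1 (bdOn Finset.univ) fun x y => labX (b + 1) (d + 1) x - labX (b + 1) (d + 1) y).mulVec
    ((op2 (bdOn Finset.univ) (carry (labX (b + 1) (d + 1))) ^ b).mulVec (chiFun p))

theorem psiFun_eq (hc : ∀ i, c i ≠ none) :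
    psiFun p c = -(firstAt c 0 * ((legAt c 0 - legAt c 1) *
      ((∏ l ∈ Finset.range b, firstAt c (1 + 2 * l) * firstAt c (1 + 2 * l + 1)
        * crAt (legAt c) (1 + 2 * l)) * chiFun p (clr (2 * b + 1) c (2 * b + 1))))) := by
  have h0 : c = clr (2 * b + 1) c 0 := by
    funext j
    exact (if_neg (by simp)).symm
  have h1 : ∀ φ : Cells k m (2 * (b + 1 + (d + 1))) → ZMod k,
      (op1 (bdOn Finset.univ) fun x y => labX (b + 1) (d + 1) x - labX (b + 1) (d + 1) y).mulVec φ c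
      = -(firstAt c 0 * ((legAt c 0 - legAt c 1) * φ (clr (2 * b + 1) c 1))) := by
    intro φ
    have := (stage_labX hc (i := 0) (by omega)).op1_mulVec_eq φ
    rw [labX_clr hc (by omega), labX_clr hc (by omega)] at this
    rwa [← h0] at this
  rw [psiFun, h1, op2_pow_mulVec_eq (A := legAt c) b
    (fun j _ hj => stage_labX hc (by omega)) (fun j _ hj => labX_clr hc (by omega)), add_comm 1 (2 * b)]

theorem chiFun_eq (hc : ∀ i, c i ≠ none) (hL : (c ⟨2 * b + 1, by omega⟩).isLeaf)
    (hL0 : (c ⟨2 * b + 1, by omega⟩).leg = 0) :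
    chiFun p (clr (2 * b + 1) c (2 * b + 1)) =
      (∏ l ∈ Finset.range d, firstAt c (2 * b + 2 + 2 * l) * firstAt c (2 * b + 2 + 2 * l + 1)
        * crAt (legAt c) (2 * b + 2 + 2 * l)) * (-(firstAt c (2 * b + 2 + 2 * d) *
        (legAt c (2 * b + 2 + 2 * d) - legAt c (2 * b + 2 + 2 * d + 1)))) := by
  have h0 : clr (2 * b + 1) c (2 * b + 1) = clr (2 * b + 1) c (2 * b + 2) := by
    funext j
    simp only [clr]
    congr 1
    simp only [eq_iff_iff]
    omega
  rw [h0, chiFun, op2_pow_mulVec_eq (A := legAt c) d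
    (fun j h hj => stage_labT hc hL hL0 (by omega) (by omega))
    (fun j h hj => labT_clr hc hL hL0 (by omega) (by omega)),
    (stage_labT hc hL hL0 (by omega) (by omega)).op1_mulVec_eq,
    labT_clr hc hL hL0 (by omega) (by omega), labT_clr hc hL hL0 (by omega) (by omega), Pi.one_apply,
    mul_one]

end Evaluate

section Total

variable {k m b d : ℕ} {p : Fin (2 * (b + 1 + (d + 1))) → ZMod k}

theorem lead_singleton {M : ℕ} {A : Type*} [Zero A] (i : Fin M) (g : Fin M → A) :
    lead {i} g = g i := by
  refine lead_eq (by simp) fun j hj => ?_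
  rw [Finset.mem_singleton.1 hj]

theorem lf_eq_singleton {M : ℕ} {I : Finset (Fin M)} {c : Cells k m M} {i : Fin M} (hi : i ∈ I)
    (h : (c i).isLeaf) (hI : ∀ l ∈ I, l ≠ i → (c l).isEdge = true) : lf I c = {i} := by
  classical
  ext l
  simp only [lf, Finset.mem_filter, Finset.mem_singleton]
  constructor
  · rintro ⟨hl, hl'⟩
    by_contra hli
    have := hI l hl hli
    rw [Cell.isEdge_eq_false_of_isLeaf hl'] at this
    exact Bool.false_ne_true this
  · rintro rfl
    exact ⟨hi, h⟩

theorem labFund_eq {n₁ n₂ : ℕ} {p : Fin (2 * (n₁ + n₂)) → ZMod k} {c : Cells k m (2 * (n₁ + n₂))}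
    {i j : Fin (2 * (n₁ + n₂))}
    (hi : i ∈ blk₁ n₁ n₂) (hj : j ∈ blk₂ n₁ n₂) (hci : (c i).isLeaf) (hcj : (c j).isLeaf)
    (hc : ∀ l, l ≠ i → l ≠ j → (c l).isEdge = true) :
    labFund p c = ((c i).leg, (c j).leg - (c i).leg * p j) := by
  rw [labFund, lf_eq_singleton hi hci fun l hl hli => hc l hli fun h =>
      Finset.disjoint_left.1 disjoint_blk hl (h ▸ hj), lf_eq_singleton hj hcj fun l hl hlj =>
      hc l (fun h => Finset.disjoint_left.1 disjoint_blk hi (h ▸ hl)) hlj,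
    lead_singleton, lead_singleton]

/-- The cell with a leaf at the end of each block and edges at the center otherwise. -/
def cellOf (α : Fin (2 * (b + 1 + (d + 1))) → ZMod k) : Cells k m (2 * (b + 1 + (d + 1))) :=
  fun i => if i.val = 2 * b + 1 ∨ i.val = 2 * b + 3 + 2 * d then Cell.leafOf (α i)
    else Cell.firstEdge (α i)

variable (α : Fin (2 * (b + 1 + (d + 1))) → ZMod k)

theorem cellOf_leg (i : Fin (2 * (b + 1 + (d + 1)))) : (cellOf (m := m) α i).leg = α i := by
  unfold cellOf
  split_ifs <;> rfl

theorem legAt_cellOf : legAt (cellOf (m := m) α) = ext0 α := by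
  funext i
  simp only [legAt, ext0, cellOf_leg]

theorem cellOf_injective : Function.Injective (cellOf (k := k) (m := m) (b := b) (d := d)) := by
  intro α β h
  funext i
  rw [← cellOf_leg (m := m) α, h, cellOf_leg]

theorem cellOf_ne_none (i : Fin (2 * (b + 1 + (d + 1)))) : cellOf (m := m) α i ≠ none := by
  unfold cellOf
  split_ifs <;> simp [Cell.leafOf, Cell.firstEdge]

theorem firstAt_cellOf {i : ℕ} (h : i < 2 * b + 3 + 2 * d) (h' : i ≠ 2 * b + 1) :
    firstAt (cellOf (m := m) α) i = 1 := by
  rw [firstAt, dif_pos (by omega), if_pos]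
  rw [cellOf_leg, cellOf, if_neg (by simp; omega)]

theorem cellOf_isLeaf {i : Fin (2 * (b + 1 + (d + 1)))}
    (h : i.val = 2 * b + 1 ∨ i.val = 2 * b + 3 + 2 * d) : (cellOf (m := m) α i).isLeaf := by
  rw [cellOf, if_pos h]
  exact ⟨rfl, rfl⟩

theorem cellOf_isEdge {i : Fin (2 * (b + 1 + (d + 1)))}
    (h : ¬ (i.val = 2 * b + 1 ∨ i.val = 2 * b + 3 + 2 * d)) :
    (cellOf (m := m) α i).isEdge = true := by
  rw [cellOf, if_neg h]
  rfl

variable [Fact k.Prime]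

theorem sgn_cellOf (i : Fin (2 * (b + 1 + (d + 1)))) :
    sgn (cellOf (m := m) α) i = sgn (cellOf (m := m) 0) i := by
  refine sgn_congr fun j _ => ?_
  unfold cellOf
  split_ifs <;> rfl

theorem term_cellOf :
    (if labFund p (cellOf (m := m) α) = 0 then
      omega (b + 1) (d + 1) (cellOf (m := m) α) * psiFun p (cellOf (m := m) α) else 0)
    = (sgn (cellOf (k := k) (m := m) (b := b) (d := d) 0) ⟨2 * b + 3 + 2 * d, by omega⟩
        * sgn (cellOf (k := k) (m := m) (b := b) (d := d) 0) ⟨2 * b + 1, by omega⟩)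
      * (if ext0 α (2 * b + 2 + 2 * d + 1) = 0 then ∏ i ∈ Finset.range (2 * b + 2 + 2 * d + 1),
        transfer b d i (ext0 α i) (ext0 α (i + 1)) else 0) := by
  have hi : (⟨2 * b + 1, by omega⟩ : Fin (2 * (b + 1 + (d + 1)))) ∈ blk₁ (b + 1) (d + 1) :=
    mem_blk₁.2 (by simp; omega)
  have hj : (⟨2 * b + 3 + 2 * d, by omega⟩ : Fin (2 * (b + 1 + (d + 1)))) ∈ blk₂ (b + 1) (d + 1) :=
    mem_blk₂.2 (by simp; omega)
  have hci := cellOf_isLeaf (m := m) α (i := ⟨2 * b + 1, by omega⟩) (Or.inl rfl)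
  have hcj := cellOf_isLeaf (m := m) α (i := ⟨2 * b + 3 + 2 * d, by omega⟩) (Or.inr rfl)
  have hc : ∀ l : Fin (2 * (b + 1 + (d + 1))), l ≠ ⟨2 * b + 1, by omega⟩ →
      l ≠ ⟨2 * b + 3 + 2 * d, by omega⟩ → (cellOf (m := m) α l).isEdge = true := fun l h1 h2 =>
    cellOf_isEdge α fun h => h.elim (fun h => h1 (Fin.ext h)) fun h => h2 (Fin.ext h)
  have hA : ∀ l : Fin (2 * (b + 1 + (d + 1))), α l = ext0 α l := fun l => by
    rw [ext0, dif_pos l.2]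
  rw [labFund_eq hi hj hci hcj hc, omega_eq hi hj hci hcj hc, prod_transfer, sgn_cellOf, sgn_cellOf α]
  simp only [cellOf_leg]
  rw [hA, hA ⟨2 * b + 3 + 2 * d, by omega⟩]
  have hk : ∏ q : Fin (b + 1 + (d + 1)), kap (α (ev q)) (α (od q))
      = ∏ q ∈ Finset.range (b + 1 + (d + 1)), kap (ext0 α (2 * q)) (ext0 α (2 * q + 1)) := by
    rw [Finset.prod_range]
    exact Finset.prod_congr rfl fun q _ => by rw [hA, hA (od q)]; rfl
  rw [hk]
  have h3 : 2 * b + 3 + 2 * d = 2 * b + 2 + 2 * d + 1 := by ring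
  by_cases h1 : ext0 α (2 * b + 1) = 0
  · by_cases h2 : ext0 α (2 * b + 2 + 2 * d + 1) = 0
    · rw [if_pos (by simp [h1, h2, h3]), if_pos h2, if_pos h1, psiFun_eq (cellOf_ne_none α),
        chiFun_eq (cellOf_ne_none α) hci (by rw [cellOf_leg, hA]; exact h1),
        firstAt_cellOf α (by omega) (by omega), firstAt_cellOf α (by omega) (by omega), legAt_cellOf]
      have e1 : ∏ l ∈ Finset.range b, (firstAt (cellOf (m := m) α) (1 + 2 * l)
          * firstAt (cellOf (m := m) α) (1 + 2 * l + 1) * crAt (ext0 α) (1 + 2 * l))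
          = ∏ l ∈ Finset.range b, crAt (ext0 α) (1 + 2 * l) := by
        refine Finset.prod_congr rfl fun l hl => ?_
        have := Finset.mem_range.1 hl
        rw [firstAt_cellOf α (by omega) (by omega), firstAt_cellOf α (by omega) (by omega), one_mul,
          one_mul]
      have e2 : ∏ l ∈ Finset.range d, (firstAt (cellOf (m := m) α) (2 * b + 2 + 2 * l)
          * firstAt (cellOf (m := m) α) (2 * b + 2 + 2 * l + 1) * crAt (ext0 α) (2 * b + 2 + 2 * l))
          = ∏ l ∈ Finset.range d, crAt (ext0 α) (2 * b + 2 + 2 * l) := by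
        refine Finset.prod_congr rfl fun l hl => ?_
        have := Finset.mem_range.1 hl
        rw [firstAt_cellOf α (by omega) (by omega), firstAt_cellOf α (by omega) (by omega), one_mul,
          one_mul]
      rw [e1, e2]
      ring
    · rw [if_neg h2, if_neg, mul_zero]
      intro h
      rw [Prod.mk_eq_zero] at h
      refine h2 ?_
      have h4 := h.2
      rwa [h1, zero_mul, sub_zero, show (Fin.val (⟨2 * b + 3 + 2 * d, by omega⟩ :
        Fin (2 * (b + 1 + (d + 1))))) = 2 * b + 2 + 2 * d + 1 by simp; ring] at h4
  · rw [if_neg fun h => h1 (Prod.mk_eq_zero.1 h).1, if_neg h1]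
    simp

theorem exists_cellOf_of_term_ne_zero {c : Cells k m (2 * (b + 1 + (d + 1)))}
    (h1 : labFund p c = 0) (h2 : omega (b + 1) (d + 1) c ≠ 0) (h3 : psiFun p c ≠ 0) :
    ∃ α, cellOf α = c := by
  obtain ⟨i, hi, j, hj, hci, hcj, hc⟩ := shape_of_omega_ne_zero h2
  have hcn : ∀ l, c l ≠ none := by
    intro l
    by_cases hli : l = i
    · subst hli; exact Cell.ne_none_of_isLeaf hci
    · by_cases hlj : l = j
      · subst hlj; exact Cell.ne_none_of_isLeaf hcj
      · exact Cell.ne_none_of_isEdge (hc l hli hlj)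
  have hfirst : ∀ l : Fin (2 * (b + 1 + (d + 1))), (c l).isLeaf → firstAt c l.val = 0 := by
    intro l hl
    by_contra h
    have := eq_firstEdge_of_firstAt_ne_zero h l rfl
    rw [this] at hl
    exact absurd hl.2 (by simp)
  rw [psiFun_eq hcn] at h3
  have hF1 : ∀ l, l < 2 * b + 1 → firstAt c l ≠ 0 := by
    intro l hl h
    refine h3 ?_
    rcases Nat.eq_zero_or_pos l with rfl | hl0
    · rw [h]; ring
    · have : ∏ l ∈ Finset.range b, (firstAt c (1 + 2 * l) * firstAt c (1 + 2 * l + 1)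
        * crAt (legAt c) (1 + 2 * l)) = 0 := by
        refine Finset.prod_eq_zero (i := (l - 1) / 2) (Finset.mem_range.2 (by omega)) ?_
        rcases Nat.mod_two_eq_zero_or_one l with h' | h'
        · rw [show 1 + 2 * ((l - 1) / 2) + 1 = l by omega, h]; ring
        · rw [show 1 + 2 * ((l - 1) / 2) = l by omega, h]; ring
      rw [this]; ring
  have hi' : i.val = 2 * b + 1 := by
    have := mem_blk₁.1 hi
    by_contra h
    exact hF1 i.val (by omega) (hfirst i hci)
  have hii : i = ⟨2 * b + 1, by omega⟩ := Fin.ext hi'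
  rw [labFund_eq hi hj hci hcj hc, Prod.mk_eq_zero] at h1
  have hF2 : ∀ l, 2 * b + 2 ≤ l → l < 2 * b + 3 + 2 * d → firstAt c l ≠ 0 := by
    intro l hl hl' h
    refine h3 ?_
    rw [chiFun_eq hcn (hii ▸ hci) (hii ▸ h1.1)]
    by_cases hl0 : l = 2 * b + 2 + 2 * d
    · rw [← hl0, h]; ring
    · have : ∏ l ∈ Finset.range d, (firstAt c (2 * b + 2 + 2 * l)
        * firstAt c (2 * b + 2 + 2 * l + 1) * crAt (legAt c) (2 * b + 2 + 2 * l)) = 0 := by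
        refine Finset.prod_eq_zero (i := (l - (2 * b + 2)) / 2) (Finset.mem_range.2 (by omega)) ?_
        rcases Nat.mod_two_eq_zero_or_one l with h' | h'
        · rw [show 2 * b + 2 + 2 * ((l - (2 * b + 2)) / 2) = l by omega, h]; ring
        · rw [show 2 * b + 2 + 2 * ((l - (2 * b + 2)) / 2) + 1 = l by omega, h]; ring
      rw [this]; ring
  have hj' : j.val = 2 * b + 3 + 2 * d := by
    have := mem_blk₂.1 hj
    by_contra h
    exact hF2 j.val (by omega) (by omega) (hfirst j hcj)
  refine ⟨fun l => (c l).leg, ?_⟩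
  funext l
  rw [cellOf]
  split_ifs with h
  · rcases h with h | h
    · rw [show l = i from Fin.ext (h.trans hi'.symm)]
      exact (Cell.eq_leafOf_of_isLeaf hci).symm
    · rw [show l = j from Fin.ext (h.trans hj'.symm)]
      exact (Cell.eq_leafOf_of_isLeaf hcj).symm
  · refine (eq_firstEdge_of_firstAt_ne_zero ?_ l rfl).symm
    rcases Nat.lt_or_ge l.val (2 * b + 1) with h' | h'
    · exact hF1 _ h'
    · exact hF2 _ (by omega) (by omega)

theorem sum_term_ne_zero :
    ∑ c : Cells k m (2 * (b + 1 + (d + 1))), (if labFund p c = 0 then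
      omega (b + 1) (d + 1) c * psiFun p c else 0) ≠ 0 := by
  rw [← Finset.sum_of_injOn (s := Finset.univ) cellOf cellOf_injective.injOn
    (fun _ _ => Finset.mem_coe.2 (Finset.mem_univ _)) ?_ fun α _ => (term_cellOf α).symm,
    ← Finset.mul_sum, sum_chain _ _ _ (sum_transfer b d) (by ring)]
  · exact mul_ne_zero (mul_ne_zero (sgn_ne_zero _ _) (sgn_ne_zero _ _))
      (prod_transferSum_ne_zero b d _)
  · intro c _ hc
    split_ifs with h
    · by_contra h'
      obtain ⟨α, hα⟩ := exists_cellOf_of_term_ne_zero h (left_ne_zero_of_mul h')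
        (right_ne_zero_of_mul h')
      exact hc ⟨α, by simp, hα⟩
    · rfl

end Total

section Nonvanishing

instance {k m n₁ n₂ : ℕ} : DecidableEq (GoodCells k m n₁ n₂) := inferInstance

noncomputable instance {k m n₁ n₂ : ℕ} [NeZero k] : Fintype (GoodCells k m n₁ n₂) := inferInstance

variable {k m b d : ℕ} [Fact k.Prime] (p : Fin (2 * (b + 1 + (d + 1))) → ZMod k)

theorem op1_closed {α R : Type*} [CommRing R] {D : Matrix α α R} {P : α → Prop}
    (hP : ∀ x y, P x → D x y ≠ 0 → P y) (V : α → α → R) :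
    ∀ x y, P x → op1 D V x y ≠ 0 → P y := by
  intro x y hx h
  rw [op1, Matrix.of_apply] at h
  exact hP x y hx fun h0 => h (by simp [h0])

theorem op_mulVec_eq_psiFun :
    (op1 (bdGood k m (b + 1) (d + 1))
      fun x y => labX (b + 1) (d + 1) x.1 - labX (b + 1) (d + 1) y.1).mulVec
      ((op2 (bdGood k m (b + 1) (d + 1)) (carry fun x => labX (b + 1) (d + 1) x.1) ^ b).mulVec
        ((op2 (bdGood k m (b + 1) (d + 1)) (carry fun x => labT p x.1) ^ d).mulVec
          ((op1 (bdGood k m (b + 1) (d + 1)) fun x y => labT p x.1 - labT p y.1).mulVec 1)))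
      = fun x => psiFun p x.1 := by
  have hP : ∀ x y : Cells k m (2 * (b + 1 + (d + 1))), Good (b + 1) (d + 1) x →
      bdOn Finset.univ x y ≠ 0 → Good (b + 1) (d + 1) y := good_of_bdOn_ne_zero
  have h1 : ∀ (V : Cells k m (2 * (b + 1 + (d + 1))) → Cells k m (2 * (b + 1 + (d + 1))) → ZMod k)
      (φ : Cells k m (2 * (b + 1 + (d + 1))) → ZMod k),
      (op1 (bdGood k m (b + 1) (d + 1)) fun x y => V x.1 y.1).mulVec (fun x => φ x.1)
        = fun x => (op1 (bdOn Finset.univ) V).mulVec φ x.1 := fun V φ =>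
    submatrix_mulVec_of_closed (op1_closed hP V) φ
  have h2 : ∀ (ε : Cells k m (2 * (b + 1 + (d + 1))) → ZMod k) (n : ℕ)
      (φ : Cells k m (2 * (b + 1 + (d + 1))) → ZMod k),
      (op2 (bdGood k m (b + 1) (d + 1)) (carry fun x => ε x.1) ^ n).mulVec (fun x => φ x.1)
        = fun x => (op2 (bdOn Finset.univ) (carry ε) ^ n).mulVec φ x.1 := fun ε n φ => by
    have := op2_submatrix_of_closed hP (carry ε)
    change op2 (bdGood k m (b + 1) (d + 1)) (carry fun x => ε x.1) = _ at this
    rw [this]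
    exact submatrix_pow_mulVec_of_closed (op2_closed hP (carry ε)) n φ
  have h3 := h1 (fun x y => labT p x - labT p y) 1
  change (op1 (bdGood k m (b + 1) (d + 1)) fun x y => labT p x.1 - labT p y.1).mulVec 1 = _ at h3
  rw [h3, h2, h2, h1 fun x y => labX (b + 1) (d + 1) x - labX (b + 1) (d + 1) y]
  rfl

theorem mulVec_inv {G Q R : Type*} [Fintype Q] [CommRing R] {act : G → Equiv.Perm Q}
    {N : Matrix Q Q R} (h : Inv act N) {φ : Q → R} (hφ : ∀ g x, φ (act g x) = φ x) (g : G) (x : Q) :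
    N.mulVec φ (act g x) = N.mulVec φ x := by
  simp only [Matrix.mulVec, dotProduct]
  rw [← Equiv.sum_comp (act g)]
  exact Finset.sum_congr rfl fun y _ => by rw [h, hφ]

/-- The product of powers of the two classes is not null-homotopic. -/
theorem not_exists_homotopy
    (hp : ∀ q : Fin (b + 1 + (d + 1)), b + 1 ≤ q.val → p (ev q) = p (od q)) :
    ¬ ∃ K, Inv (act (m := m) p) K ∧
      op2 (bdGood k m (b + 1) (d + 1)) (carry fun x => labX (b + 1) (d + 1) x.1) ^ b
        * op2 (bdGood k m (b + 1) (d + 1)) (carry fun x => labT p x.1) ^ d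
      = bdGood k m (b + 1) (d + 1) * K + K * bdGood k m (b + 1) (d + 1) := by
  rintro ⟨K, hK, hXT⟩
  set D := bdGood k m (b + 1) (d + 1) with hD
  set Ux := op1 D fun x y => labX (b + 1) (d + 1) x.1 - labX (b + 1) (d + 1) y.1 with hUx
  set Ut := op1 D fun x y => labT p x.1 - labT p y.1 with hUt
  have hDD : D * D = 0 := bdGood_mul_self
  have ax : D * Ux = -(Ux * D) := op1_anticomm hDD fun x y z => by ring
  have at' : D * Ut = -(Ut * D) := op1_anticomm hDD fun x y z => by ring
  have hUxi : Inv (act (m := m) p) Ux := (bdGood_inv p).op1 fun g x y => by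
    change labX _ _ (shiftCells (angle _ p g) x.1) - labX _ _ (shiftCells (angle _ p g) y.1) = _
    rw [labX_shift p x.2, labX_shift p y.2]
    ring
  have hUti : Inv (act (m := m) p) Ut := (bdGood_inv p).op1 fun g x y => by
    change labT p (shiftCells (angle _ p g) x.1) - labT p (shiftCells (angle _ p g) y.1) = _
    rw [labT_shift p x.2, labT_shift p y.2]
    ring
  have h0 : Ux * (D * K + K * D) * Ut = D * (-(Ux * K * Ut)) + (-(Ux * K * Ut)) * D := by
    have e1 : Ux * D = -(D * Ux) := by rw [ax, neg_neg]
    rw [mul_add, add_mul, ← mul_assoc Ux D K, e1, mul_assoc Ux (K * D) Ut, mul_assoc K D Ut, at']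
    noncomm_ring
  have h1 : D.mulVec (-((Ux * K * Ut).mulVec 1)) = fun x => psiFun p x.1 := by
    rw [← op_mulVec_eq_psiFun p, ← hD, ← hUx, ← hUt, Matrix.mulVec_mulVec, Matrix.mulVec_mulVec,
      Matrix.mulVec_mulVec, mul_assoc Ux (_ ^ b), hXT, h0, Matrix.add_mulVec, ← Matrix.mulVec_mulVec 1 _ D,
      bdGood_mulVec_one, Matrix.mulVec_zero, add_zero, ← Matrix.mulVec_mulVec 1 D, Matrix.neg_mulVec]
  have h2 := sum_fundamental_domain_mulVec_eq_zero (act (m := m) p) (fun c => labFund p c.1)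
    (fun g c => labFund_act p g c) D (bdGood_inv p) (fun c => omega (b + 1) (d + 1) c.1)
    (-((Ux * K * Ut).mulVec 1))
    (fun g c => ?_) (fun g c => ?_) omega_vecMul_bdGood
  · rw [h1] at h2
    refine sum_term_ne_zero (p := p) (k := k) (m := m) (b := b) (d := d) ?_
    refine Eq.trans (Eq.symm ?_) h2
    exact sum_subtype_of_support (P := Good (b + 1) (d + 1))
      (fun c => if labFund p c = 0 then omega (b + 1) (d + 1) c * psiFun p c else 0) fun c hc => by
      have h0 : omega (b + 1) (d + 1) c = 0 := by_contra fun h => hc (good_of_omega_ne_zero h)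
      rw [h0, zero_mul, ite_self]
  · refine omega_shiftCells (fun q => ?_) c.1
    unfold angle
    rcases lt_or_ge q.val (b + 1) with h | h
    · rw [if_pos (by simp [ev]; omega), if_pos (by simp [od]; omega)]
    · rw [if_neg (by simp [ev]; omega), if_neg (by simp [od]; omega), hp q h]
  · rw [Pi.neg_apply, Pi.neg_apply, mulVec_inv ((hUxi.mul hK).mul hUti) (φ := 1) fun _ _ => rfl]

end Nonvanishing

section Vertices

variable {k m M : ℕ}

/-- The vertex `v` of the product complex lies in the cell `c`. -/
def IsVert (c v : Cells k m M) : Prop :=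
  ∀ i, if (c i).isEdge then v i = (c i).head ∨ v i = (c i).tail else v i = c i

theorem Face.isVert {c c' v : Cells k m M} {i : Fin M} (h : Face c c' i) (hv : IsVert c' v) :
    IsVert c v := by
  intro j
  have hj := hv j
  by_cases hji : j = i
  · subst hji
    obtain ⟨he, rfl | rfl⟩ := h
    · rw [Function.update_self, Cell.head_isEdge] at hj
      rw [if_pos he]
      exact Or.inl hj
    · rw [Function.update_self, Cell.tail_isEdge] at hj
      rw [if_pos he]
      exact Or.inr hj
  · rwa [h.eq_of_ne hji] at hj

theorem IsVert.shift {c v : Cells k m M} (hv : IsVert c v) (s : Fin M → ZMod k) :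
    IsVert (shiftCells s c) (shiftCells s v) := by
  intro i
  have hi := hv i
  simp only [shiftCells, Cell.isEdge_shift, Cell.head_shift, Cell.tail_shift]
  split_ifs at hi ⊢ with he
  · exact hi.imp (congrArg _) (congrArg _)
  · rw [hi]

theorem isVert_shift_iff {c v : Cells k m M} (s : Fin M → ZMod k) :
    IsVert (shiftCells s c) v ↔ ∃ u, IsVert c u ∧ v = shiftCells s u := by
  constructor
  · intro h
    refine ⟨shiftCells (-s) v, ?_, ?_⟩
    · simpa only [shiftCells_neg] using h.shift (-s)
    · simpa using (shiftCells_neg (-s) v).symm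
  · rintro ⟨u, hu, rfl⟩
    exact hu.shift s

theorem exists_isVert (c : Cells k m M) : ∃ v, IsVert c v := by
  refine ⟨fun i => if (c i).isEdge then (c i).head else c i, fun i => ?_⟩
  dsimp only
  split_ifs with h
  · exact Or.inl rfl
  · rfl

theorem IsVert.eq_of_isLeaf {c v : Cells k m M} (hv : IsVert c v) {i : Fin M}
    (hi : (c i).isLeaf) : v i = c i := by
  have := hv i
  rwa [Cell.isEdge_eq_false_of_isLeaf hi] at this

theorem IsVert.good {n₁ n₂ : ℕ} {c v : Cells k m (2 * (n₁ + n₂))} (hv : IsVert c v)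
    (hc : Good n₁ n₂ c) : Good n₁ n₂ v := by
  classical
  have key : ∀ I, lf I c ⊆ lf I v := fun I =>
    Finset.monotone_filter_right _ fun i _ hi => by rwa [hv.eq_of_isLeaf hi]
  exact ⟨hc.1.mono (key _), hc.2.mono (key _)⟩

end Vertices

section RowMean

variable {k N : ℕ} [NeZero k]

/-- The mean of the first nonempty row. -/
def rowMean (G : Fin N → Finset (ZMod k)) : ZMod k :=
  lead (Finset.univ.filter fun s => (G s).Nonempty) fun s => (∑ i ∈ G s, i) * ((G s).card : ZMod k)⁻¹

theorem rowMean_image [Fact k.Prime] {G G' : Fin N → Finset (ZMod k)} (hG : ∃ s, (G s).Nonempty)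
    (hG' : ∀ s, G s ≠ Finset.univ) (t : ZMod k)
    (h : ∀ s, G' s = (G s).image fun i => t + i) : rowMean G' = t + rowMean G := by
  have hne : (Finset.univ.filter fun s => (G s).Nonempty).Nonempty := by
    obtain ⟨s, hs⟩ := hG
    exact ⟨s, by simpa using hs⟩
  have hS : (Finset.univ.filter fun s => (G' s).Nonempty)
      = Finset.univ.filter fun s => (G s).Nonempty := by
    refine Finset.filter_congr fun s _ => ?_
    rw [h, Finset.image_nonempty]
  unfold rowMean
  rw [hS, ← lead_map hne fun x => t + x]
  refine lead_congr fun s hs => ?_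
  have hs' := (Finset.mem_filter.1 hs).2
  have hcard : ((G s).card : ZMod k) ≠ 0 := by
    rw [Ne, ZMod.natCast_eq_zero_iff]
    refine Nat.not_dvd_of_pos_of_lt hs'.card_pos ?_
    have := Finset.card_lt_univ_of_notMem (s := G s)
      (Classical.choose_spec (not_forall.1 fun h' => hG' s (Finset.eq_univ_iff_forall.2 h')))
    rwa [ZMod.card] at this
  have hinj : Function.Injective fun i : ZMod k => t + i := add_right_injective t
  rw [h, Finset.card_image_of_injective _ hinj, Finset.sum_image fun x _ y _ h => hinj h,
    Finset.sum_add_distrib, Finset.sum_const, nsmul_eq_mul]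
  field_simp

end RowMean

section Combination

variable {k m ℓ a b d e N : ℕ} [Fact k.Prime]

/-- The type of a direction of the second block. -/
def typ (n₁ e : ℕ) (i : ℕ) : ℕ := (i - 2 * n₁) / (2 * e) + 1

/-- The slopes of the action on the second block. -/
def slope (n₁ n₂ e : ℕ) (i : Fin (2 * (n₁ + n₂))) : ZMod k := ((typ n₁ e i.val : ℕ) : ZMod k)⁻¹

omit [Fact k.Prime] in
theorem typ_lt {n₁ n₂ : ℕ} (hn : n₂ = (k - 1) * e) {i : Fin (2 * (n₁ + n₂))}
    (hi : 2 * n₁ ≤ i.val) : typ n₁ e i.val < k := by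
  have h : (i.val - 2 * n₁) < (2 * e) * (k - 1) := by
    have := i.2
    have e1 : (2 * e) * (k - 1) = 2 * ((k - 1) * e) := by ring
    omega
  have := Nat.div_lt_of_lt_mul h
  exact Nat.add_lt_of_lt_sub this

theorem typ_ne_zero {n₁ n₂ : ℕ} (hn : n₂ = (k - 1) * e) {i : Fin (2 * (n₁ + n₂))}
    (hi : 2 * n₁ ≤ i.val) : ((typ n₁ e i.val : ℕ) : ZMod k) ≠ 0 := by
  rw [Ne, ZMod.natCast_eq_zero_iff]
  exact Nat.not_dvd_of_pos_of_lt (Nat.succ_pos _) (typ_lt hn hi)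

theorem card_blkType_le {n₁ n₂ : ℕ} (he : 0 < e) (hn : n₂ = (k - 1) * e) (j : ZMod k) :
    (blkType (n₁ := n₁) (slope (k := k) n₁ n₂ e) j).card ≤ 2 * e := by
  rw [← Finset.card_range (2 * e)]
  refine Finset.card_le_card_of_injOn (fun i => (i.val - 2 * n₁) % (2 * e))
    (fun i _ => Finset.mem_coe.2 (Finset.mem_range.2 (Nat.mod_lt _ (by omega)))) ?_
  intro i hi i' hi' h
  have key : ∀ i ∈ blkType (n₁ := n₁) (slope (k := k) n₁ n₂ e) j,
      2 * n₁ ≤ i.val ∧ ((typ n₁ e i.val : ℕ) : ZMod k) = j := by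
    intro i hi
    obtain ⟨h1, h2⟩ := Finset.mem_filter.1 hi
    have h1 := mem_blk₂.1 h1
    exact ⟨h1, ((mul_inv_eq_one₀ (typ_ne_zero hn h1)).1 h2).symm⟩
  obtain ⟨h1, h2⟩ := key i hi
  obtain ⟨h1', h2'⟩ := key i' hi'
  have h3 : typ n₁ e i.val = typ n₁ e i'.val := by
    have := congrArg ZMod.val (h2.trans h2'.symm)
    rwa [ZMod.val_natCast_of_lt (typ_lt hn h1), ZMod.val_natCast_of_lt (typ_lt hn h1')] at this
  have h4 : (i.val - 2 * n₁) / (2 * e) = (i'.val - 2 * n₁) / (2 * e) := by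
    unfold typ at h3
    omega
  have h5 : i.val - 2 * n₁ = i'.val - 2 * n₁ := by
    rw [← Nat.div_add_mod (i.val - 2 * n₁) (2 * e), h4, show _ % _ = _ % _ from h, Nat.div_add_mod]
  exact Fin.ext (by omega)

theorem slope_ev_eq_slope_od {n₁ n₂ : ℕ} (q : Fin (n₁ + n₂)) (hq : n₁ ≤ q.val) :
    slope (k := k) n₁ n₂ e (ev q) = slope n₁ n₂ e (od q) := by
  have : typ n₁ e (2 * q.val) = typ n₁ e (2 * q.val + 1) := by
    unfold typ
    rw [← Nat.div_div_eq_div_mul, ← Nat.div_div_eq_div_mul]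
    congr 2
    omega
  simp only [slope, ev, od, this]

set_option maxHeartbeats 400000 in
open Classical in
/-- An equivariant monotone family of nonempty sets on a product of stars has a full row. -/
theorem exists_full_row (hk2 : 3 ≤ k) (ha : 2 ≤ a) (haq : a ≤ k ^ ℓ) (hb : b = (k - 1) * (a - 1))
    (he : e = k ^ ℓ - a + 1) (hd : d + 1 = (k - 1) * e) (hN : N = 2 * k ^ ℓ - 1)
    (F : Cells k m (2 * (b + 1 + (d + 1))) → ZMod k → Fin N → Prop)
    (hF : ∀ c, Good (b + 1) (d + 1) c → ∃ i s, F c i s)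
    (hshift : ∀ g c i s, Good (b + 1) (d + 1) c →
      (F (shiftCells (angle (b + 1) (slope (b + 1) (d + 1) e) g) c) (g.2 + i) s ↔ F c i s)) :
    ∃ c, Good (b + 1) (d + 1) c ∧ ∃ s, ∀ i, ∃ v, IsVert c v ∧ F v i s := by
  by_contra! hfull
  set p : Fin (2 * (b + 1 + (d + 1))) → ZMod k := slope (b + 1) (d + 1) e with hp
  have hk0 : ((k : ℕ) : ZMod k) = 0 := ZMod.natCast_self k
  set G : Cells k m (2 * (b + 1 + (d + 1))) → Fin N → Finset (ZMod k) :=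
    fun c s => Finset.univ.filter fun i => ∃ v, IsVert c v ∧ F v i s with hG
  have hGmono : ∀ {x y i}, Face x y i → ∀ s, G y s ⊆ G x s := fun h s =>
    Finset.monotone_filter_right _ fun i _ ⟨v, hv, hi⟩ => ⟨v, h.isVert hv, hi⟩
  have hGne : ∀ c, Good (b + 1) (d + 1) c → ∃ s, (G c s).Nonempty := by
    intro c hc
    obtain ⟨v, hv⟩ := exists_isVert c
    obtain ⟨i, s, h⟩ := hF v (hv.good hc)
    exact ⟨s, i, by simpa [hG] using ⟨v, hv, h⟩⟩
  have hGu : ∀ c, Good (b + 1) (d + 1) c → ∀ s, G c s ≠ Finset.univ := by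
    intro c hc s h
    obtain ⟨i, hi⟩ := hfull c hc s
    obtain ⟨v, hv, hF⟩ := (Finset.mem_filter.1 (h ▸ Finset.mem_univ i : i ∈ G c s)).2
    exact hi v hv hF
  have hGs : ∀ g c, Good (b + 1) (d + 1) c → ∀ s,
      G (shiftCells (angle (b + 1) p g) c) s = (G c s).image fun i => g.2 + i := by
    intro g c hc s
    ext i
    simp only [hG, Finset.mem_filter, Finset.mem_univ, true_and, Finset.mem_image,
      isVert_shift_iff]
    constructor
    · rintro ⟨_, ⟨u, hu, rfl⟩, hi⟩
      refine ⟨i - g.2, ⟨u, hu, ?_⟩, by ring⟩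
      rw [← hshift g u _ s (hu.good hc), add_sub_cancel]
      exact hi
    · rintro ⟨i, ⟨u, hu, hi⟩, rfl⟩
      exact ⟨_, ⟨u, hu, rfl⟩, (hshift g u i s (hu.good hc)).2 hi⟩
  set r : Cells k m (2 * (b + 1 + (d + 1))) → ℕ := fun c => ∑ s, (G c s).card with hr
  have hrle : ∀ c, Good (b + 1) (d + 1) c → r c ≤ 2 * ((k - 1) * k ^ ℓ - 1) := by
    intro c hc
    have h1 : r c ≤ ∑ _s : Fin N, (k - 1) := by
      refine Finset.sum_le_sum fun s _ => ?_
      have := Finset.card_lt_univ_of_notMem (s := G c s)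
        (Classical.choose_spec (not_forall.1 fun h' =>
          hGu c hc s (Finset.eq_univ_iff_forall.2 h')))
      rw [ZMod.card] at this
      omega
    rw [Finset.sum_const, Finset.card_univ, Fintype.card_fin, smul_eq_mul, hN] at h1
    refine h1.trans ?_
    rw [Nat.sub_mul, show 2 * k ^ ℓ * (k - 1) = 2 * ((k - 1) * k ^ ℓ) by ring]
    omega
  have hrmono : ∀ {x y i}, Face x y i → r y ≤ r x := fun h =>
    Finset.sum_le_sum fun s _ => Finset.card_le_card (hGmono h s)
  have hrlt : ∀ {x y i}, Face x y i → rowMean (G x) ≠ rowMean (G y) → r y < r x := by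
    intro x y i h hne
    refine lt_of_le_of_ne (hrmono h) fun heq => hne ?_
    have := (Finset.sum_eq_sum_iff_of_le fun s _ => Finset.card_le_card (hGmono h s)).1 heq
    congr 1
    funext s
    exact (Finset.eq_of_subset_of_card_le (hGmono h s) (this s (Finset.mem_univ s)).ge).symm
  have hrpos : ∀ c, Good (b + 1) (d + 1) c → r c ≠ 0 := by
    intro c hc h
    obtain ⟨s, hs⟩ := hGne c hc
    exact hs.card_pos.ne' (Finset.sum_eq_zero_iff.1 h s (Finset.mem_univ s))
  set D := bdGood k m (b + 1) (d + 1) with hD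
  have hDD : D * D = 0 := bdGood_mul_self
  have hDi : Inv (act (m := m) p) D := bdGood_inv p
  have hsX : ∀ (g : ZMod k × ZMod k) (x : GoodCells k m (b + 1) (d + 1)),
      labX (b + 1) (d + 1) (act p g x).1 = g.1 + labX (b + 1) (d + 1) x.1 :=
    fun g x => labX_shift p x.2 g
  have hsT : ∀ (g : ZMod k × ZMod k) (x : GoodCells k m (b + 1) (d + 1)),
      labT p (act p g x).1 = g.2 + labT p x.1 := fun g x => labT_shift p x.2 g
  have hsY : ∀ (j : ZMod k) (g : ZMod k × ZMod k) (x : GoodCells k m (b + 1) (d + 1)),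
      labY p j (act p g x).1 = (g.1 + j * g.2) + labY p j x.1 := fun j g x => labY_shift p j x.2 g
  have hsF : ∀ (g : ZMod k × ZMod k) (x : GoodCells k m (b + 1) (d + 1)),
      rowMean (G (act p g x).1) = g.2 + rowMean (G x.1) := fun g x =>
    rowMean_image (hGne x.1 x.2) (hGu x.1 x.2) g.2 (hGs g x.1 x.2)
  refine not_exists_homotopy (m := m) p (fun q hq => slope_ev_eq_slope_od q hq) ?_
  have main := exists_homotopy_pow_mul_pow (k := k) (ℓ := ℓ) (a := a) hk2 hk0 ha haq hDD hDi
    (X := op2 D (carry fun x => labX (b + 1) (d + 1) x.1))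
    (T := op2 D (carry fun x => labT p x.1))
    (F := op2 D (carry fun x => rowMean (G x.1)))
    (Y := fun j => op2 D (carry fun x => labY p j x.1))
    (carryOp_mem hDD hDi hsX) (carryOp_mem hDD hDi hsT) (carryOp_comm hDD hDi hsX hsT)
    ?_ (fun j _ => ?_) ?_ ?_ ?_
  · rwa [← hb, ← he, ← hd, Nat.add_sub_cancel] at main
  · rw [← hb]
    refine carryOp_pow_eq_zero (r := fun x => (nz (blk₁ (b + 1) (d + 1)) x.1).card) ?_ ?_ _ ?_ ?_
    · intro x y h
      obtain ⟨i, hi⟩ := exists_face_of_bdGood_ne_zero h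
      exact card_nz_mono hi _
    · intro x y h hl
      obtain ⟨i, hi⟩ := exists_face_of_bdGood_ne_zero h
      exact labX_rank hi hl
    · intro x
      refine (Finset.card_filter_le _ _).trans ?_
      rw [← Finset.card_range (2 * (b + 1))]
      exact Finset.card_le_card_of_injOn (fun i => i.val)
        (fun i hi => Finset.mem_coe.2 (Finset.mem_range.2 (mem_blk₁.1 hi))) fun i _ j _ => Fin.ext
    · intro x
      exact Finset.card_ne_zero.2 x.2.nz₁
  · have := carryOp_relation hDD hDi 1 j.val (hsY j) hsX hsT
      (ε := fun x => labY p j x.1) (ε₁ := fun x => labX (b + 1) (d + 1) x.1)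
      (ε₂ := fun x => labT p x.1) (w := fun x => labY p j x.1 - labX (b + 1) (d + 1) x.1 - j * labT p x.1)
      (fun g x => by rw [hsX, hsT, hsY]; ring)
      (fun x => by rw [ZMod.natCast_zmod_val, Nat.cast_one]; ring)
    simpa only [one_smul] using this
  · have := list_prod_carryOp_pow_eq_zero (D := D) (r := fun j x => (nz (blkType p j) x.1).card)
      (ε := fun j x => labY p j x.1) ?_ ?_ (k ^ ℓ - a + 1) ?_
      ((Finset.univ : Finset (ZMod k)).erase 0).toList ?_
    · exact this
    · intro j x y h
      obtain ⟨i, hi⟩ := exists_face_of_bdGood_ne_zero h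
      exact card_nz_mono hi _
    · intro j x y h hl
      obtain ⟨i, hi⟩ := exists_face_of_bdGood_ne_zero h
      exact labY_rank p hi hl
    · intro j x
      rw [← he]
      exact (Finset.card_filter_le _ _).trans (card_blkType_le (by omega) hd j)
    · intro x
      obtain ⟨i, hi⟩ := x.2.nz₂
      obtain ⟨h1, h2⟩ := Finset.mem_filter.1 hi
      have h3 := typ_ne_zero hd (mem_blk₂.1 h1)
      refine ⟨((typ (b + 1) e i.val : ℕ) : ZMod k), by simpa using h3, ?_⟩
      refine Finset.card_ne_zero.2 ⟨i, Finset.mem_filter.2 ⟨Finset.mem_filter.2 ⟨h1, ?_⟩, h2⟩⟩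
      exact mul_inv_cancel₀ h3
  · have := carryOp_relation hDD hDi 0 1 hsF hsX hsT
      (ε := fun x => rowMean (G x.1)) (ε₁ := fun x => labX (b + 1) (d + 1) x.1)
      (ε₂ := fun x => labT p x.1) (w := fun x => rowMean (G x.1) - labT p x.1)
      (fun g x => by rw [hsF, hsT]; ring)
      (fun x => by push_cast; ring)
    simpa only [one_smul, zero_smul, zero_add] using this
  · refine carryOp_pow_eq_zero (r := fun x => r x.1) ?_ ?_ _ ?_ ?_
    · intro x y h
      obtain ⟨i, hi⟩ := exists_face_of_bdGood_ne_zero h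
      exact hrmono hi
    · intro x y h hl
      obtain ⟨i, hi⟩ := exists_face_of_bdGood_ne_zero h
      exact hrlt hi hl
    · exact fun x => hrle x.1 x.2
    · exact fun x => hrpos x.1 x.2

end Combination

section Star

variable {k m : ℕ} [NeZero k]

/-- The star with legs towards the `k`-th roots of unity. -/
def star (k : ℕ) [NeZero k] : Set ℂ :=
  {x | ∃ t : ZMod k, ∃ r ∈ Set.Icc (0 : ℝ) 1, x = (r : ℂ) * ZMod.stdAddChar t}

theorem isCompact_star : IsCompact (star k) := by
  have : star k = ⋃ t : ZMod k,
      (fun r : ℝ => (r : ℂ) * ZMod.stdAddChar t) '' Set.Icc (0 : ℝ) 1 := by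
    ext x
    simp only [star, Set.mem_ofPred_eq, Set.mem_iUnion, Set.mem_image, eq_comm]
  rw [this]
  exact isCompact_iUnion fun t => isCompact_Icc.image (by fun_prop)

theorem mul_mem_star (t : ZMod k) {x : ℂ} (hx : x ∈ star k) : ZMod.stdAddChar t * x ∈ star k := by
  obtain ⟨s, r, hr, rfl⟩ := hx
  exact ⟨t + s, r, hr, by rw [AddChar.map_add_eq_mul]; ring⟩

theorem add_ne_zero_of_mem_star (hk : Odd k) {x y : ℂ} (hx : x ∈ star k) (hy : y ∈ star k)
    (hx1 : ‖x‖ = 1) : x + y ≠ 0 := by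
  have key : ∀ z ∈ star k, ‖z‖ = 1 → z ^ k = 1 := by
    rintro z ⟨t, r, hr, rfl⟩ h
    rw [norm_mul, AddChar.norm_apply, mul_one, Complex.norm_real, Real.norm_of_nonneg hr.1] at h
    rw [h, Complex.ofReal_one, one_mul, ← AddChar.map_nsmul_eq_pow, nsmul_eq_mul,
      ZMod.natCast_self, zero_mul, AddChar.map_zero_eq_one]
  intro h
  have hy' : y = -x := by linear_combination h
  have h1 := key y hy (by rw [hy', norm_neg, hx1])
  rw [hy', hk.neg_pow, key x hx hx1] at h1
  norm_num at h1

/-- The point of the star represented by a vertex, with the legs turned by a weight. -/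
noncomputable def cellPt (w : ZMod k) : Cell k m → ℂ
  | none => 0
  | some (a, r, _) => (((r.val + 1 : ℝ) / (m + 1) : ℝ) : ℂ) * ZMod.stdAddChar (w * a)

theorem cellPt_mem_star (w : ZMod k) (c : Cell k m) : cellPt w c ∈ star k := by
  rcases c with _ | ⟨a, r, e⟩
  · exact ⟨0, 0, by simp, by simp [cellPt]⟩
  · refine ⟨w * a, _, ⟨by positivity, ?_⟩, rfl⟩
    rw [div_le_one (by positivity)]
    have : (r.val : ℝ) ≤ m := by exact_mod_cast Nat.lt_succ_iff.1 r.2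
    linarith

theorem cellPt_shift (w s : ZMod k) (c : Cell k m) :
    cellPt w (c.shift s) = ZMod.stdAddChar (w * s) * cellPt w c := by
  rcases c with _ | ⟨a, r, e⟩
  · simp [cellPt, Cell.shift]
  · change _ * ZMod.stdAddChar (w * (s + a)) = _ * (_ * _)
    rw [mul_add, AddChar.map_add_eq_mul]
    ring

theorem norm_cellPt_of_isLeaf (w : ZMod k) {c : Cell k m} (hc : c.isLeaf) : ‖cellPt w c‖ = 1 := by
  rcases c with _ | ⟨a, r, e⟩
  · exact hc.elim
  · obtain ⟨rfl, rfl⟩ := hc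
    rw [cellPt, norm_mul, AddChar.norm_apply, mul_one, Fin.val_last, div_self (by positivity)]
    simp

theorem norm_cellPt_head_sub_tail (w : ZMod k) (c : Cell k m) :
    ‖cellPt w c.head - cellPt w c.tail‖ ≤ 1 / (m + 1) := by
  rcases c with _ | ⟨a, r, e⟩
  · simp only [Cell.head, Cell.tail, sub_self, norm_zero]
    positivity
  · have : ∃ x : ℝ, x = 1 / (m + 1) ∧ cellPt w (Cell.head (some (a, r, e)))
        - cellPt w (Cell.tail (some (a, r, e))) = (x : ℂ) * ZMod.stdAddChar (w * a) := by
      refine ⟨_, rfl, ?_⟩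
      induction r using Fin.cases with
      | zero => simp [Cell.head, Cell.tail, cellPt]
      | succ r =>
        simp only [Cell.head, Cell.tail, cellPt, Fin.cases_succ, Fin.val_succ, Fin.val_castSucc]
        push_cast
        ring
    obtain ⟨x, hx, h⟩ := this
    rw [h, norm_mul, AddChar.norm_apply, mul_one, Complex.norm_real, hx, Real.norm_of_nonneg]
    positivity

end Star

section Configuration

variable {k m n₁ n₂ : ℕ} [NeZero k]

/-- The points of the product of stars having a leaf coordinate in each block. -/
def conf (k n₁ n₂ : ℕ) [NeZero k] : Set (Fin (2 * (n₁ + n₂)) → ℂ) :=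
  {x | (∀ i, x i ∈ star k) ∧ (∃ i, i.val < 2 * n₁ ∧ ‖x i‖ = 1) ∧ ∃ i, 2 * n₁ ≤ i.val ∧ ‖x i‖ = 1}

theorem isCompact_conf : IsCompact (conf k n₁ n₂) := by
  have h1 : IsCompact (Set.univ.pi fun _ : Fin (2 * (n₁ + n₂)) => star k) :=
    isCompact_univ_pi fun _ => isCompact_star
  have h2 : ∀ P : Fin (2 * (n₁ + n₂)) → Prop,
      IsClosed {x : Fin (2 * (n₁ + n₂)) → ℂ | ∃ i, P i ∧ ‖x i‖ = 1} := by
    intro P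
    rw [Set.ofPred_exists]
    refine isClosed_iUnion_of_finite fun i => isClosed_const.and ?_
    exact isClosed_eq (by fun_prop) continuous_const
  have : conf k n₁ n₂ = (Set.univ.pi fun _ => star k) ∩
      ({x | ∃ i, i.val < 2 * n₁ ∧ ‖x i‖ = 1} ∩ {x | ∃ i, 2 * n₁ ≤ i.val ∧ ‖x i‖ = 1}) := by
    ext x
    simp [conf]
  rw [this]
  exact h1.inter_right ((h2 _).inter (h2 _))

/-- The rotation angles of the coordinates under an element of the symmetry group. -/
def wangle (n₁ e : ℕ) (g : ZMod k × ZMod k) (i : ℕ) : ZMod k :=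
  if i < 2 * n₁ then g.1 else g.1 + (typ n₁ e i : ℕ) * g.2

/-- The action of the symmetry group on configurations. -/
noncomputable def rot (n₁ e : ℕ) (g : ZMod k × ZMod k) {M : ℕ} (x : Fin M → ℂ) (i : Fin M) : ℂ :=
  ZMod.stdAddChar (wangle n₁ e g i) * x i

theorem rot_mem_conf (e : ℕ) (g : ZMod k × ZMod k) {x : Fin (2 * (n₁ + n₂)) → ℂ}
    (hx : x ∈ conf k n₁ n₂) : rot n₁ e g x ∈ conf k n₁ n₂ := by
  obtain ⟨h1, ⟨i, hi, hi1⟩, j, hj, hj1⟩ := hx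
  refine ⟨fun i => mul_mem_star _ (h1 i), ⟨i, hi, ?_⟩, j, hj, ?_⟩
  · rw [rot, norm_mul, AddChar.norm_apply, one_mul, hi1]
  · rw [rot, norm_mul, AddChar.norm_apply, one_mul, hj1]

/-- The configuration represented by a vertex of the product complex. -/
noncomputable def cellsPt (n₁ e : ℕ) {M : ℕ} (c : Cells k m M) (i : Fin M) : ℂ :=
  cellPt (if i.val < 2 * n₁ then 1 else (typ n₁ e i : ℕ)) (c i)

theorem cellsPt_mem_conf (e : ℕ) {c : Cells k m (2 * (n₁ + n₂))} (hc : Good n₁ n₂ c) :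
    cellsPt n₁ e c ∈ conf k n₁ n₂ := by
  classical
  obtain ⟨⟨i, hi⟩, j, hj⟩ := hc
  obtain ⟨hi, hi'⟩ := Finset.mem_filter.1 hi
  obtain ⟨hj, hj'⟩ := Finset.mem_filter.1 hj
  exact ⟨fun i => cellPt_mem_star _ _, ⟨i, mem_blk₁.1 hi, norm_cellPt_of_isLeaf _ hi'⟩,
    j, mem_blk₂.1 hj, norm_cellPt_of_isLeaf _ hj'⟩

theorem norm_cellsPt_sub_le (n₁ e : ℕ) {M : ℕ} {c u v : Cells k m M} (hu : IsVert c u)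
    (hv : IsVert c v) : ‖cellsPt n₁ e u - cellsPt n₁ e v‖ ≤ 1 / (m + 1) := by
  rw [pi_norm_le_iff_of_nonneg (by positivity)]
  intro i
  have h := norm_cellPt_head_sub_tail (if i.val < 2 * n₁ then 1 else (typ n₁ e i : ZMod k)) (c i)
  have h0 : (0 : ℝ) ≤ 1 / (m + 1) := by positivity
  have hui := hu i
  have hvi := hv i
  rw [Pi.sub_apply, cellsPt, cellsPt]
  split_ifs at hui hvi with he
  · rcases hui with hui | hui <;> rcases hvi with hvi | hvi <;> rw [hui, hvi]
    · rwa [sub_self, norm_zero]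
    · exact h
    · rwa [norm_sub_rev]
    · rwa [sub_self, norm_zero]
  · rw [hui, hvi, sub_self, norm_zero]
    exact h0

theorem cellsPt_shift [Fact k.Prime] {e : ℕ} (hn : n₂ = (k - 1) * e) (g : ZMod k × ZMod k)
    (c : Cells k m (2 * (n₁ + n₂))) :
    cellsPt n₁ e (shiftCells (angle n₁ (slope n₁ n₂ e) g) c) = rot n₁ e g (cellsPt n₁ e c) := by
  funext i
  rw [cellsPt, shiftCells, cellPt_shift, rot, cellsPt]
  congr 2
  unfold angle wangle
  split_ifs with h
  · rw [one_mul]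
  · have := typ_ne_zero hn (not_lt.1 h)
    rw [slope]
    field_simp

/-- A closed equivariant cover of the configuration space has a full row. -/
theorem exists_mem_of_closed_cover [Fact k.Prime] {ℓ a b d e : ℕ} {S : Type*} [Fintype S]
    (hk2 : 3 ≤ k) (ha : 2 ≤ a) (haq : a ≤ k ^ ℓ) (hb : b = (k - 1) * (a - 1))
    (he : e = k ^ ℓ - a + 1) (hd : d + 1 = (k - 1) * e) (hS : Fintype.card S = 2 * k ^ ℓ - 1)
    (A : ZMod k → S → Set (conf k (b + 1) (d + 1))) (hA : ∀ i s, IsClosed (A i s))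
    (hcover : ∀ x, ∃ i s, x ∈ A i s)
    (hshift : ∀ g (x : conf k (b + 1) (d + 1)) i s,
      (⟨rot (b + 1) e g x.1, rot_mem_conf e g x.2⟩ ∈ A (g.2 + i) s ↔ x ∈ A i s)) :
    ∃ x s, ∀ i, x ∈ A i s := by
  have key : ∀ m : ℕ, ∃ s, ∃ y : ZMod k → conf k (b + 1) (d + 1),
      (∀ i, y i ∈ A i s) ∧ ∀ i, dist (y i) (y 0) ≤ 1 / (m + 1) := by
    intro m
    obtain ⟨c, hc, s, h⟩ := exists_full_row (m := m) hk2 ha haq hb he hd rfl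
      (fun c i s => ∃ h : Good (b + 1) (d + 1) c,
        ⟨cellsPt (b + 1) e c, cellsPt_mem_conf e h⟩ ∈ A i ((Fintype.equivFinOfCardEq hS).symm s))
      (fun c hc => by
        obtain ⟨i, s, h⟩ := hcover ⟨cellsPt (b + 1) e c, cellsPt_mem_conf e hc⟩
        exact ⟨i, Fintype.equivFinOfCardEq hS s, hc, by simpa using h⟩)
      (fun g c i s hc => by
        have := hshift g ⟨cellsPt (b + 1) e c, cellsPt_mem_conf e hc⟩ i
          ((Fintype.equivFinOfCardEq hS).symm s)
        simp only [← cellsPt_shift hd] at this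
        simp only [good_shiftCells, hc, exists_true_left, this])
    choose v hv hg hA using h
    refine ⟨_, fun i => ⟨cellsPt (b + 1) e (v i), cellsPt_mem_conf e (hg i)⟩, hA, fun i => ?_⟩
    rw [Subtype.dist_eq, dist_eq_norm]
    exact norm_cellsPt_sub_le _ _ (hv i) (hv 0)
  choose s y hy hd using key
  have : CompactSpace (conf k (b + 1) (d + 1)) := isCompact_iff_compactSpace.1 isCompact_conf
  let _ : TopologicalSpace S := ⊥
  have : DiscreteTopology S := ⟨rfl⟩
  obtain ⟨⟨x, t⟩, -, φ, hφ, hlim⟩ := (isCompact_univ (X := conf k (b + 1) (d + 1) × S)).tendsto_subseq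
    (x := fun m => (y m 0, s m)) fun _ => Set.mem_univ _
  have h1 : Filter.Tendsto (fun n => y (φ n) 0) Filter.atTop (nhds x) :=
    (continuous_fst.tendsto _).comp hlim
  have h2 : Filter.Tendsto (fun n => s (φ n)) Filter.atTop (nhds t) :=
    (continuous_snd.tendsto _).comp hlim
  rw [nhds_discrete, Filter.tendsto_pure] at h2
  refine ⟨x, t, fun i => ?_⟩
  have h3 : Filter.Tendsto (fun n => y (φ n) i) Filter.atTop (nhds x) := by
    refine tendsto_iff_of_dist ?_ |>.2 h1
    refine squeeze_zero (fun _ => dist_nonneg) (fun n => hd (φ n) i) ?_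
    exact tendsto_one_div_add_atTop_nhds_zero_nat.comp hφ.tendsto_atTop
  exact (hA i t).mem_of_tendsto h3 (h2.mono fun n hn => hn ▸ hy (φ n) i)

end Configuration

section Partitions

variable {k : ℕ} [Fact k.Prime]

/-- A partition which is neither discrete nor trivial. -/
def IsProperPart (r : Setoid (ZMod k)) : Prop := (∃ i j, i ≠ j ∧ r i j) ∧ ∃ i j, ¬ r i j

theorem exists_not_rel_add {r : Setoid (ZMod k)} (hr : IsProperPart r) {t : ZMod k} (ht : t ≠ 0) :
    ∃ i, ¬ r i (i + t) := by
  by_contra! h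
  obtain ⟨i, j, hij⟩ := hr.2
  have key : ∀ n : ℕ, r i (i + n * t) := by
    intro n
    induction n with
    | zero => simp
    | succ n ih =>
      have := r.trans ih (h (i + n * t))
      rwa [add_assoc, ← add_one_mul, ← Nat.cast_succ] at this
  refine hij ?_
  have := key ((j - i) / t).val
  rwa [ZMod.natCast_zmod_val, div_mul_cancel₀ _ ht, add_sub_cancel] at this

open Classical in
/-- An equivariant element attached to a partition. -/
noncomputable def partMean (r : Setoid (ZMod k)) : ZMod k :=
  rowMean fun t : Fin (k - 1) => Finset.univ.filter fun i => r i (i + (t.val + 1 : ℕ))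

theorem partMean_shift {r : Setoid (ZMod k)} (hr : IsProperPart r) (g : ZMod k) :
    partMean (Setoid.comap (fun i => i - g) r) = g + partMean r := by
  classical
  have hk := (Fact.out : k.Prime).one_lt
  refine rowMean_image ?_ (fun t h => ?_) g fun t => ?_
  · obtain ⟨i, j, hij, h⟩ := hr.1
    have h1 : (j - i).val ≠ 0 := by
      rw [Ne, ZMod.val_eq_zero, sub_eq_zero]
      exact hij.symm
    have h2 := ZMod.val_lt (j - i)
    refine ⟨⟨(j - i).val - 1, by omega⟩, i, ?_⟩
    rw [Finset.mem_filter]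
    refine ⟨Finset.mem_univ _, ?_⟩
    rwa [Nat.sub_add_cancel (by omega), ZMod.natCast_zmod_val, add_sub_cancel]
  · have ht : ((t.val + 1 : ℕ) : ZMod k) ≠ 0 := by
      rw [Ne, ZMod.natCast_eq_zero_iff]
      exact Nat.not_dvd_of_pos_of_lt (Nat.succ_pos _) (by omega)
    obtain ⟨i, hi⟩ := exists_not_rel_add hr ht
    have hm := Finset.eq_univ_iff_forall.1 h i
    exact hi (Finset.mem_filter.1 hm).2
  · ext i
    simp only [Finset.mem_filter, Finset.mem_univ, true_and, Finset.mem_image, Setoid.comap_rel]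
    constructor
    · intro h
      exact ⟨i - g, by rwa [sub_add_eq_add_sub], by ring⟩
    · rintro ⟨i, h, rfl⟩
      rwa [add_sub_cancel_left, add_assoc, add_sub_cancel_left]

theorem IsProperPart.shift {r : Setoid (ZMod k)} (hr : IsProperPart r) (g : ZMod k) :
    IsProperPart (Setoid.comap (fun i => i - g) r) := by
  obtain ⟨⟨i, j, hij, h⟩, i', j', h'⟩ := hr
  refine ⟨⟨i + g, j + g, fun h => hij (add_right_cancel h), ?_⟩, i' + g, j' + g, ?_⟩
  · simpa [Setoid.comap_rel] using h
  · simpa [Setoid.comap_rel] using h'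

theorem eq_of_le_of_card_quotient_eq {α : Type*} [Finite α] {r s : Setoid α} (h : r ≤ s)
    (hc : Nat.card (Quotient r) = Nat.card (Quotient s)) : r = s := by
  refine le_antisymm h fun x y hxy => ?_
  have hsurj : Function.Surjective (Quotient.map' (s₁ := r) (s₂ := s) id fun x y hxy => h hxy) := by
    rintro ⟨x⟩
    exact ⟨Quotient.mk r x, rfl⟩
  have hinj := (hsurj.bijective_of_nat_card_le hc.le).1
  exact Quotient.exact (hinj (a₁ := Quotient.mk r x) (a₂ := Quotient.mk r y) (Quotient.sound hxy))

theorem not_injective_of_chain {π : ZMod k → Setoid (ZMod k)} (hπ : ∀ i, IsProperPart (π i))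
    (hchain : ∀ i j, π i ≤ π j ∨ π j ≤ π i) : ¬ Function.Injective π := by
  intro hinj
  have hk := (Fact.out : k.Prime).two_le
  have hmaps : ∀ i ∈ (Finset.univ : Finset (ZMod k)),
      Nat.card (Quotient (π i)) ∈ Finset.Ico 2 k := by
    intro i _
    obtain ⟨⟨x, y, hxy, h⟩, x', y', h'⟩ := hπ i
    rw [Finset.mem_Ico]
    constructor
    · have : Nontrivial (Quotient (π i)) :=
        ⟨Quotient.mk _ x', Quotient.mk _ y', fun h => h' (Quotient.exact h)⟩
      exact Finite.one_lt_card
    · by_contra! hle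
      have hle := (Nat.card_zmod k).trans_le hle
      exact hxy ((Quotient.mk_surjective.bijective_of_nat_card_le hle).1 (Quotient.sound h))
  obtain ⟨i, -, j, -, hij, h⟩ := Finset.exists_ne_map_eq_of_card_lt_of_maps_to
    (by rw [Nat.card_Ico, Finset.card_univ, ZMod.card]; omega) hmaps
  refine hij (hinj ?_)
  rcases hchain i j with h' | h'
  · exact eq_of_le_of_card_quotient_eq h' h
  · exact (eq_of_le_of_card_quotient_eq h' h.symm).symm

end Partitions

section Selection

variable {k : ℕ} [Fact k.Prime] {K V T : Type*} [TopologicalSpace K] [MetricSpace V]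

/-- The related pairs of points are closer than the unrelated ones, by a margin. -/
def Gap (w : ZMod k → K → V) (c : ℝ) (r : Setoid (ZMod k)) (x : K) : Prop :=
  ∀ i j i' j', r i j → ¬ r i' j' → dist (w i x) (w j x) + c ≤ dist (w i' x) (w j' x)

omit [Fact k.Prime] [TopologicalSpace K] in
theorem Gap.le_or_le {w : ZMod k → K → V} {c : ℝ} (hc : 0 < c) {r s : Setoid (ZMod k)} {x : K}
    (hr : Gap w c r x) (hs : Gap w c s x) : r ≤ s ∨ s ≤ r := by
  by_contra! h
  obtain ⟨h1, h2⟩ := h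
  simp only [Setoid.le_def, not_forall] at h1 h2
  obtain ⟨i, j, hr1, hs1⟩ := h1
  obtain ⟨i', j', hs2, hr2⟩ := h2
  linarith [hr _ _ _ _ hr1 hr2, hs _ _ _ _ hs2 hs1]

/-- The real and imaginary coordinate functions. -/
def coord (U : T → ZMod k → K → ℂ) (s : T × Bool) (i : ZMod k) (x : K) : ℝ :=
  if s.2 then (U s.1 i x).re else (U s.1 i x).im

omit [Fact k.Prime] in
theorem continuous_coord {U : T → ZMod k → K → ℂ} (hU : ∀ c i, Continuous (U c i)) (s : T × Bool)
    (i : ZMod k) : Continuous (coord U s i) := by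
  unfold coord
  split_ifs
  · exact Complex.continuous_re.comp (hU _ _)
  · exact Complex.continuous_im.comp (hU _ _)

theorem exists_margin [CompactSpace K] {w : ZMod k → K → V} (hw : ∀ i, Continuous (w i))
    {U : T → ZMod k → K → ℂ} (hU : ∀ c i, Continuous (U c i)) (hne : ∀ x, ∃ i j, w i x ≠ w j x)
    (hno : ∀ x, Function.Injective (fun i => w i x) → ∃ c i j, U c i x ≠ U c j x) :
    ∃ c > 0, ∀ x, (∃ r, IsProperPart r ∧ Gap w c r x) ∨
      ∃ s i j, coord U s j x + c ≤ coord U s i x := by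
  set O : ℕ → Set K := fun n => {x | (∃ r, IsProperPart r ∧ ∀ i j i' j', r i j → ¬ r i' j' →
    dist (w i x) (w j x) + 1 / (n + 1) < dist (w i' x) (w j' x)) ∨
      ∃ s i j, coord U s j x + 1 / (n + 1) < coord U s i x} with hO
  have hopen : ∀ n, IsOpen (O n) := by
    intro n
    have h1 : O n = (⋃ r, ⋃ (_ : IsProperPart r), ⋂ i, ⋂ j, ⋂ i', ⋂ j',
        ⋂ (_ : r i j), ⋂ (_ : ¬ r i' j'),
          {x | dist (w i x) (w j x) + 1 / (n + 1) < dist (w i' x) (w j' x)}) ∪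
        ⋃ s, ⋃ i, ⋃ j, {x | coord U s j x + 1 / (n + 1) < coord U s i x} := by
      ext x
      simp [hO]
    rw [h1]
    refine (isOpen_iUnion fun r => isOpen_iUnion fun _ => ?_).union
      (isOpen_iUnion fun s => isOpen_iUnion fun i => isOpen_iUnion fun j => ?_)
    · refine isOpen_iInter_of_finite fun i => isOpen_iInter_of_finite fun j =>
        isOpen_iInter_of_finite fun i' => isOpen_iInter_of_finite fun j' =>
        isOpen_iInter_of_finite fun _ => isOpen_iInter_of_finite fun _ => ?_
      exact isOpen_lt (((hw i).dist (hw j)).add continuous_const) ((hw i').dist (hw j'))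
    · exact isOpen_lt ((continuous_coord hU s j).add continuous_const) (continuous_coord hU s i)
  have hmono : Monotone O := by
    intro n n' hn x hx
    have h : (1 : ℝ) / (n' + 1) ≤ 1 / (n + 1) := one_div_le_one_div_of_le (by positivity)
      (by exact_mod_cast Nat.succ_le_succ hn)
    rcases hx with ⟨r, hr, hx⟩ | ⟨s, i, j, hx⟩
    · exact Or.inl ⟨r, hr, fun i j i' j' h1 h2 => by linarith [hx i j i' j' h1 h2]⟩
    · exact Or.inr ⟨s, i, j, by linarith⟩
  have hcov : Set.univ ⊆ ⋃ n, O n := by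
    intro x _
    rw [Set.mem_iUnion]
    by_cases hinj : Function.Injective fun i => w i x
    · obtain ⟨c, i, j, h⟩ := hno x hinj
      have : ∃ s i j, coord U s j x < coord U s i x := by
        by_cases hre : (U c i x).re = (U c j x).re
        · have him : (U c i x).im ≠ (U c j x).im := fun him => h (Complex.ext hre him)
          rcases him.lt_or_gt with him | him
          · exact ⟨(c, false), j, i, him⟩
          · exact ⟨(c, false), i, j, him⟩
        · rcases lt_or_gt_of_ne hre with hre | hre
          · exact ⟨(c, true), j, i, hre⟩
          · exact ⟨(c, true), i, j, hre⟩
      obtain ⟨s, i, j, h⟩ := this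
      obtain ⟨n, hn⟩ := exists_nat_one_div_lt (sub_pos.2 h)
      exact ⟨n, Or.inr ⟨s, i, j, by linarith⟩⟩
    · set r : Setoid (ZMod k) := Setoid.ker fun i => w i x with hr
      have hrp : IsProperPart r := by
        constructor
        · simp only [Function.Injective, not_forall] at hinj
          obtain ⟨i, j, h, hij⟩ := hinj
          exact ⟨i, j, hij, h⟩
        · exact hne x
      have : ∃ c > 0, ∀ i j, ¬ r i j → c < dist (w i x) (w j x) := by
        have hfin : ∀ q : ZMod k × ZMod k, ∀ᶠ c in nhdsWithin (0 : ℝ) (Set.Ioi 0),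
            ¬ r q.1 q.2 → c < dist (w q.1 x) (w q.2 x) := by
          intro q
          by_cases h : r q.1 q.2
          · exact Filter.Eventually.of_forall fun _ h' => absurd h h'
          · exact Filter.mem_of_superset (Ioo_mem_nhdsGT (dist_pos.2 h)) fun c hc _ => hc.2
        obtain ⟨c, hc, hc0⟩ := ((Filter.eventually_all.2 hfin).and self_mem_nhdsWithin).exists
        exact ⟨c, hc0, fun i j => hc (i, j)⟩
      obtain ⟨c, hc, h⟩ := this
      obtain ⟨n, hn⟩ := exists_nat_one_div_lt hc
      refine ⟨n, Or.inl ⟨r, hrp, fun i j i' j' h1 h2 => ?_⟩⟩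
      have : w i x = w j x := h1
      rw [this, dist_self, zero_add]
      exact hn.trans (h i' j' h2)
  obtain ⟨n, hn⟩ := isCompact_univ.elim_directed_cover O hopen hcov hmono.directed_le
  refine ⟨1 / (n + 1), by positivity, fun x => ?_⟩
  rcases hn (Set.mem_univ x) with ⟨r, hr, hx⟩ | ⟨s, i, j, hx⟩
  · exact Or.inl ⟨r, hr, fun i j i' j' h1 h2 => (hx i j i' j' h1 h2).le⟩
  · exact Or.inr ⟨s, i, j, hx.le⟩

/-- If every closed equivariant cover has a full row, then some point has equal values
and no collisions. -/
theorem exists_injective_of_closed_cover [CompactSpace K] {G : Type*} (σ : G → ZMod k)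
    (ρ : G → K → K)
    (hcover : ∀ A : ZMod k → Option (T × Bool) → Set K, (∀ i s, IsClosed (A i s)) →
      (∀ x, ∃ i s, x ∈ A i s) → (∀ g x i s, ρ g x ∈ A (σ g + i) s ↔ x ∈ A i s) →
      ∃ x s, ∀ i, x ∈ A i s)
    {w : ZMod k → K → V} (hw : ∀ i, Continuous (w i))
    (hwρ : ∀ g x i j, dist (w (σ g + i) (ρ g x)) (w (σ g + j) (ρ g x)) = dist (w i x) (w j x))
    {U : T → ZMod k → K → ℂ} (hU : ∀ c i, Continuous (U c i))
    (hUρ : ∀ g c i x, U c (σ g + i) (ρ g x) = U c i x) (hne : ∀ x, ∃ i j, w i x ≠ w j x) :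
    ∃ x, Function.Injective (fun i => w i x) ∧ ∀ c i j, U c i x = U c j x := by
  by_contra! hno
  obtain ⟨c, hc, hmar⟩ := exists_margin hw hU hne hno
  have hfin : Finite (Setoid (ZMod k)) :=
    Finite.of_injective (fun r : Setoid (ZMod k) => (r : ZMod k → ZMod k → Prop))
      fun r s h => Setoid.ext fun i j => iff_of_eq (congrFun (congrFun h i) j)
  have hUρ' : ∀ g s i x, coord U s (σ g + i) (ρ g x) = coord U s i x := fun g s i x => by
    simp only [coord, hUρ]
  have hGap : ∀ g r x, Gap w c r x → Gap w c (Setoid.comap (fun i => i - σ g) r) (ρ g x) := by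
    intro g r x h i j i' j' h1 h2
    have := h _ _ _ _ h1 h2
    rwa [← hwρ g, ← hwρ g x (i' - σ g), add_sub_cancel, add_sub_cancel, add_sub_cancel,
      add_sub_cancel] at this
  have hGap' : ∀ g r x, Gap w c r (ρ g x) → Gap w c (Setoid.comap (fun i => i - -σ g) r) x := by
    intro g r x h i j i' j' h1 h2
    rw [Setoid.comap_rel, sub_neg_eq_add, sub_neg_eq_add] at h1 h2
    have := h _ _ _ _ h1 h2
    rwa [add_comm i, add_comm j, add_comm i', add_comm j', hwρ, hwρ] at this
  set A : ZMod k → Option (T × Bool) → Set K := fun i s => s.elim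
    {x | ∃ r, IsProperPart r ∧ i = partMean r ∧ Gap w c r x}
    fun s => {x | (∃ j, coord U s j x + c ≤ coord U s i x) ∧ ∀ j, coord U s j x ≤ coord U s i x}
    with hA
  have hclosed : ∀ i s, IsClosed (A i s) := by
    intro i s
    rcases s with _ | s
    · have : A i none = ⋃ r, ⋃ (_ : IsProperPart r ∧ i = partMean r),
          ⋂ i, ⋂ j, ⋂ i', ⋂ j', ⋂ (_ : r i j), ⋂ (_ : ¬ r i' j'),
            {x | dist (w i x) (w j x) + c ≤ dist (w i' x) (w j' x)} := by
        ext x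
        simp [hA, Gap, and_assoc]
      rw [this]
      refine isClosed_iUnion_of_finite fun r => isClosed_iUnion_of_finite fun _ =>
        isClosed_iInter fun i => isClosed_iInter fun j =>
        isClosed_iInter fun i' => isClosed_iInter fun j' => isClosed_iInter fun _ =>
        isClosed_iInter fun _ => ?_
      exact isClosed_le (((hw i).dist (hw j)).add continuous_const) ((hw i').dist (hw j'))
    · have : A i (some s) = (⋃ j, {x | coord U s j x + c ≤ coord U s i x}) ∩
          ⋂ j, {x | coord U s j x ≤ coord U s i x} := by
        ext x
        simp [hA]
      rw [this]
      refine (isClosed_iUnion_of_finite fun j => ?_).inter (isClosed_iInter fun j => ?_)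
      · exact isClosed_le ((continuous_coord hU s j).add continuous_const) (continuous_coord hU s i)
      · exact isClosed_le (continuous_coord hU s j) (continuous_coord hU s i)
  have hcov : ∀ x, ∃ i s, x ∈ A i s := by
    intro x
    rcases hmar x with ⟨r, hr, h⟩ | ⟨s, i, j, h⟩
    · exact ⟨partMean r, none, r, hr, rfl, h⟩
    · obtain ⟨i', hi'⟩ := Finite.exists_max fun i => coord U s i x
      exact ⟨i', some s, ⟨j, h.trans (hi' i)⟩, hi'⟩
  have hequiv : ∀ g x i s, ρ g x ∈ A (σ g + i) s ↔ x ∈ A i s := by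
    intro g x i s
    rcases s with _ | s
    · constructor
      · rintro ⟨r, hr, hi, h⟩
        refine ⟨_, hr.shift _, ?_, hGap' g r x h⟩
        rw [partMean_shift hr, ← hi, neg_add_cancel_left]
      · rintro ⟨r, hr, hi, h⟩
        exact ⟨_, hr.shift _, by rw [partMean_shift hr, hi], hGap g r x h⟩
    · have key : ∀ P : ZMod k → Prop, (∀ j, P j) ↔ ∀ j, P (σ g + j) := fun P =>
        (Equiv.forall_congr_right (Equiv.addLeft (σ g))).symm
      have key' : ∀ P : ZMod k → Prop, (∃ j, P j) ↔ ∃ j, P (σ g + j) := fun P =>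
        (Equiv.exists_congr_right (Equiv.addLeft (σ g))).symm
      change ((∃ j, _) ∧ ∀ j, _) ↔ _
      rw [key, key']
      simp only [hUρ']
      exact Iff.rfl
  obtain ⟨x, s, hx⟩ := hcover A hclosed hcov hequiv
  rcases s with _ | s
  · choose π hπ hi hg using hx
    refine not_injective_of_chain hπ (fun i j => (hg i).le_or_le hc (hg j)) fun i j h => ?_
    rw [hi i, hi j, h]
  · obtain ⟨j, hj⟩ := (hx 0).1
    linarith [(hx j).2 0]

end Selection

open Filter Topology

section PairSums

variable {k n₁ n₂ e N : ℕ}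

/-- The sum of two consecutive coordinates. -/
noncomputable def pairSum (x : Fin (2 * N) → ℂ) (q : ℕ) : ℂ :=
  if h : q < N then x (ev ⟨q, h⟩) + x (od ⟨q, h⟩) else 0

theorem continuous_pairSum (q : ℕ) : Continuous fun x : Fin (2 * N) → ℂ => pairSum x q := by
  unfold pairSum
  split_ifs <;> fun_prop

theorem wangle_two_mul_add_one (g : ZMod k × ZMod k) (q : ℕ) :
    wangle n₁ e g (2 * q + 1) = wangle n₁ e g (2 * q) := by
  have h : (2 * q + 1 < 2 * n₁) = (2 * q < 2 * n₁) := propext (by omega)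
  have ht : 2 * n₁ ≤ 2 * q → typ n₁ e (2 * q + 1) = typ n₁ e (2 * q) := by
    intro hq
    rw [typ, typ, ← Nat.div_div_eq_div_mul, ← Nat.div_div_eq_div_mul]
    congr 2
    omega
  simp only [wangle, h]
  split_ifs with hq
  · rfl
  · rw [ht (not_lt.1 hq)]

theorem wangle_of_lt (g : ZMod k × ZMod k) {q : ℕ} (hq : q < n₁) :
    wangle n₁ e g (2 * q) = g.1 :=
  if_pos (by omega)

theorem wangle_add (g : ZMod k × ZMod k) (j : ℕ) {μ : ℕ} (hμ : μ < e) :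
    wangle n₁ e g (2 * (n₁ + (j * e + μ))) = g.1 + (j + 1) * g.2 := by
  have h : typ n₁ e (2 * (n₁ + (j * e + μ))) = j + 1 := by
    rw [typ, ← mul_tsub, add_tsub_cancel_left, Nat.mul_div_mul_left _ _ two_pos, mul_comm j,
      Nat.mul_add_div (by omega), Nat.div_eq_of_lt hμ, add_zero]
  rw [wangle, if_neg (by omega), h, Nat.cast_succ]

variable [NeZero k]

theorem pairSum_ne_zero (hk : Odd k) {x : Fin (2 * N) → ℂ} (hx : ∀ i, x i ∈ star k)
    {i : Fin (2 * N)} (hi : ‖x i‖ = 1) : pairSum x (i.val / 2) ≠ 0 := by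
  have hq : i.val / 2 < N := by omega
  rw [pairSum, dif_pos hq]
  rcases Nat.mod_two_eq_zero_or_one i.val with h | h
  · have : ev ⟨i.val / 2, hq⟩ = i := Fin.ext (by simp only [ev]; omega)
    rw [this]
    exact add_ne_zero_of_mem_star hk (hx _) (hx _) hi
  · have : od ⟨i.val / 2, hq⟩ = i := Fin.ext (by simp only [od]; omega)
    rw [this, add_comm]
    exact add_ne_zero_of_mem_star hk (hx _) (hx _) hi

theorem pairSum_rot (g : ZMod k × ZMod k) (x : Fin (2 * N) → ℂ) (q : ℕ) :
    pairSum (rot n₁ e g x) q = ZMod.stdAddChar (wangle n₁ e g (2 * q)) * pairSum x q := by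
  unfold pairSum
  split_ifs with h
  · simp only [rot, ev, od, wangle_two_mul_add_one, mul_add]
  · rw [mul_zero]

/-- The vector read off the first block. -/
noncomputable def zmap (n₁ e : ℕ) (x : Fin (2 * N) → ℂ) : EuclideanSpace ℂ (Fin e) :=
  WithLp.toLp 2 fun μ => if μ.val < n₁ then pairSum x μ else 0

/-- The vectors read off the second block by a discrete Fourier transform. -/
noncomputable def wmap (n₁ e : ℕ) (t : ZMod k) (x : Fin (2 * N) → ℂ) : EuclideanSpace ℂ (Fin e) :=
  WithLp.toLp 2 fun μ => ∑ j : Fin (k - 1),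
    ZMod.stdAddChar (-(t * ((j.val : ZMod k) + 1))) * pairSum x (n₁ + (j.val * e + μ.val))

theorem continuous_zmap : Continuous fun x : Fin (2 * N) → ℂ => zmap n₁ e x := by
  refine (PiLp.continuous_toLp 2 _).comp (continuous_pi fun μ => ?_)
  split_ifs
  · exact continuous_pairSum _
  · exact continuous_const

theorem continuous_wmap (t : ZMod k) : Continuous fun x : Fin (2 * N) → ℂ => wmap n₁ e t x :=
  (PiLp.continuous_toLp 2 _).comp (continuous_pi fun _ => continuous_finsetSum _ fun _ _ =>
    continuous_const.mul (continuous_pairSum _))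

theorem zmap_rot (g : ZMod k × ZMod k) (x : Fin (2 * N) → ℂ) :
    zmap n₁ e (rot n₁ e g x) = ZMod.stdAddChar g.1 • zmap n₁ e x := by
  ext μ
  simp only [zmap, PiLp.smul_apply, smul_eq_mul]
  split_ifs with h
  · rw [pairSum_rot, wangle_of_lt g h]
  · rw [mul_zero]

theorem wmap_rot (g : ZMod k × ZMod k) (t : ZMod k) (x : Fin (2 * N) → ℂ) :
    wmap n₁ e (g.2 + t) (rot n₁ e g x) = ZMod.stdAddChar g.1 • wmap n₁ e t x := by
  ext μ
  simp only [wmap, PiLp.smul_apply, smul_eq_mul, Finset.mul_sum]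
  refine Finset.sum_congr rfl fun j _ => ?_
  rw [pairSum_rot, wangle_add g _ μ.2, ← mul_assoc, ← mul_assoc, ← AddChar.map_add_eq_mul,
    ← AddChar.map_add_eq_mul]
  congr 2
  ring

theorem zmap_ne_zero (hk : Odd k) (hn : n₁ ≤ e) {x : Fin (2 * (n₁ + n₂)) → ℂ}
    (hx : x ∈ conf k n₁ n₂) : zmap n₁ e x ≠ 0 := by
  obtain ⟨hs, ⟨i, hi, h1⟩, -⟩ := hx
  intro h
  have := congrArg (fun v : EuclideanSpace ℂ (Fin e) => v ⟨i.val / 2, by omega⟩) h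
  simp only [zmap, PiLp.zero_apply] at this
  rw [if_pos (by omega)] at this
  exact pairSum_ne_zero hk hs h1 this

theorem exists_wmap_ne (hk : Odd k) (hn : n₂ = (k - 1) * e) {x : Fin (2 * (n₁ + n₂)) → ℂ}
    (hx : x ∈ conf k n₁ n₂) : ∃ s t : ZMod k, wmap n₁ e s x ≠ wmap n₁ e t x := by
  obtain ⟨hs, -, i, hi, h1⟩ := hx
  by_contra! hall
  have hne := pairSum_ne_zero hk hs h1
  set q := i.val / 2 - n₁ with hq
  have hqn : q < (k - 1) * e := by have := i.2; omega
  have he : 0 < e := Nat.pos_of_mul_pos_left (pos_of_gt hqn)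
  set j : Fin (k - 1) := ⟨q / e, Nat.div_lt_of_lt_mul (by rwa [mul_comm])⟩ with hj
  set μ : Fin e := ⟨q % e, Nat.mod_lt _ he⟩ with hμ
  have hqe : n₁ + (j * e + μ) = i.val / 2 := by
    simp only [hj, hμ]
    rw [Nat.div_add_mod' q e]
    omega
  have hk0 : (k : ℂ) ≠ 0 := by exact_mod_cast NeZero.ne k
  have hort : ∀ m : ZMod k, ∑ t : ZMod k, ZMod.stdAddChar (t * m) =
      if m = 0 then (k : ℂ) else 0 := by
    intro m
    rw [AddChar.sum_mulShift m (ZMod.isPrimitive_stdAddChar k), ZMod.card]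
    split_ifs <;> simp
  have hcast : ∀ j' : Fin (k - 1), ((j'.val : ZMod k) + 1 = 0) → False := by
    intro j' h
    rw [← Nat.cast_succ, ZMod.natCast_eq_zero_iff] at h
    exact Nat.not_dvd_of_pos_of_lt (Nat.succ_pos _) (by omega) h
  have hS1 : ∑ t : ZMod k, ZMod.stdAddChar (t * ((j.val : ZMod k) + 1)) * wmap n₁ e t x μ
      = k * pairSum x (i.val / 2) := by
    simp only [wmap, Finset.mul_sum]
    rw [Finset.sum_comm, Finset.sum_eq_single j]
    · simp only [← mul_assoc, ← AddChar.map_add_eq_mul, hqe]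
      rw [← Finset.sum_mul]
      simp
    · intro j' _ hj'
      simp only [← mul_assoc, ← AddChar.map_add_eq_mul]
      rw [← Finset.sum_mul]
      have : ∀ t : ZMod k, t * ((j.val : ZMod k) + 1) + -(t * ((j'.val : ZMod k) + 1)) =
          t * ((j.val : ZMod k) - j'.val) := fun t => by ring
      simp only [this]
      rw [hort, if_neg, zero_mul]
      rw [sub_eq_zero, ZMod.natCast_eq_natCast_iff', Nat.mod_eq_of_lt (by omega),
        Nat.mod_eq_of_lt (by omega)]
      exact fun h => hj' (Fin.ext h.symm)
    · exact fun h => absurd (Finset.mem_univ _) h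
  have hS2 : ∑ t : ZMod k, ZMod.stdAddChar (t * ((j.val : ZMod k) + 1)) * wmap n₁ e t x μ = 0 := by
    simp only [hall _ (0 : ZMod k)]
    rw [← Finset.sum_mul, hort, if_neg (hcast j), zero_mul]
  exact mul_ne_zero hk0 hne (hS1.symm.trans hS2)

end PairSums

section Perturbation

variable {k : ℕ} [NeZero k] {K E Y : Type*} [TopologicalSpace K] [CompactSpace K]
  [NormedAddCommGroup E] [InnerProductSpace ℂ E] [TopologicalSpace Y]

theorem eventually_mk_mem {v : E} (hv : v ≠ 0) {U : Set (Projectivization ℂ E)}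
    (hU : U ∈ 𝓝 (Projectivization.mk ℂ v hv)) :
    ∀ᶠ u in 𝓝 v, ∀ h : u ≠ 0, Projectivization.mk ℂ u h ∈ U := by
  have hc : Continuous fun u : {u : E // u ≠ 0} => Projectivization.mk ℂ u.1 u.2 :=
    continuous_quotient_mk'
  have h := (hc.tendsto ⟨v, hv⟩) hU
  obtain ⟨W, hW, hWU⟩ := (mem_nhds_induced _ _ _).1 (mem_map.1 h)
  exact mem_of_superset hW fun u hu h => hWU (a := ⟨u, h⟩) hu

theorem mk_add_smul_ne {z w w' : E} {τ : ℂ} (hτ : τ ≠ 0) (hw : w ≠ w')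
    (hz : inner ℂ z (z + τ • w') ≠ 0) (hzw : inner ℂ z w = inner ℂ z w') (h : z + τ • w ≠ 0)
    (h' : z + τ • w' ≠ 0) :
    Projectivization.mk ℂ (z + τ • w) h ≠ Projectivization.mk ℂ (z + τ • w') h' := by
  rw [Ne, Projectivization.mk_eq_mk_iff']
  rintro ⟨c, hc⟩
  have h1 := congrArg (inner ℂ z) hc
  have h2 : inner ℂ z (z + τ • w) = inner ℂ z (z + τ • w') := by
    simp only [inner_add_right, inner_smul_right, hzw]
  rw [inner_smul_right, h2, mul_left_eq_self₀] at h1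
  rw [h1.resolve_right hz, one_smul, add_right_inj] at hc
  exact hw (smul_right_injective E hτ hc).symm

/-- A map with multiplicities at arbitrarily small perturbations of nonzero vectors admits
a local multiplicity. -/
theorem admitsLocalMultiplicity_of_perturbation {z : K → E} (hz : Continuous z)
    (hz0 : ∀ x, z x ≠ 0) {w : ZMod k → K → E} (hw : ∀ i, Continuous (w i))
    (f : Projectivization ℂ E → Y)
    (h : ∀ τ : ℂ, τ ≠ 0 → ∃ x, ∀ hne : ∀ i, z x + τ • w i x ≠ 0,
      Function.Injective (fun i => w i x) ∧
      (∀ i j, inner ℂ (z x) (w i x) = inner ℂ (z x) (w j x)) ∧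
      ∀ i j, f (Projectivization.mk ℂ _ (hne i)) = f (Projectivization.mk ℂ _ (hne j))) :
    AdmitsLocalMultiplicity f k := by
  have hτ : ∀ n : ℕ, (1 : ℂ) / (n + 1) ≠ 0 := fun n => one_div_ne_zero (Nat.cast_add_one_ne_zero n)
  choose x hx using fun n : ℕ => h (1 / (n + 1)) (hτ n)
  obtain ⟨y, -, hy⟩ := isCompact_univ.ultrafilter_le_nhds ((hyperfilter ℕ).map x) (by simp)
  have hxy : Tendsto x (hyperfilter ℕ) (𝓝 y) := hy
  have hτ0 : Tendsto (fun n : ℕ => (1 : ℂ) / (n + 1)) (hyperfilter ℕ) (𝓝 0) :=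
    tendsto_one_div_add_atTop_nhds_zero_nat.mono_left Nat.hyperfilter_le_atTop
  have hzx : Tendsto (fun n => z (x n)) (hyperfilter ℕ) (𝓝 (z y)) := (hz.tendsto y).comp hxy
  have hp : ∀ i, Tendsto (fun n : ℕ => z (x n) + ((1 : ℂ) / (n + 1)) • w i (x n)) (hyperfilter ℕ)
      (𝓝 (z y)) := by
    intro i
    have := hzx.add (hτ0.smul (((hw i).tendsto y).comp hxy))
    rwa [zero_smul, add_zero] at this
  refine ⟨Projectivization.mk ℂ (z y) (hz0 y), fun U hU => ?_⟩
  have h1 : ∀ᶠ n in hyperfilter ℕ, ∀ i, z (x n) + ((1 : ℂ) / (n + 1)) • w i (x n) ≠ 0 :=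
    eventually_all.2 fun i => (hp i).eventually_ne (hz0 y)
  have h2 : ∀ᶠ n in hyperfilter ℕ, ∀ i,
      inner ℂ (z (x n)) (z (x n) + ((1 : ℂ) / (n + 1)) • w i (x n)) ≠ 0 :=
    eventually_all.2 fun i => (hzx.inner (hp i)).eventually_ne (inner_self_ne_zero.2 (hz0 y))
  have h3 : ∀ᶠ n in hyperfilter ℕ, ∀ i, ∀ hne : z (x n) + ((1 : ℂ) / (n + 1)) • w i (x n) ≠ 0,
      Projectivization.mk ℂ _ hne ∈ U :=
    eventually_all.2 fun i => (hp i).eventually (eventually_mk_mem (hz0 y) hU)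
  obtain ⟨n, hn1, hn2, hn3⟩ := (h1.and (h2.and h3)).exists
  obtain ⟨hinj, hin, hf⟩ := hx n hn1
  refine ⟨fun i => Projectivization.mk ℂ _ (hn1 (ZMod.finEquiv k i)), fun i j hij => ?_,
    fun i => hn3 _ _, fun i j => hf _ _⟩
  by_contra hne
  exact mk_add_smul_ne (hτ n) (fun hw => hne ((ZMod.finEquiv k).injective (hinj hw))) (hn2 _)
    (hin _ _) _ _ hij

end Perturbation

end FineStar

/-- Every continuous map `ℂP^{k^ℓ-a} → ℂ^{k^ℓ-2}` admits a local `k`-multiplicity,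
whenever `k` is an odd prime, `2 ≤ a ≤ (k^ℓ+1)/2` and `k(a-1) ≤ k^ℓ - 1`. -/
theorem localMultiplicity_of_continuous_complexProjective_to_complexEuclidean
    (a ℓ k : ℕ) (ha : 1 ≤ a) (hℓ : 1 ≤ ℓ) (hkprime : Nat.Prime k) (hkodd : Odd k)
    (ha2 : 2 ≤ a) (ha3 : 2 * a ≤ k ^ ℓ + 1)
    (hka : k * (a - 1) ≤ k ^ ℓ - 1)
    (f : Projectivization ℂ (EuclideanSpace ℂ (Fin (k ^ ℓ - a + 1))) →
      EuclideanSpace ℂ (Fin (k ^ ℓ - 2)))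
    (hf : Continuous f) :
    AdmitsLocalMultiplicity f k := by
  have : Fact k.Prime := ⟨hkprime⟩
  have hk3 : 3 ≤ k := by
    have := hkprime.two_le
    obtain ⟨m, rfl⟩ := hkodd
    omega
  have hq : 1 ≤ k ^ ℓ := Nat.one_le_pow _ _ hkprime.pos
  have hcard : Fintype.card (Option (Option (Fin (k ^ ℓ - 2)) × Bool)) = 2 * k ^ ℓ - 1 := by
    simp only [Fintype.card_option, Fintype.card_prod, Fintype.card_fin, Fintype.card_bool]
    omega
  obtain ⟨b, hb⟩ : ∃ b, b = (k - 1) * (a - 1) := ⟨_, rfl⟩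
  have hbe : b + 1 ≤ k ^ ℓ - a + 1 := by
    rw [tsub_mul, one_mul] at hb
    omega
  clear hℓ
  generalize he : k ^ ℓ - a + 1 = e at *
  obtain ⟨d, hd⟩ : ∃ d, d + 1 = (k - 1) * e :=
    ⟨(k - 1) * e - 1, Nat.sub_add_cancel (Nat.mul_pos (by omega) (by omega))⟩
  set K := FineStar.conf k (b + 1) (d + 1)
  have : CompactSpace K := isCompact_iff_compactSpace.1 FineStar.isCompact_conf
  have hz : Continuous fun x : K => FineStar.zmap (b + 1) e x.1 :=
    FineStar.continuous_zmap.comp continuous_subtype_val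
  have hw : ∀ i : ZMod k, Continuous fun x : K => FineStar.wmap (b + 1) e i x.1 := fun i =>
    (FineStar.continuous_wmap i).comp continuous_subtype_val
  refine FineStar.admitsLocalMultiplicity_of_perturbation hz
    (fun x => FineStar.zmap_ne_zero hkodd hbe x.2) hw f fun τ hτ => ?_
  by_contra! hno
  choose hne hno using hno
  have hp : ∀ i, Continuous fun x : K =>
      FineStar.zmap (b + 1) e x.1 + τ • FineStar.wmap (b + 1) e i x.1 := fun i =>
    hz.add ((hw i).const_smul τ)
  have hmk : ∀ i, Continuous fun x : K => Projectivization.mk ℂ _ (hne x i) := fun i =>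
    continuous_quotient_mk'.comp ((hp i).subtype_mk fun x => hne x i)
  obtain ⟨x, hinj, hx⟩ := FineStar.exists_injective_of_closed_cover
    (T := Option (Fin (k ^ ℓ - 2))) Prod.snd
    (fun g (x : K) => ⟨FineStar.rot (b + 1) e g x.1, FineStar.rot_mem_conf e g x.2⟩)
    (fun A hA hcover hshift => FineStar.exists_mem_of_closed_cover hk3 ha2 (by omega) hb he.symm hd
      hcard A hA hcover hshift)
    (w := fun i x => FineStar.wmap (b + 1) e i x.1) hw
    (fun g x i j => by
      simp only [FineStar.wmap_rot]
      rw [dist_smul₀, AddChar.norm_apply, one_mul])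
    (U := fun c i x => c.elim
      (inner ℂ (FineStar.zmap (b + 1) e x.1) (FineStar.wmap (b + 1) e i x.1))
      fun c => f (Projectivization.mk ℂ _ (hne x i)) c)
    (fun c i => by
      cases c with
      | none => exact hz.inner (hw i)
      | some c => exact (EuclideanSpace.proj (𝕜 := ℂ) c).continuous.comp (hf.comp (hmk i)))
    (fun g c i x => by
      cases c with
      | none =>
        simp only [Option.elim, FineStar.wmap_rot, FineStar.zmap_rot, inner_smul_left,
          inner_smul_right]
        rw [← mul_assoc, Complex.mul_conj', AddChar.norm_apply]
        simp
      | some c =>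
        refine congrArg (fun p => f p c) ((Projectivization.mk_eq_mk_iff' _ _ _ _ _).2
          ⟨ZMod.stdAddChar g.1, ?_⟩)
        simp only [FineStar.wmap_rot, FineStar.zmap_rot]
        rw [smul_add, smul_comm τ])
    (fun x => FineStar.exists_wmap_ne hkodd hd x.2)
  obtain ⟨i, j, h⟩ := hno x hinj fun i j => hx none i j
  refine h ?_
  ext c
  exact hx (some c) i j
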